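/- arXiv:2007.08562 — 4 statements merged into one kernel-verified Lean document; each statement's English description precedes it below -/
import Mathlib

section
/- Let R be a commutative noetherian local ring and M a bounded complex of finitely generated R-modules (equivalently an object of the bounded derived category with finitely generated homology). If M has finite projective dimension, i.e. Ext_R^i(M, k) = 0 for all i ≫ 0 where k is the residue field, then M is isomorphic in the derived category to a bounded complex of finitely generated free R-modules. -/
open CategoryTheory Limits

attribute [local instance] HasDerivedCategory.standard

/-- The mapping cone of `f` is acyclic, in terms of elements. -/
def ConeAcyclic {R : Type} [CommRing R] {P M : CochainComplex (ModuleCat.{0} R) ℤ} (f : P ⟶ M) : Prop :=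
  ∀ (i : ℤ) (p : P.X (i + 1)) (m : M.X i), P.d (i + 1) (i + 1 + 1) p = 0 →
    f.f (i + 1) p = M.d i (i + 1) m →
    ∃ (p' : P.X i) (m' : M.X (i - 1)), P.d i (i + 1) p' = p ∧ m = f.f i p' + M.d (i - 1) i m'

lemma ConeAcyclic.quasiIso {R : Type} [CommRing R] {P M : CochainComplex (ModuleCat.{0} R) ℤ}
    {f : P ⟶ M} (h : ConeAcyclic f) : QuasiIso f := by
  rw [quasiIso_iff]
  intro j
  rw [quasiIsoAt_iff_isIso_homologyMap]
  have h1 : Mono (HomologicalComplex.homologyMap f j) := by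
    obtain ⟨i, rfl⟩ : ∃ i, j = i + 1 := ⟨j - 1, by ring⟩
    rw [HomologicalComplex.mono_homologyMap_iff_up_to_refinements f i (i + 1) (i + 1 + 1)
      (by simp) (by simp)]
    intro A x hx y hy
    let W : Submodule R (A × P.X i) :=
      LinearMap.ker (x.hom.comp (LinearMap.fst R A (P.X i)) -
        (P.d i (i + 1)).hom.comp (LinearMap.snd R A (P.X i)))
    refine ⟨ModuleCat.of R W, ModuleCat.ofHom ((LinearMap.fst R A (P.X i)).comp W.subtype), ?_,
      ModuleCat.ofHom ((LinearMap.snd R A (P.X i)).comp W.subtype), ?_⟩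
    · rw [ModuleCat.epi_iff_surjective]
      intro a
      obtain ⟨p', m', h1, h2⟩ := h i (x a) (y a) (by simpa using congr($hx a))
        (by simpa using congr($hy a))
      exact ⟨⟨(a, p'), by simp [W, h1]⟩, rfl⟩
    · ext w
      have := w.2
      simp only [W, LinearMap.mem_ker, LinearMap.sub_apply, sub_eq_zero] at this
      exact this
  have h2 : Epi (HomologicalComplex.homologyMap f j) := by
    rw [HomologicalComplex.epi_homologyMap_iff_up_to_refinements f (j - 1) j (j + 1)
      (by simp) (by simp)]
    intro A y hy
    let W : Submodule R (A × (P.X j × M.X (j - 1))) :=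
      LinearMap.ker (y.hom.comp (LinearMap.fst R A (P.X j × M.X (j - 1))) -
        ((f.f j).hom.coprod (M.d (j - 1) j).hom).comp (LinearMap.snd R A (P.X j × M.X (j - 1)))) ⊓
      LinearMap.ker ((P.d j (j + 1)).hom.comp ((LinearMap.fst R _ _).comp
        (LinearMap.snd R A (P.X j × M.X (j - 1)))))
    refine ⟨ModuleCat.of R W, ModuleCat.ofHom ((LinearMap.fst R A _).comp W.subtype), ?_,
      ModuleCat.ofHom ((LinearMap.fst R _ _).comp ((LinearMap.snd R A _).comp W.subtype)), ?_,
      ModuleCat.ofHom ((LinearMap.snd R _ _).comp ((LinearMap.snd R A _).comp W.subtype)), ?_⟩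
    · rw [ModuleCat.epi_iff_surjective]
      intro a
      obtain ⟨p', m', h1, h2⟩ := h j 0 (y a) (by simp)
        (by simpa using congr($hy a).symm)
      exact ⟨⟨(a, p', m'), by simp [W, h1, h2]⟩, rfl⟩
    · ext w
      exact w.2.2
    · ext w
      have := LinearMap.mem_ker.1 w.2.1
      rw [LinearMap.sub_apply, sub_eq_zero] at this
      exact this
  exact isIso_of_mono_of_epi _

lemma exists_step_aux {R : Type} [CommRing R] [IsNoetherianRing R] {X0 X1 X2 : Type}
    [AddCommGroup X0] [Module R X0] [AddCommGroup X1] [Module R X1] [AddCommGroup X2] [Module R X2]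
    (a : X0 →ₗ[R] X1) (b : X1 →ₗ[R] X2) (N : Submodule R X1) (hN : N.FG)
    (hNb : N ≤ LinearMap.ker b) (hN2 : LinearMap.ker b ≤ N ⊔ LinearMap.range a)
    (r : ℕ) (f : (Fin r → R) →ₗ[R] X2) (Z : Submodule R (Fin r → R)) :
    ∃ (r' : ℕ) (d : (Fin r' → R) →ₗ[R] (Fin r → R)) (f' : (Fin r' → R) →ₗ[R] X1),
      (∀ v, d v ∈ Z) ∧ (∀ v, f (d v) = b (f' v)) ∧
      ∀ p ∈ Z, ∀ m, f p = b m → ∃ p' m', d p' = p ∧ m = f' p' + a m' := by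
  let W : Submodule R ((Fin r → R) × X1) :=
    Z.comap (LinearMap.fst R _ _) ⊓ LinearMap.ker (f.comp (LinearMap.fst R _ _) -
      b.comp (LinearMap.snd R _ _))
  have hW : ∀ p m, (p, m) ∈ W ↔ p ∈ Z ∧ f p = b m := by
    intro p m
    simp [W, sub_eq_zero]
  have h1 : (W.map (LinearMap.fst R _ _)).FG := IsNoetherian.noetherian _
  obtain ⟨n, g, hg⟩ := (Submodule.fg_iff_exists_fin_linearMap R _).1 h1
  have hg1 : ∀ v, ∃ m, (g v, m) ∈ W := by
    intro v
    have : g v ∈ W.map (LinearMap.fst R _ _) := hg ▸ ⟨v, rfl⟩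
    obtain ⟨⟨p, m⟩, h, h'⟩ := this
    exact ⟨m, by simpa [← h'] using h⟩
  choose q hq using fun i : Fin n => hg1 (Pi.single i 1)
  let q' : (Fin n → R) →ₗ[R] X1 := (Pi.basisFun R (Fin n)).constr R q
  have hq' : ∀ v, (g v, q' v) ∈ W := by
    intro v
    have : LinearMap.range (g.prod q') ≤ W := by
      rw [LinearMap.range_eq_map, ← (Pi.basisFun R (Fin n)).span_eq, Submodule.map_span,
        Submodule.span_le]
      rintro _ ⟨_, ⟨i, rfl⟩, rfl⟩
      simpa [q', Module.Basis.constr_basis, -Pi.basisFun_apply] using (by simpa using hq i)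
    exact this ⟨v, rfl⟩
  obtain ⟨l, e, he⟩ := (Submodule.fg_iff_exists_fin_linearMap R _).1 hN
  let c : (Fin (n + l) → R) ≃ₗ[R] (Fin n → R) × (Fin l → R) :=
    (LinearEquiv.funCongrLeft R R finSumFinEquiv).trans (LinearEquiv.sumArrowLequivProdArrow _ _ R R)
  have hec : ∀ v, b (e v) = 0 := fun v => hNb (he ▸ ⟨v, rfl⟩)
  refine ⟨n + l, (g.comp (LinearMap.fst R _ _)).comp c.toLinearMap,
    (q'.coprod e).comp c.toLinearMap, ?_, ?_, ?_⟩
  · intro v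
    exact ((hW _ _).1 (hq' _)).1
  · intro v
    simpa [hec] using ((hW _ _).1 (hq' (c v).1)).2
  · intro p hp m hm
    have : p ∈ W.map (LinearMap.fst R _ _) := ⟨(p, m), (hW _ _).2 ⟨hp, hm⟩, rfl⟩
    rw [← hg] at this
    obtain ⟨v, rfl⟩ := this
    have h3 : m - q' v ∈ LinearMap.ker b := by
      simp [← hm, ((hW _ _).1 (hq' v)).2]
    obtain ⟨_, h4, _, ⟨m', rfl⟩, h5⟩ := Submodule.mem_sup.1 (hN2 h3)
    rw [← he] at h4
    obtain ⟨w, rfl⟩ := h4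
    refine ⟨c.symm (v, w), m', by simp, ?_⟩
    simp [add_assoc, h5]

/-- State of the recursive construction in degree `i`. -/
structure ResState {R : Type} [CommRing R] (M : CochainComplex (ModuleCat.{0} R) ℤ) (i : ℤ) where
  r : ℕ
  f : (Fin r → R) →ₗ[R] M.X i
  Z : Submodule R (Fin r → R)

/-- The compatibility between consecutive states. -/
def ResState.Rel {R : Type} [CommRing R] {M : CochainComplex (ModuleCat.{0} R) ℤ} {i : ℤ}
    (t : ResState M i) (u : ResState M (i + 1)) : Prop :=
  ∃ d : (Fin t.r → R) →ₗ[R] (Fin u.r → R), LinearMap.ker d = t.Z ∧ (∀ v, d v ∈ u.Z) ∧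
    (∀ v, u.f (d v) = M.d i (i + 1) (t.f v)) ∧
    ∀ p ∈ u.Z, ∀ m, u.f p = M.d i (i + 1) m → ∃ p' m', d p' = p ∧ m = t.f p' + M.d (i - 1) i m'

lemma exists_fg_homology {R : Type} [CommRing R] (M : CochainComplex (ModuleCat.{0} R) ℤ) (i : ℤ)
    (hfg : Module.Finite R (M.homology i)) :
    ∃ N : Submodule R (M.X i), N.FG ∧ N ≤ LinearMap.ker (M.d i (i + 1)).hom ∧
      LinearMap.ker (M.d i (i + 1)).hom ≤ N ⊔ LinearMap.range (M.d (i - 1) i).hom := by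
  let S := M.sc' (i - 1) i (i + 1)
  have e : M.homology i ≅ S.homology :=
    ShortComplex.homologyMapIso (M.isoSc' (i - 1) i (i + 1) (by simp) (by simp))
  have e' := (e ≪≫ S.moduleCatHomologyIso).toLinearEquiv
  have hf : Module.Finite R (LinearMap.ker S.g.hom ⧸ LinearMap.range S.moduleCatToCycles) :=
    Module.Finite.equiv e'
  obtain ⟨n, g, hg⟩ := Module.Finite.exists_fin' R
    (LinearMap.ker S.g.hom ⧸ LinearMap.range S.moduleCatToCycles)
  obtain ⟨g', hg'⟩ := Module.projective_lifting_property
    (LinearMap.range S.moduleCatToCycles).mkQ g (Submodule.mkQ_surjective _)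
  refine ⟨LinearMap.range ((LinearMap.ker S.g.hom).subtype.comp g'), ?_, ?_, ?_⟩
  · exact (Submodule.fg_iff_exists_fin_linearMap R _).2 ⟨n, _, rfl⟩
  · rintro _ ⟨v, rfl⟩
    exact (g' v).2
  · intro x hx
    let z : LinearMap.ker S.g.hom := ⟨x, hx⟩
    obtain ⟨v, hv⟩ := hg ((LinearMap.range S.moduleCatToCycles).mkQ z)
    rw [← hg', LinearMap.comp_apply, eq_comm, ← sub_eq_zero, ← map_sub] at hv
    rw [Submodule.mkQ_apply, Submodule.Quotient.mk_eq_zero] at hv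
    obtain ⟨y, hy⟩ := hv
    refine Submodule.mem_sup.2 ⟨_, ⟨v, rfl⟩, _, ⟨y, rfl⟩, ?_⟩
    let w : M.X i := (g' v).1
    have : (M.d (i - 1) i).hom y = x - w := congr_arg Subtype.val hy
    change w + (M.d (i - 1) i).hom y = x
    rw [this]
    exact add_sub_cancel _ _

lemma exists_step {R : Type} [CommRing R] [IsNoetherianRing R]
    (M : CochainComplex (ModuleCat.{0} R) ℤ)
    (hfg : ∀ i, Module.Finite R (M.homology i)) (i : ℤ) (u : ResState M (i + 1)) :
    ∃ t : ResState M i, t.Rel u := by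
  obtain ⟨N, h1, h2, h3⟩ := exists_fg_homology M i (hfg i)
  obtain ⟨r, d, f, h⟩ := exists_step_aux (M.d (i - 1) i).hom (M.d i (i + 1)).hom N h1 h2 h3
    u.r u.f u.Z
  exact ⟨⟨r, f, LinearMap.ker d⟩, d, rfl, h⟩

/-- The recursive construction. -/
noncomputable def resState {R : Type} [CommRing R] [IsNoetherianRing R]
    (M : CochainComplex (ModuleCat.{0} R) ℤ)
    (hfg : ∀ i, Module.Finite R (M.homology i)) (N : ℤ) (i : ℤ) : ResState M i :=
  if _h : N ≤ i then ⟨0, 0, ⊤⟩ else (exists_step M hfg i (resState M hfg N (i + 1))).choose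
termination_by (N - i).toNat
decreasing_by omega

lemma resState_rel {R : Type} [CommRing R] [IsNoetherianRing R]
    (M : CochainComplex (ModuleCat.{0} R) ℤ)
    (hfg : ∀ i, Module.Finite R (M.homology i)) (N : ℤ)
    (hN : ∀ i, N ≤ i → ∀ m : M.X i, M.d i (i + 1) m = 0 → ∃ m', m = M.d (i - 1) i m') (i : ℤ) :
    (resState M hfg N i).Rel (resState M hfg N (i + 1)) := by
  by_cases h : N ≤ i
  · rw [resState, dif_pos h, resState, dif_pos (by omega)]
    refine ⟨0, ?_, by simp, by simp, ?_⟩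
    · simp
    · intro p _ m hm
      obtain ⟨m', hm'⟩ := hN i h m (by simpa using hm.symm)
      exact ⟨0, m', Subsingleton.elim _ _, by simpa using hm'⟩
  · rw [resState, dif_neg h]
    exact (exists_step M hfg i (resState M hfg N (i + 1))).choose_spec

lemma exists_resolution {R : Type} [CommRing R] [IsNoetherianRing R]
    (M : CochainComplex (ModuleCat.{0} R) ℤ)
    (hfg : ∀ i, Module.Finite R (M.homology i)) (N : ℤ)
    (hN : ∀ i, N ≤ i → ∀ m : M.X i, M.d i (i + 1) m = 0 → ∃ m', m = M.d (i - 1) i m') :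
    ∃ (P : CochainComplex (ModuleCat.{0} R) ℤ) (f : P ⟶ M), ConeAcyclic f ∧
      (∀ i, Module.Free R (P.X i) ∧ Module.Finite R (P.X i)) ∧
      ∀ i, N ≤ i → IsZero (P.X i) := by
  choose d hd1 hd2 hd3 hd4 using resState_rel M hfg N hN
  let P : CochainComplex (ModuleCat.{0} R) ℤ := CochainComplex.of
    (fun i => ModuleCat.of R (Fin (resState M hfg N i).r → R)) (fun i => ModuleCat.ofHom (d i)) (by
      intro i
      ext1
      refine LinearMap.ext fun v => ?_
      have : d i v ∈ LinearMap.ker (d (i + 1)) := hd1 (i + 1) ▸ hd2 i v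
      exact this)
  have hPd : ∀ i, P.d i (i + 1) = ModuleCat.ofHom (d i) := fun i =>
    CochainComplex.of_d (fun i => ModuleCat.of R (Fin (resState M hfg N i).r → R))
      (fun i => ModuleCat.ofHom (d i)) i
  refine ⟨P, CochainComplex.ofHom (fun i => ModuleCat.ofHom (resState M hfg N i).f) ?_, ?_, ?_, ?_⟩
  · intro i
    rw [hPd]
    ext1
    refine LinearMap.ext fun v => ?_
    exact (hd3 i v).symm
  · intro i p m h1 h2
    rw [hPd] at h1 ⊢
    exact hd4 i p (by rw [← hd1]; exact h1) m h2
  · intro i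
    exact ⟨inferInstanceAs (Module.Free R (Fin (resState M hfg N i).r → R)),
      inferInstanceAs (Module.Finite R (Fin (resState M hfg N i).r → R))⟩
  · intro i hi
    have : (resState M hfg N i).r = 0 := by rw [resState, dif_pos hi]
    have : Subsingleton (P.X i) := by
      change Subsingleton (Fin (resState M hfg N i).r → R)
      rw [this]; infer_instance
    exact ModuleCat.isZero_of_subsingleton _

lemma exists_extend {R : Type} [CommRing R] (P : CochainComplex (ModuleCat.{0} R) ℤ)
    [P.IsKProjective] (k : ModuleCat.{0} R) (n : ℤ)
    (h : Subsingleton (DerivedCategory.Q.obj P ⟶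
      (DerivedCategory.Q.obj ((HomologicalComplex.single (ModuleCat.{0} R)
        (ComplexShape.up ℤ) 0).obj k))⟦n⟧)) (j : ℤ) (hj : n + j = 0)
    (φ : P.X j ⟶ k) (hφ : ∀ i, (ComplexShape.up ℤ).Rel i j → P.d i j ≫ φ = 0) :
    ∃ ψ : P.X (j + 1) ⟶ k, P.d j (j + 1) ≫ ψ = φ := by
  let φ' : P ⟶ (HomologicalComplex.single (ModuleCat.{0} R) (ComplexShape.up ℤ) j).obj k :=
    HomologicalComplex.mkHomToSingle φ hφ
  let e : ((HomologicalComplex.single (ModuleCat.{0} R) (ComplexShape.up ℤ) 0).obj k)⟦n⟧ ≅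
      (HomologicalComplex.single (ModuleCat.{0} R) (ComplexShape.up ℤ) j).obj k :=
    ((CochainComplex.singleFunctors (ModuleCat.{0} R)).shiftIso n j 0 hj).app k
  let e' := (DerivedCategory.Q.mapIso e).symm ≪≫
    (DerivedCategory.Q.commShiftIso n).app
      ((HomologicalComplex.single (ModuleCat.{0} R) (ComplexShape.up ℤ) 0).obj k)
  have h0 : DerivedCategory.Q.map φ' = 0 := by
    rw [← cancel_mono e'.hom]
    exact h.elim _ _
  have h1 : (HomotopyCategory.quotient _ _).map φ' = 0 := by
    apply (CochainComplex.IsKProjective.Qh_map_bijective P _).injective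
    rw [Functor.map_zero, ← cancel_mono ((DerivedCategory.quotientCompQhIso _).hom.app _)]
    rw [DerivedCategory.quotientCompQhIso_hom_naturality, h0]
    exact comp_zero.trans zero_comp.symm
  rw [HomotopyCategory.quotient_map_eq_zero_iff] at h1
  obtain ⟨H⟩ := h1
  have h2 : (HomologicalComplex.mkHomToSingle φ hφ : P ⟶ (HomologicalComplex.single _ _ j).obj k).f j
    = _ := H.comm j
  rw [HomologicalComplex.mkHomToSingle_f, dNext_eq _ (show (ComplexShape.up ℤ).Rel j (j + 1) from rfl),
    prevD_eq _ (show (ComplexShape.up ℤ).Rel (j - 1) j by simp)] at h2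
  refine ⟨H.hom (j + 1) j ≫ (HomologicalComplex.singleObjXSelf (ComplexShape.up ℤ) j k).hom, ?_⟩
  have h3 := congr($h2 ≫ (HomologicalComplex.singleObjXSelf (ComplexShape.up ℤ) j k).hom)
  simp at h3
  exact h3.symm

open TensorProduct in
lemma exists_split {R : Type} [CommRing R] [IsLocalRing R] {G : Type} [AddCommGroup G] [Module R G]
    [Module.Finite R G] [Module.Free R G] (K : Submodule R G) (hK : K.FG)
    (h : ∀ φ : K →ₗ[R] IsLocalRing.ResidueField R, ∃ ψ : G →ₗ[R] IsLocalRing.ResidueField R,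
      ∀ x : K, ψ x = φ x) :
    ∃ l : G →ₗ[R] K, l ∘ₗ K.subtype = LinearMap.id := by
  have : Module.Finite R K := Module.Finite.iff_fg.2 hK
  rw [IsLocalRing.split_injective_iff_lTensor_residueField_injective]
  rw [injective_iff_map_eq_zero]
  intro z hz
  rw [← Module.forall_dual_apply_eq_zero_iff (IsLocalRing.ResidueField R) z]
  intro θ
  obtain ⟨ψ, hψ⟩ := h ((θ.restrictScalars R).comp
    (TensorProduct.mk R (IsLocalRing.ResidueField R) K 1))
  have key : ∀ z, ψ.liftBaseChange (IsLocalRing.ResidueField R)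
      (K.subtype.lTensor (IsLocalRing.ResidueField R) z) = θ z := by
    intro z
    induction z with
    | zero => simp
    | add x y hx hy => simp only [map_add, hx, hy]
    | tmul a x =>
      rw [LinearMap.lTensor_tmul, LinearMap.liftBaseChange_tmul, Submodule.subtype_apply, hψ]
      have : a ⊗ₜ[R] x = a • ((1 : IsLocalRing.ResidueField R) ⊗ₜ[R] x) := by
        rw [TensorProduct.smul_tmul', smul_eq_mul, mul_one]
      rw [this, map_smul]
      rfl
  rw [← key, hz, map_zero]

lemma exists_sub {R : Type} [CommRing R] {P M : CochainComplex (ModuleCat.{0} R) ℤ} (f : P ⟶ M)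
    (hf : ConeAcyclic f) (hP : ∀ i, Module.Free R (P.X i) ∧ Module.Finite R (P.X i))
    [IsLocalRing R] (j : ℤ)
    (hj : ∀ i, i ≤ j → ∀ m : M.X i, M.d i (i + 1) m = 0 → ∃ m', m = M.d (i - 1) i m')
    (N : ℤ) (hN : ∀ i, N ≤ i → IsZero (P.X i))
    (l : P.X (j + 1) →ₗ[R] LinearMap.range (P.d j (j + 1)).hom)
    (hl : l ∘ₗ (LinearMap.range (P.d j (j + 1)).hom).subtype = LinearMap.id) :
    ∃ (P : CochainComplex (ModuleCat R) ℤ) (f : P ⟶ M),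
      QuasiIso f ∧
      (∀ i, Module.Free R (P.X i) ∧ Module.Finite R (P.X i)) ∧
      ∃ a b : ℤ, ∀ i, (i < a ∨ b < i) → IsZero (P.X i) := by
  have hl' : ∀ x, l (P.d j (j + 1) x) = ⟨P.d j (j + 1) x, x, rfl⟩ := fun x =>
    LinearMap.congr_fun hl ⟨P.d j (j + 1) x, x, rfl⟩
  let S : ∀ i, Submodule R (P.X i) := Function.update (fun i => if i < j + 1 then ⊥ else ⊤) (j + 1)
    (LinearMap.ker l)
  have S1 : ∀ i, i < j + 1 → S i = ⊥ := by
    intro i hi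
    simp only [S, Function.update_of_ne hi.ne, if_pos hi]
  have S2 : ∀ i, j + 1 < i → S i = ⊤ := by
    intro i hi
    simp only [S, Function.update_of_ne hi.ne', if_neg hi.not_gt]
  have S3 : S (j + 1) = LinearMap.ker l := by
    simp [S]
  have hS : ∀ i i', ∀ x ∈ S i, (P.d i i').hom x ∈ S i' := by
    intro i i' x hx
    by_cases h : i + 1 = i'
    · subst h
      rcases lt_or_ge i (j + 1) with h | h
      · rw [S1 i h, Submodule.mem_bot] at hx
        simp [hx]
      · rw [S2 (i + 1) (by omega)]
        trivial
    · rw [P.shape i i' h]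
      simp
  let P' : CochainComplex (ModuleCat.{0} R) ℤ :=
    { X := fun i => ModuleCat.of R (S i)
      d := fun i i' => ModuleCat.ofHom ((P.d i i').hom.restrict (hS i i'))
      shape := fun i i' h => by
        ext x
        have := P.shape i i' h
        change (P.d i i').hom x.1 = 0
        rw [this]; rfl
      d_comp_d' := fun i i' i'' _ _ => by
        ext x
        change (P.d i' i'').hom ((P.d i i').hom x.1) = 0
        exact congr($(P.d_comp_d i i' i'') x.1) }
  let g : P' ⟶ M :=
    { f := fun i => ModuleCat.ofHom ((f.f i).hom.comp (S i).subtype)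
      comm' := fun i i' _ => by
        ext x
        exact congr($(f.comm i i') x.1) }
  refine ⟨P', g, ConeAcyclic.quasiIso ?_, ?_, j + 1, N, ?_⟩
  · rintro i ⟨p, hp⟩ m h1 h2
    replace h1 : P.d (i + 1) (i + 1 + 1) p = 0 := congr_arg Subtype.val h1
    replace h2 : f.f (i + 1) p = M.d i (i + 1) m := h2
    obtain ⟨p', m', h3, h4⟩ := hf i p m h1 h2
    suffices ∃ (p' : P.X i) (m' : M.X (i - 1)), p' ∈ S i ∧ P.d i (i + 1) p' = p ∧
        m = f.f i p' + M.d (i - 1) i m' by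
      obtain ⟨p', m', h5, h6, h7⟩ := this
      exact ⟨⟨p', h5⟩, m', Subtype.ext h6, h7⟩
    rcases lt_or_ge i (j + 1) with hi | hi
    · have hp0 : p = 0 := by
        rcases lt_or_ge i j with hi' | hi'
        · rwa [S1 _ (by omega), Submodule.mem_bot] at hp
        · obtain rfl : i = j := by omega
          rw [S3, LinearMap.mem_ker, ← h3, hl'] at hp
          rw [← h3]
          exact congr_arg Subtype.val hp
      subst hp0
      obtain ⟨m'', h⟩ := hj i (by omega) m (by simpa using h2.symm)
      exact ⟨0, m'', zero_mem _, by simp, by simpa using h⟩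
    rcases eq_or_lt_of_le hi with hi | hi
    · subst hi
      obtain ⟨q, hq⟩ := (l p').2
      change P.d j (j + 1) q = (l p').1 at hq
      obtain ⟨q', hq'⟩ : ∃ q' : M.X (j + 1 - 1), M.d (j + 1 - 1) (j + 1) q' =
          f.f (j + 1) (P.d j (j + 1) q) := by
        have : j + 1 - 1 = j := by omega
        rw [this]
        exact ⟨f.f j q, congr($(f.comm j (j + 1)) q)⟩
      refine ⟨p' - P.d j (j + 1) q, m' + q', ?_, ?_, ?_⟩
      · rw [S3, LinearMap.mem_ker, map_sub, sub_eq_zero]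
        rw [hl']
        exact Subtype.ext hq.symm
      · rw [map_sub, h3]
        have : P.d (j + 1) (j + 1 + 1) (P.d j (j + 1) q) = 0 :=
          congr($(P.d_comp_d j (j + 1) (j + 1 + 1)) q)
        rw [this, sub_zero]
      · rw [h4, map_sub, map_add, hq']
        abel
    · exact ⟨p', m', by rw [S2 i hi]; trivial, h3, h4⟩
  · intro i
    obtain ⟨_, _⟩ := hP i
    change Module.Free R (S i) ∧ Module.Finite R (S i)
    rcases lt_trichotomy i (j + 1) with hi | hi | hi
    · rw [S1 i hi]; exact ⟨inferInstance, inferInstance⟩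
    · subst hi
      rw [S3]
      have hmem : ∀ x, x - (l x).1 ∈ LinearMap.ker l := by
        intro x
        rw [LinearMap.mem_ker, map_sub, sub_eq_zero]
        exact (LinearMap.congr_fun hl (l x)).symm
      let s : P.X (j + 1) →ₗ[R] LinearMap.ker l := LinearMap.codRestrict _
        (LinearMap.id - (LinearMap.range (P.d j (j + 1)).hom).subtype ∘ₗ l) hmem
      have hs : s ∘ₗ (LinearMap.ker l).subtype = LinearMap.id := by
        refine LinearMap.ext fun x => Subtype.ext ?_
        change x.1 - (l x.1).1 = x.1
        rw [LinearMap.mem_ker.1 x.2]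
        exact sub_zero _
      have h1 : Module.Finite R (LinearMap.ker l) :=
        Module.Finite.of_surjective s (fun x => ⟨x.1, LinearMap.congr_fun hs x⟩)
      have h2 : Module.Projective R (LinearMap.ker l) := Module.Projective.of_split _ s hs
      exact ⟨Module.free_of_flat_of_isLocalRing, h1⟩
    · rw [S2 i hi]
      exact ⟨Module.Free.of_equiv Submodule.topEquiv.symm,
        Module.Finite.equiv Submodule.topEquiv.symm⟩
  · intro i hi
    have : Subsingleton (S i) := by
      rcases hi with hi | hi
      · rw [S1 i hi]; infer_instance
      · have := ModuleCat.subsingleton_of_isZero (hN i hi.le)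
        infer_instance
    exact ModuleCat.isZero_of_subsingleton (ModuleCat.of R (S i))

theorem perfect_of_ext_vanishing
    (R : Type) [CommRing R] [IsNoetherianRing R] [IsLocalRing R]
    (M : CochainComplex (ModuleCat R) ℤ)
    (hfg : ∀ i, Module.Finite R (M.homology i))
    (hbd : ∃ n : ℕ, ∀ i : ℤ, (n : ℤ) ≤ |i| → IsZero (M.homology i))
    (hext : ∃ n₀ : ℕ, ∀ i : ℕ, n₀ ≤ i →
      Subsingleton
        ((DerivedCategory.Q.obj M) ⟶
          ((DerivedCategory.Q.obj
            ((HomologicalComplex.single (ModuleCat R) (ComplexShape.up ℤ) 0).obj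
              (ModuleCat.of R (IsLocalRing.ResidueField R))))⟦(i : ℤ)⟧))) :
    ∃ (P : CochainComplex (ModuleCat R) ℤ) (f : P ⟶ M),
      QuasiIso f ∧
      (∀ i, Module.Free R (P.X i) ∧ Module.Finite R (P.X i)) ∧
      ∃ a b : ℤ, ∀ i, (i < a ∨ b < i) → IsZero (P.X i) := by
  obtain ⟨n, hn⟩ := hbd
  obtain ⟨n₀, hn₀⟩ := hext
  have hex : ∀ i : ℤ, (n : ℤ) ≤ |i| → ∀ m : M.X i, M.d i (i + 1) m = 0 →
      ∃ m', m = M.d (i - 1) i m' := by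
    intro i hi m hm
    have h1 := hn i hi
    rw [← HomologicalComplex.exactAt_iff_isZero_homology,
      HomologicalComplex.exactAt_iff' _ (i - 1) i (i + 1) (by simp) (by simp),
      ShortComplex.moduleCat_exact_iff] at h1
    obtain ⟨y, hy⟩ := h1 m hm
    exact ⟨y, hy.symm⟩
  obtain ⟨P, f, hf, hP, hN⟩ := exists_resolution M hfg n
    (fun i hi => hex i (hi.trans (le_abs_self i)))
  have hP' : ∀ i, Projective (P.X i) := by
    intro i
    have := (hP i).1
    infer_instance
  have : P.IsStrictlyLE n := by
    rw [CochainComplex.isStrictlyLE_iff]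
    exact fun i hi => hN i hi.le
  have : P.IsKProjective := CochainComplex.isKProjective_of_projective P n
  have hq : QuasiIso f := hf.quasiIso
  let a : ℕ := n₀ + n
  let j : ℤ := -(a : ℤ)
  have hsub := hn₀ a (by omega)
  have hsub' : Subsingleton (DerivedCategory.Q.obj P ⟶
      (DerivedCategory.Q.obj ((HomologicalComplex.single (ModuleCat.{0} R)
        (ComplexShape.up ℤ) 0).obj
          (ModuleCat.of R (IsLocalRing.ResidueField R))))⟦(a : ℤ)⟧) := by
    constructor
    intro x y
    have := hsub.elim (inv (DerivedCategory.Q.map f) ≫ x) (inv (DerivedCategory.Q.map f) ≫ y)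
    rwa [cancel_epi] at this
  obtain ⟨_, _⟩ := hP (j + 1)
  obtain ⟨_, _⟩ := hP j
  obtain ⟨l, hl⟩ := exists_split (LinearMap.range (P.d j (j + 1)).hom)
    (IsNoetherian.noetherian _) (by
      intro φ
      obtain ⟨ψ, hψ⟩ := exists_extend P _ a hsub' j (by omega)
        (ModuleCat.ofHom (φ.comp (P.d j (j + 1)).hom.rangeRestrict)) (by
          intro i hi
          ext x
          have : (P.d j (j + 1)).hom.rangeRestrict (P.d i j x) = 0 :=
            Subtype.ext congr($(P.d_comp_d i j (j + 1)) x)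
          change φ ((P.d j (j + 1)).hom.rangeRestrict (P.d i j x)) = 0
          rw [this, map_zero])
      refine ⟨ψ.hom, ?_⟩
      rintro ⟨_, x, rfl⟩
      exact congr($hψ x))
  refine exists_sub f hf hP j ?_ n hN l hl
  intro i hi
  apply hex
  rw [abs_of_nonpos (by omega)]
  omega
end

section
/- Let φ : (R,m) → (S,n) be a surjective homomorphism of commutative noetherian local rings whose kernel contains only zerodivisors of R and is nonzero. Then S has infinite projective dimension as an R-module. -/
/-!
STATEMENT 5: If `φ : (R,m) → (S,n)` is a surjective homomorphism of commutative
noetherian local rings whose kernel is nonzero and consists of zerodivisors of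
`R`, then `S` has infinite projective dimension as an `R`-module.
-/

/-- An `R`-module `M` has finite projective dimension: it admits a projective
resolution vanishing in large degrees. -/
def HasFiniteProjectiveDimension (R : Type) [Ring R] (M : Type)
    [AddCommGroup M] [Module R M] : Prop :=
  ∃ (n : ℕ) (P : ChainComplex (ModuleCat R) ℕ)
    (f : P ⟶ (ChainComplex.single₀ (ModuleCat R)).obj (ModuleCat.of R M)),
      QuasiIso f ∧ (∀ i, CategoryTheory.Projective (P.X i)) ∧
        ∀ i, n < i → CategoryTheory.Limits.IsZero (P.X i)

open CategoryTheory in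
theorem aux_hasPD {R : Type} [CommRing R] {M : Type} [AddCommGroup M] [Module R M]
    (h : HasFiniteProjectiveDimension R M) :
    ∃ n : ℕ, HasProjectiveDimensionLE (ModuleCat.of R M) n := by
  obtain ⟨n, P, f, hf, hP, hz⟩ := h
  refine ⟨n, ?_⟩
  let Q : ProjectiveResolution (ModuleCat.of R M) :=
    { complex := P, projective := hP, π := f, quasiIso := hf }
  letI := HasExt.standard (ModuleCat R)
  refine HasProjectiveDimensionLT.mk fun i hi Y e => ?_
  obtain ⟨g, hg, rfl⟩ := Q.extMk_surjective e (i + 1) rfl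
  have hg0 : g = 0 := (hz i (by omega)).eq_of_src _ _
  subst hg0
  exact Q.extMk_zero _ _

open TensorProduct in
theorem aux_free {A : Type} [CommRing A] [IsLocalRing A] [IsNoetherianRing A]
    (hA : IsLocalRing.maximalIdeal A ∈ associatedPrimes A A)
    {K N P : Type} [AddCommGroup K] [AddCommGroup N] [AddCommGroup P]
    [Module A K] [Module A N] [Module A P] [Module.Finite A K] [Module.Finite A N]
    [Module.Free A K] [Module.Free A N] (f : K →ₗ[A] N) (g : N →ₗ[A] P)
    (hf : Function.Injective f) (hfg : Function.Exact f g) (hg : Function.Surjective g) :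
    Module.Free A P ∧ Module.finrank A N = Module.finrank A K + Module.finrank A P := by
  have hfree : Module.Free A P := by
    obtain ⟨_, j, hj⟩ := (isAssociatedPrime_iff_exists_injective_linearMap _ _).mp hA
    refine Module.free_of_lTensor_residueField_injective f g hg hfg ?_
    have h1 : Function.Injective (j.rTensor K) :=
      Module.Flat.rTensor_preserves_injective_linearMap j hj
    have h2 : Function.Injective (f.lTensor A) :=
      Module.Flat.lTensor_preserves_injective_linearMap f hf
    have h3 : (f.lTensor A) ∘ₗ (j.rTensor K) =
        (j.rTensor N) ∘ₗ (f.lTensor (A ⧸ IsLocalRing.maximalIdeal A)) := by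
      rw [LinearMap.lTensor_comp_rTensor, LinearMap.rTensor_comp_lTensor]
    have h4 : Function.Injective ((f.lTensor A) ∘ₗ (j.rTensor K)) := h2.comp h1
    rw [h3] at h4
    exact Function.Injective.of_comp (f := j.rTensor N) h4
  refine ⟨hfree, ?_⟩
  obtain ⟨l, hl⟩ := Module.projective_lifting_property g LinearMap.id hg
  have : Module.Finite A P := Module.Finite.of_surjective g hg
  obtain ⟨e, -⟩ := hfg.splitSurjectiveEquiv hf ⟨l, hl⟩
  rw [e.finrank_eq, Module.finrank_prod]

theorem aux_ass {R : Type} [CommRing R] [IsNoetherianRing R] (q : Ideal R) [q.IsPrime]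
    (hq : q ∈ associatedPrimes R R) :
    IsLocalRing.maximalIdeal (Localization.AtPrime q) ∈
      associatedPrimes (Localization.AtPrime q) (Localization.AtPrime q) := by
  apply Module.associatedPrimes.mem_associatedPrimes_of_comap_mem_associatedPrimes_of_isLocalizedModule
    q.primeCompl (Algebra.linearMap R (Localization.AtPrime q))
  have h := Localization.AtPrime.under_maximalIdeal (I := q)
  rw [Ideal.under_def] at h
  rwa [h]

open CategoryTheory TensorProduct in
theorem aux_rank {R : Type} [CommRing R] [IsNoetherianRing R] [IsLocalRing R] (n : ℕ) :
    ∀ (M : Type) [AddCommGroup M] [Module R M] [Module.Finite R M],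
      HasProjectiveDimensionLE (ModuleCat.of R M) n →
      ∃ r : ℕ, ∀ (q : Ideal R) [q.IsPrime], q ∈ associatedPrimes R R →
        Module.Free (Localization.AtPrime q) (Localization.AtPrime q ⊗[R] M) ∧
        Module.finrank (Localization.AtPrime q) (Localization.AtPrime q ⊗[R] M) = r := by
  induction n with
  | zero =>
    intro M _ _ _ h
    have hp : Module.Projective R M := by
      rw [← projective_iff_hasProjectiveDimensionLE_zero] at h
      exact (IsProjective.iff_projective (R := R) M).mpr h
    have : Module.Free R M := Module.free_of_flat_of_isLocalRing
    exact ⟨Module.finrank R M, fun q _ _ => ⟨inferInstance, Module.finrank_baseChange⟩⟩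
  | succ n ih =>
    intro M _ _ _ h
    rcases Module.exists_finite_presentation R M with ⟨P, _, _, _, _, f, surjf⟩
    have S_exact := LinearMap.shortExact_shortComplexKer surjf
    have proj := ModuleCat.projective_of_categoryTheory_projective f.shortComplexKer.X₂
    have hK : HasProjectiveDimensionLE (ModuleCat.of R (LinearMap.ker f)) n :=
      (S_exact.hasProjectiveDimensionLT_X₃_iff n proj).mp h
    obtain ⟨s, hs⟩ := ih (LinearMap.ker f) hK
    refine ⟨Module.finrank R P - s, fun q _ hq => ?_⟩
    obtain ⟨hfree, hrank⟩ := hs q hq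
    have := aux_free (aux_ass q hq)
      ((LinearMap.ker f).subtype.baseChange (Localization.AtPrime q))
      (f.baseChange (Localization.AtPrime q))
      (Module.Flat.lTensor_preserves_injective_linearMap _ (Submodule.subtype_injective _))
      (Module.Flat.lTensor_exact _ (LinearMap.exact_subtype_ker_map f))
      (LinearMap.lTensor_surjective _ surjf)
    refine ⟨this.1, ?_⟩
    have h2 := this.2
    rw [Module.finrank_baseChange, hrank] at h2
    omega

open TensorProduct in
theorem infinite_projdim_of_zerodivisor_kernel
    (R S : Type) [CommRing R] [CommRing S]
    [IsNoetherianRing R] [IsNoetherianRing S]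
    [IsLocalRing R] [IsLocalRing S]
    (φ : R →+* S) (hφs : Function.Surjective φ) (hφl : IsLocalHom φ)
    (hne : RingHom.ker φ ≠ ⊥)
    (hzd : ∀ x ∈ RingHom.ker φ, x ∉ nonZeroDivisors R) :
    ¬ (letI := φ.toAlgebra; HasFiniteProjectiveDimension R S) := by
  letI := φ.toAlgebra
  intro hfin
  obtain ⟨n, hn⟩ := aux_hasPD hfin
  have hfinite : Module.Finite R S := Module.Finite.of_surjective (Algebra.linearMap R S) hφs
  obtain ⟨r, hr⟩ := aux_rank n S hn
  obtain ⟨p, hp, hIp⟩ : ∃ P ∈ associatedPrimes R R, RingHom.ker φ ≤ P :=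
    ((RingHom.ker φ).subset_union_prime_finite (associatedPrimes.finite ..) (f := id) 0 0
      fun _ h _ _ ↦ h.1).1 <| by
      simp_rw [id, biUnion_associatedPrimes_eq_compl_nonZeroDivisors]
      exact fun x hx => hzd x hx
  have hpp : p.IsPrime := hp.1
  have hr0 : 0 < r := by
    obtain ⟨h1, h2⟩ := hr p hp
    have hsup : (⟨p, hpp⟩ : PrimeSpectrum R) ∈ Module.support R S := by
      rw [Module.support_of_algebra]
      exact hIp
    rw [Module.mem_support_iff] at hsup
    have : Nontrivial (Localization.AtPrime p ⊗[R] S) :=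
      (LocalizedModule.equivTensorProduct p.primeCompl S).symm.toEquiv.nontrivial
    rw [← h2]
    exact Module.finrank_pos_iff_of_free _ _ |>.mpr this
  obtain ⟨x, hx, hx0⟩ := Submodule.exists_mem_ne_zero_of_ne_bot hne
  obtain ⟨q, hq, hxq⟩ := exists_le_isAssociatedPrime_of_isNoetherianRing R x hx0
  have hqp : q.IsPrime := hq.1
  obtain ⟨h1, h2⟩ := hr q hq
  have : Nontrivial (Localization.AtPrime q ⊗[R] S) := by
    rw [← Module.finrank_pos_iff_of_free (Localization.AtPrime q)]
    omega
  have hkill : ∀ t : Localization.AtPrime q ⊗[R] S,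
      algebraMap R (Localization.AtPrime q) x • t = 0 := by
    intro t
    rw [algebraMap_smul]
    induction t with
    | zero => simp
    | add a b ha hb => rw [smul_add, ha, hb, add_zero]
    | tmul a b =>
      have hxb : x • b = 0 := by
        rw [Algebra.smul_def]
        have : algebraMap R S x = 0 := hx
        rw [this, zero_mul]
      rw [← TensorProduct.tmul_smul, hxb, TensorProduct.tmul_zero]
  have hzero : algebraMap R (Localization.AtPrime q) x = 0 :=
    FaithfulSMul.eq_of_smul_eq_smul (α := Localization.AtPrime q ⊗[R] S)
      fun t => by rw [hkill, zero_smul]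
  rw [IsLocalization.map_eq_zero_iff q.primeCompl] at hzero
  obtain ⟨m, hm⟩ := hzero
  exact m.2 (hxq (by simpa [Submodule.mem_colon_singleton] using hm))
end

section
/- Let φ : R → S be a surjective homomorphism of commutative noetherian rings. Then φ is locally complete intersection (i.e. for each prime q of S the localized map R_{q∩R} → S_q has kernel generated by a regular sequence) if and only if for every prime q of S the conormal module (I/I²)_q is free over S_q of rank equal to the minimal number of generators of I_{q∩R}, where I = Ker φ, assuming in addition that S has finite flat dimension over R. In particular, if φ is locally complete intersection then I/I² is a projective S-module. -/
/-!
STATEMENT 7: Let `φ : R → S` be a surjective homomorphism of commutative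
noetherian rings with kernel `I`, and assume `S` has finite flat dimension over
`R`.  Then `φ` is locally complete intersection (for each prime `q` of `S` the
localized map `R_{q∩R} → S_q` has kernel generated by a regular sequence) iff
for every prime `q` of `S` the conormal module `(I/I²)_q` is free over `S_q` of
rank equal to the minimal number of generators of `I_{q∩R}`.  In particular, if
`φ` is locally complete intersection then `I/I²` is a projective `S`-module.
-/

/-- A surjective-type complete intersection condition for a ring map: the kernel is
generated by a regular sequence. -/
def RingHom.IsCompleteIntersection {R S : Type} [CommRing R] [CommRing S]
    (φ : R →+* S) : Prop :=
  ∃ rs : List R, RingTheory.Sequence.IsRegular R rs ∧ Ideal.ofList rs = RingHom.ker φ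

/-- Finite flat dimension via flat resolutions. -/
def HasFiniteFlatDimension (R : Type) [CommRing R] (M : Type)
    [AddCommGroup M] [Module R M] : Prop :=
  ∃ (n : ℕ) (P : ChainComplex (ModuleCat R) ℕ)
    (f : P ⟶ (ChainComplex.single₀ (ModuleCat R)).obj (ModuleCat.of R M)),
      QuasiIso f ∧ (∀ i, Module.Flat R (P.X i)) ∧
        ∀ i, n < i → CategoryTheory.Limits.IsZero (P.X i)

/-- The minimal number of generators of an ideal. -/
noncomputable def minimalGenerators {A : Type} [CommRing A] (J : Ideal A) : ℕ :=
  sInf {n | ∃ s : Finset A, s.card = n ∧ Ideal.span (s : Set A) = J}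

namespace LCIaux

open TensorProduct

lemma flat_prod {R A B : Type} [CommRing R] [AddCommGroup A] [AddCommGroup B] [Module R A]
    [Module R B] [Module.Flat R A] [Module.Flat R B] : Module.Flat R (A × B) := by
  rw [Module.Flat.iff_rTensor_preserves_injective_linearMap]
  intro N N' _ _ _ _ f hf
  have hA := Module.Flat.rTensor_preserves_injective_linearMap (M := A) f hf
  have hB := Module.Flat.rTensor_preserves_injective_linearMap (M := B) f hf
  have key : (TensorProduct.prodRight R R N' A B).toLinearMap ∘ₗ f.rTensor (A × B) =
      (LinearMap.prodMap (f.rTensor A) (f.rTensor B)) ∘ₗ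
        (TensorProduct.prodRight R R N A B).toLinearMap := by
    ext <;> simp
  have : Function.Injective ((TensorProduct.prodRight R R N' A B).toLinearMap ∘ₗ
      f.rTensor (A × B)) := by
    rw [key]
    simp only [LinearMap.coe_comp, LinearEquiv.coe_coe, LinearMap.coe_prodMap]
    exact (Function.Injective.prodMap hA hB).comp (LinearEquiv.injective _)
  rw [LinearMap.coe_comp] at this
  exact this.of_comp

lemma flat_ker {R X F : Type} [CommRing R] [AddCommGroup X] [AddCommGroup F] [Module R X]
    [Module R F] [Module.Flat R X] [Module.Flat R F] (h : X →ₗ[R] F)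
    (hh : Function.Surjective h) : Module.Flat R (LinearMap.ker h) := by
  rw [Module.Flat.iff_rTensor_preserves_injective_linearMap]
  intro N N' _ _ _ _ f hf
  have h1 := LinearMap.lTensor_injective_of_exact_of_flat h hh (LinearMap.ker h).subtype
    (Submodule.subtype_injective _) (LinearMap.exact_subtype_ker_map h) N
  have h2 := Module.Flat.rTensor_preserves_injective_linearMap (M := X) f hf
  have key : (LinearMap.ker h).subtype.lTensor N' ∘ₗ f.rTensor (LinearMap.ker h) =
      f.rTensor X ∘ₗ (LinearMap.ker h).subtype.lTensor N := by
    ext; simp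
  have : Function.Injective ((LinearMap.ker h).subtype.lTensor N' ∘ₗ
      f.rTensor (LinearMap.ker h)) := by
    rw [key, LinearMap.coe_comp]
    exact h2.comp h1
  rw [LinearMap.coe_comp] at this
  exact this.of_comp

/-- flat dimension at most `n`, by flat resolutions. -/
def FD (R : Type) [CommRing R] : ℕ → ∀ (M : Type) [AddCommGroup M] [Module R M], Prop
  | 0, M, _, _ => Module.Flat R M
  | n + 1, M, _, _ => ∃ (F : Type) (_ : AddCommGroup F) (_ : Module R F) (g : F →ₗ[R] M),
      Module.Flat R F ∧ Function.Surjective g ∧ FD R n (LinearMap.ker g)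

section
variable {R : Type} [CommRing R]

lemma FD.equiv {n : ℕ} {M N : Type} [AddCommGroup M] [Module R M] [AddCommGroup N]
    [Module R N] (e : M ≃ₗ[R] N) (h : FD R n M) : FD R n N := by
  cases n with
  | zero =>
    have : Module.Flat R M := h
    exact Module.Flat.of_linearEquiv e.symm
  | succ n =>
    obtain ⟨F, _, _, g, hF, hg, hK⟩ := h
    refine ⟨F, _, _, e.toLinearMap ∘ₗ g, hF, e.surjective.comp hg, ?_⟩
    rwa [LinearEquiv.ker_comp]

lemma FD.of_exact {n : ℕ} {K F M : Type} [AddCommGroup M] [Module R M] [AddCommGroup K]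
    [Module R K] [AddCommGroup F] [Module R F] [Module.Flat R F] (f : K →ₗ[R] F) (g : F →ₗ[R] M)
    (hf : Function.Injective f) (hg : Function.Surjective g) (hfg : Function.Exact f g)
    (hK : FD R n K) : FD R (n + 1) M := by
  refine ⟨F, _, _, g, ‹_›, hg, ?_⟩
  rw [hfg.linearMap_ker_eq]
  exact hK.equiv (LinearEquiv.ofInjective f hf)

lemma FD.succ {n : ℕ} {M : Type} [AddCommGroup M] [Module R M] (h : FD R n M) :
    FD R (n + 1) M := by
  induction n generalizing M with
  | zero =>
    refine ⟨M, _, _, LinearMap.id, h, Function.surjective_id, ?_⟩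
    rw [LinearMap.ker_id]
    show Module.Flat R (⊥ : Submodule R M)
    infer_instance
  | succ n ih =>
    obtain ⟨F, _, _, g, hF, hg, hK⟩ := h
    exact ⟨F, _, _, g, hF, hg, ih hK⟩

lemma FD.prod_flat {n : ℕ} {M P : Type} [AddCommGroup M] [Module R M] [AddCommGroup P]
    [Module R P] [Module.Flat R P] (h : FD R n M) : FD R n (M × P) := by
  cases n with
  | zero =>
    have : Module.Flat R M := h
    exact flat_prod
  | succ n =>
    obtain ⟨F, _, _, g, hF, hg, hK⟩ := h
    have := flat_prod (R := R) (A := F) (B := P)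
    refine FD.of_exact (LinearMap.inl R F P ∘ₗ (LinearMap.ker g).subtype)
      (LinearMap.prodMap g LinearMap.id) ?_ ?_ ?_ hK
    · exact LinearMap.inl_injective.comp (Submodule.subtype_injective _)
    · rintro ⟨a, b⟩
      obtain ⟨c, rfl⟩ := hg a
      exact ⟨(c, b), rfl⟩
    · rintro ⟨a, b⟩
      constructor
      · intro h
        simp only [LinearMap.prodMap_apply, LinearMap.id_apply, Prod.mk_eq_zero] at h
        exact ⟨⟨a, h.1⟩, by simp [h.2]⟩
      · rintro ⟨k, hk⟩
        simp only [LinearMap.comp_apply, LinearMap.inl_apply, Prod.mk.injEq] at hk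
        simp [← hk.1, ← hk.2]

lemma FD.ker_of_flat {n : ℕ} {X F : Type} [AddCommGroup X] [Module R X] [AddCommGroup F]
    [Module R F] [Module.Flat R F] (hX : FD R n X) (h : X →ₗ[R] F)
    (hh : Function.Surjective h) : FD R n (LinearMap.ker h) := by
  cases n with
  | zero =>
    have : Module.Flat R X := hX
    exact flat_ker h hh
  | succ n =>
    obtain ⟨G, _, _, g, hG, hg, hK⟩ := hX
    have := flat_ker (h ∘ₗ g) (hh.comp hg)
    let g' : LinearMap.ker (h ∘ₗ g) →ₗ[R] LinearMap.ker h :=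
      g.restrict (fun x hx => hx)
    let f' : LinearMap.ker g →ₗ[R] LinearMap.ker (h ∘ₗ g) :=
      Submodule.inclusion (LinearMap.ker_le_ker_comp g h)
    refine FD.of_exact f' g' (Submodule.inclusion_injective _) ?_ ?_ hK
    · rintro ⟨x, hx⟩
      obtain ⟨y, rfl⟩ := hg x
      exact ⟨⟨y, hx⟩, rfl⟩
    · rintro ⟨x, hx⟩
      constructor
      · intro h
        have : g x = 0 := congrArg Subtype.val h
        exact ⟨⟨x, this⟩, rfl⟩
      · rintro ⟨y, hy⟩
        have hy' : (y : G) = x := congrArg Subtype.val hy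
        apply Subtype.ext
        show g x = 0
        rw [← hy']; exact y.2

lemma FD.syzygy {n : ℕ} {M P : Type} [AddCommGroup M] [Module R M] [AddCommGroup P]
    [Module R P] [Module.Projective R P] (h : FD R (n + 1) M) (π : P →ₗ[R] M)
    (hπ : Function.Surjective π) : FD R n (LinearMap.ker π) := by
  obtain ⟨F, _, _, g, hF, hg, hK⟩ := h
  obtain ⟨s, hs⟩ := Module.projective_lifting_property g π hg
  have hs' : ∀ p, g (s p) = π p := fun p => LinearMap.congr_fun hs p
  let H : (LinearMap.ker g × P) →ₗ[R] F := LinearMap.coprod (LinearMap.ker g).subtype s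
  have hH : Function.Surjective H := by
    intro x
    obtain ⟨p, hp⟩ := hπ (g x)
    refine ⟨(⟨x - s p, ?_⟩, p), ?_⟩
    · simp [hs', hp]
    · simp [H]
  have h1 := (hK.prod_flat (P := P)).ker_of_flat H hH
  refine h1.equiv (LinearEquiv.ofBijective
    ((LinearMap.snd R _ P).restrict (p := LinearMap.ker H) (q := LinearMap.ker π) ?_) ⟨?_, ?_⟩)
  · rintro ⟨⟨k, hk⟩, p⟩ hx
    have hx' : k + s p = 0 := by simpa [H] using hx
    have := congrArg g hx'
    have hk' : g k = 0 := hk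
    simpa [hs', hk'] using this
  · rw [injective_iff_map_eq_zero]
    rintro ⟨⟨⟨k, hk⟩, p⟩, hx⟩ h0
    have hx' : k + s p = 0 := by simpa [H] using hx
    have hp : p = 0 := congrArg Subtype.val h0
    subst hp
    have : k = 0 := by simpa using hx'
    subst this
    rfl
  · rintro ⟨p, hp⟩
    have hp' : π p = 0 := hp
    refine ⟨⟨(⟨- s p, ?_⟩, p), ?_⟩, rfl⟩
    · simp [hs', hp']
    · simp [H]

lemma FD.retract {n : ℕ} {A B : Type} [AddCommGroup A] [Module R A] [AddCommGroup B]
    [Module R B] (i : A →ₗ[R] B) (p : B →ₗ[R] A) (hpi : p ∘ₗ i = LinearMap.id)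
    (h : FD R n B) : FD R n A := by
  induction n generalizing A B with
  | zero =>
    have : Module.Flat R B := h
    exact Module.Flat.of_retract i p hpi
  | succ n ih =>
    have h1 := h.syzygy (Finsupp.linearCombination R (id : B → B))
      (Finsupp.linearCombination_id_surjective R B)
    refine ⟨A →₀ R, _, _, Finsupp.linearCombination R (id : A → A), inferInstance,
      Finsupp.linearCombination_id_surjective R A, ?_⟩
    refine ih ((Finsupp.lmapDomain R R i).restrict ?_)
      ((Finsupp.lmapDomain R R p).restrict ?_) ?_ h1
    · intro x hx
      rw [LinearMap.mem_ker] at hx ⊢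
      have : Finsupp.linearCombination R (id : B → B) ∘ₗ Finsupp.lmapDomain R R i =
        i ∘ₗ Finsupp.linearCombination R (id : A → A) := by ext; simp
      have := LinearMap.congr_fun this x
      simp only [LinearMap.comp_apply] at this
      rw [this, hx, map_zero]
    · intro x hx
      rw [LinearMap.mem_ker] at hx ⊢
      have : Finsupp.linearCombination R (id : A → A) ∘ₗ Finsupp.lmapDomain R R p =
        p ∘ₗ Finsupp.linearCombination R (id : B → B) := by ext; simp
      have := LinearMap.congr_fun this x
      simp only [LinearMap.comp_apply] at this
      rw [this, hx, map_zero]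
    · ext x : 1
      apply Subtype.ext
      show Finsupp.lmapDomain R R p (Finsupp.lmapDomain R R i x) = x
      rw [Finsupp.lmapDomain_apply, Finsupp.lmapDomain_apply, ← Finsupp.mapDomain_comp]
      have : (p ∘ i : A → A) = id := funext fun a => LinearMap.congr_fun hpi a
      rw [this, Finsupp.mapDomain_id]

lemma FD.tensor_step {n : ℕ} (S : Type) [CommRing S] [Algebra R S] {F M : Type}
    [AddCommGroup M] [Module R M] [AddCommGroup F] [Module R F] [Module.Flat R F]
    (g : F →ₗ[R] M) (hg : Function.Surjective g)
    (hinj : Function.Injective ((LinearMap.ker g).subtype.lTensor S))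
    (h : FD S n (S ⊗[R] LinearMap.ker g)) : FD S (n + 1) (S ⊗[R] M) := by
  refine FD.of_exact ((LinearMap.ker g).subtype.baseChange S) (g.baseChange S) hinj
    (LinearMap.lTensor_surjective S hg) ?_ h
  exact lTensor_exact S (LinearMap.exact_subtype_ker_map g) hg

lemma FD.baseChange_flat {n : ℕ} (S : Type) [CommRing S] [Algebra R S] [Module.Flat R S]
    {M : Type} [AddCommGroup M] [Module R M] (h : FD R n M) : FD S n (S ⊗[R] M) := by
  induction n generalizing M with
  | zero =>
    have : Module.Flat R M := h
    show Module.Flat S (S ⊗[R] M)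
    infer_instance
  | succ n ih =>
    obtain ⟨F, _, _, g, hF, hg, hK⟩ := h
    exact FD.tensor_step S g hg (Module.Flat.lTensor_preserves_injective_linearMap _
      (Submodule.subtype_injective _)) (ih hK)

lemma one_tmul_eq_zero_iff (I : Ideal R) {M : Type} [AddCommGroup M] [Module R M] (m : M) :
    (1 : R ⧸ I) ⊗ₜ[R] m = 0 ↔ m ∈ I • (⊤ : Submodule R M) := by
  rw [← (TensorProduct.quotTensorEquivQuotSMul M I).map_eq_zero_iff]
  have : (TensorProduct.quotTensorEquivQuotSMul M I) ((1 : R ⧸ I) ⊗ₜ[R] m) =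
      Submodule.Quotient.mk m := by
    simp
  rw [this, Submodule.Quotient.mk_eq_zero]

lemma exists_one_tmul (I : Ideal R) {M : Type} [AddCommGroup M] [Module R M]
    (t : (R ⧸ I) ⊗[R] M) : ∃ m : M, t = 1 ⊗ₜ[R] m :=
  (TensorProduct.mk_surjective R M (R ⧸ I) Ideal.Quotient.mk_surjective t).imp fun _ h => h.symm

lemma FD.baseChange_quot {n : ℕ} (z : R) (hz : IsSMulRegular R z)
    {M : Type} [AddCommGroup M] [Module R M] (hM : IsSMulRegular M z) (h : FD R n M) :
    FD (R ⧸ Ideal.span {z}) n ((R ⧸ Ideal.span {z}) ⊗[R] M) := by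
  induction n generalizing M with
  | zero =>
    have : Module.Flat R M := h
    show Module.Flat _ ((R ⧸ Ideal.span {z}) ⊗[R] M)
    infer_instance
  | succ n ih =>
    obtain ⟨F, _, _, g, hF, hg, hK⟩ := h
    have hFz : IsSMulRegular F z := by
      have := Module.Flat.lTensor_preserves_injective_linearMap (M := F)
        (LinearMap.lsmul R R z) hz
      intro a b hab
      have h2 : (LinearMap.lsmul R R z).lTensor F (a ⊗ₜ 1) =
        (LinearMap.lsmul R R z).lTensor F (b ⊗ₜ 1) := by
        have hab : z • a = z • b := hab
        simp only [LinearMap.lTensor_tmul, LinearMap.lsmul_apply, TensorProduct.tmul_smul,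
          TensorProduct.smul_tmul', hab]
      have h3 := congrArg (TensorProduct.rid R F) (this h2)
      simpa using h3
    have hKz : IsSMulRegular (LinearMap.ker g) z := hFz.submodule _ _
    refine FD.tensor_step _ g hg ?_ (ih hKz hK)
    rw [injective_iff_map_eq_zero]
    intro t ht
    obtain ⟨k, rfl⟩ := exists_one_tmul _ t
    rw [LinearMap.lTensor_tmul, one_tmul_eq_zero_iff, Submodule.ideal_span_singleton_smul,
      Submodule.mem_smul_pointwise_iff_exists] at ht
    obtain ⟨u, -, hu⟩ := ht
    have h0 : g u = 0 := by
      apply hM.right_eq_zero_of_smul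
      rw [← map_smul, hu]
      exact k.2
    rw [one_tmul_eq_zero_iff, Submodule.ideal_span_singleton_smul,
      Submodule.mem_smul_pointwise_iff_exists]
    exact ⟨⟨u, h0⟩, trivial, Subtype.ext hu⟩

end

open CategoryTheory in
lemma FD.of_hasFinite {R : Type} [CommRing R] {M : Type} [AddCommGroup M] [Module R M]
    (h : HasFiniteFlatDimension R M) : ∃ n, FD R n M := by
  obtain ⟨n, P, f, hf, hflat, hzero⟩ := h
  have ex : ∀ i, LinearMap.range (P.d (i+2) (i+1)).hom = LinearMap.ker (P.d (i+1) i).hom := by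
    intro i
    have h1 : P.ExactAt (i + 1) := by
      rw [← quasiIsoAt_iff_exactAt' f (i + 1) (ChainComplex.exactAt_succ_single_obj _ _)]
      infer_instance
    have h2 : (ShortComplex.mk _ _ (P.d_comp_d (i + 2) (i + 1) i)).Exact :=
      ((HomologicalComplex.exactAt_iff' _ (i + 2) (i + 1) i) (by simp only [ChainComplex.prev]; rfl)
        (by simp)).1 h1
    exact h2.moduleCat_range_eq_ker
  have hB : ∀ k i, n ≤ i + k → FD R k (LinearMap.range (P.d (i+1) i).hom) := by
    intro k
    induction k with
    | zero =>
      intro i hi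
      have h0 := hzero (i + 1) (by omega)
      have : P.d (i+1) i = 0 := h0.eq_of_src _ _
      rw [this]
      show Module.Flat R (LinearMap.range (0 : P.X (i+1) →ₗ[R] P.X i))
      rw [LinearMap.range_zero]
      infer_instance
    | succ k ih =>
      intro i hi
      have := hflat (i + 1)
      refine ⟨P.X (i+1), _, _, (P.d (i+1) i).hom.rangeRestrict, inferInstance,
        LinearMap.surjective_rangeRestrict _, ?_⟩
      rw [LinearMap.ker_rangeRestrict, ← ex]
      exact ih (i + 1) (by omega)
  let f0 : P.X 0 ⟶ ModuleCat.of R M := f.f 0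
  have w : P.d 1 0 ≫ f0 = 0 := by
    have := f.comm 1 0
    rw [show ((ChainComplex.single₀ (ModuleCat R)).obj (ModuleCat.of R M)).d 1 0 = 0 from
      HomologicalComplex.single_obj_d _ _ _ _ _, Limits.comp_zero] at this
    exact this.symm
  have hcok : Nonempty (Limits.IsColimit (Limits.CokernelCofork.ofπ f0 w)) := by
    refine ⟨Limits.IsColimit.ofIsoColimit (P.opcyclesIsCokernel 1 0 (by simp)) ?_⟩
    let Q := (ChainComplex.single₀ (ModuleCat R)).obj (ModuleCat.of R M)
    have i1 : IsIso (HomologicalComplex.opcyclesMap f 0) := by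
      have hn : HomologicalComplex.opcyclesMap f 0 = P.isoHomologyι₀.inv ≫
          HomologicalComplex.homologyMap f 0 ≫ (ChainComplex.isoHomologyι₀ Q).hom := by
        rw [ChainComplex.isoHomologyι₀_inv_naturality_assoc]
        simp [Q]
      rw [hn]
      infer_instance
    have i2 : IsIso (Q.pOpcycles 0) :=
      HomologicalComplex.isIso_pOpcycles Q 1 0 (by simp)
        (HomologicalComplex.single_obj_d _ _ _ _ _)
    have hc : P.pOpcycles 0 ≫ HomologicalComplex.opcyclesMap f 0 ≫ inv (Q.pOpcycles 0) = f.f 0 := by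
      rw [HomologicalComplex.p_opcyclesMap_assoc, IsIso.hom_inv_id, Category.comp_id]
    exact Limits.Cofork.ext (asIso (HomologicalComplex.opcyclesMap f 0) ≪≫
      (asIso (Q.pOpcycles 0)).symm) hc
  obtain ⟨hcok⟩ := hcok
  have hepi : Epi f0 := Limits.epi_of_isColimit_cofork hcok
  have hex : (ShortComplex.mk _ _ w).Exact := ShortComplex.exact_of_g_is_cokernel _ hcok
  refine ⟨n + 1, P.X 0, inferInstance, inferInstance, f0.hom, hflat 0,
    (ModuleCat.epi_iff_surjective _).1 hepi, ?_⟩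
  have := hex.moduleCat_range_eq_ker
  dsimp only at this
  rw [← this]
  exact hB n 0 (by omega)

end LCIaux
namespace LCIaux
open TensorProduct

lemma free_coker {A N M P : Type} [CommRing A] [IsLocalRing A] [AddCommGroup N] [Module A N]
    [AddCommGroup M] [Module A M] [AddCommGroup P] [Module A P] [Module.Free A N]
    [Module.Finite A N] [Module.Free A M] [Module.Finite A M]
    (y : A) (hy : y ≠ 0) (hy' : ∀ a ∈ IsLocalRing.maximalIdeal A, a * y = 0)
    (f : N →ₗ[A] M) (g : M →ₗ[A] P) (hf : Function.Injective f) (hg : Function.Surjective g)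
    (hfg : Function.Exact f g) :
    Module.Free A P ∧ Module.finrank A P + Module.finrank A N = Module.finrank A M := by
  have hfree : Module.Free A P := by
    refine Module.free_of_lTensor_residueField_injective f g hg hfg ?_
    rw [injective_iff_map_eq_zero]
    intro t ht
    obtain ⟨n, rfl⟩ := exists_one_tmul (IsLocalRing.maximalIdeal A) t
    have ht' := (one_tmul_eq_zero_iff (IsLocalRing.maximalIdeal A) (f n)).1 ht
    refine (one_tmul_eq_zero_iff (IsLocalRing.maximalIdeal A) n).2 ?_
    have h1 : ∀ w ∈ IsLocalRing.maximalIdeal A • (⊤ : Submodule A M), y • w = 0 := by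
      intro w hw
      refine Submodule.smul_induction_on hw ?_ ?_
      · intro a ha v _
        rw [smul_smul, mul_comm, hy' a ha, zero_smul]
      · intro u v hu hv
        rw [smul_add, hu, hv, add_zero]
    have h2 : y • n = 0 := by
      apply hf
      rw [map_smul, h1 _ ht', map_zero]
    let b := Module.Free.chooseBasis A N
    rw [← b.sum_repr n]
    refine Submodule.sum_mem _ fun i _ => Submodule.smul_mem_smul ?_ trivial
    rw [IsLocalRing.mem_maximalIdeal, mem_nonunits_iff]
    intro hu
    have h3 : y * b.repr n i = 0 := by
      have := congrArg (fun v => b.repr v i) h2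
      simpa using this
    exact hy ((hu.mul_left_eq_zero).1 h3)
  refine ⟨hfree, ?_⟩
  obtain ⟨s, hs⟩ := Module.projective_lifting_property g LinearMap.id hg
  have hs' : ∀ p, g (s p) = p := fun p => LinearMap.congr_fun hs p
  have hgf : ∀ n, g (f n) = 0 := fun n => hfg.apply_apply_eq_zero n
  have hfin : Module.Finite A P := Module.Finite.of_surjective g hg
  let e : (P × N) ≃ₗ[A] M := LinearEquiv.ofBijective (LinearMap.coprod s f) ⟨by
    rw [injective_iff_map_eq_zero]
    rintro ⟨p, n⟩ h
    have h' : s p + f n = 0 := by simpa using h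
    have h2 := congrArg g h'
    have hp : p = 0 := by simpa [hs', hgf] using h2
    subst hp
    have : f n = 0 := by simpa using h'
    have hn : n = 0 := hf (by rw [this, map_zero])
    rw [hn]; rfl, by
    intro m
    obtain ⟨n, hn⟩ := (hfg (m - s (g m))).1 (by simp [hs'])
    exact ⟨(g m, n), by simp [hn]⟩⟩
  rw [← e.finrank_eq, Module.finrank_prod]

lemma exists_socle {R : Type} [CommRing R] [IsNoetherianRing R] (p : Ideal R) [hp : p.IsPrime]
    (h : p ∈ associatedPrimes R R) : ∃ y : Localization.AtPrime p, y ≠ 0 ∧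
      ∀ a ∈ IsLocalRing.maximalIdeal (Localization.AtPrime p), a * y = 0 := by
  rw [AssociatedPrimes.mem_iff, isAssociatedPrime_iff] at h
  obtain ⟨-, x, hx⟩ := h
  have hx' : ∀ a, a ∈ p ↔ a * x = 0 := by
    intro a; rw [hx]; simp [Submodule.mem_colon_singleton]
  refine ⟨algebraMap R _ x, ?_, ?_⟩
  · intro h0
    rw [IsLocalization.map_eq_zero_iff p.primeCompl] at h0
    obtain ⟨m, hm⟩ := h0
    exact m.2 ((hx' _).2 hm)
  · intro a ha
    obtain ⟨r, s, rfl⟩ := IsLocalization.exists_mk'_eq p.primeCompl a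
    rw [IsLocalization.AtPrime.mk'_mem_maximal_iff _ p] at ha
    rw [mul_comm, IsLocalization.mul_mk'_eq_mk'_of_mul, mul_comm, (hx' _).1 ha,
      IsLocalization.mk'_zero]

lemma FD.exists_rank {R : Type} [CommRing R] [IsNoetherianRing R] [IsLocalRing R] {n : ℕ}
    {M : Type} [AddCommGroup M] [Module R M] [Module.Finite R M] (h : FD R n M) :
    ∃ r : ℕ, ∀ (p : Ideal R) [p.IsPrime], p ∈ associatedPrimes R R →
      Module.Free (Localization.AtPrime p) (Localization.AtPrime p ⊗[R] M) ∧
      Module.finrank (Localization.AtPrime p) (Localization.AtPrime p ⊗[R] M) = r := by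
  induction n generalizing M with
  | zero =>
    have : Module.Flat R M := h
    have : Module.Free R M := Module.free_of_flat_of_isLocalRing
    exact ⟨Module.finrank R M, fun p _ _ => ⟨inferInstance, Module.finrank_baseChange⟩⟩
  | succ n ih =>
    obtain ⟨k, π, hπ⟩ := Module.Finite.exists_fin' R M
    obtain ⟨r, hr⟩ := ih (h.syzygy π hπ)
    refine ⟨k - r, fun p _ hp => ?_⟩
    obtain ⟨h1, h2⟩ := hr p hp
    obtain ⟨y, hy, hy'⟩ := exists_socle p hp
    obtain ⟨h3, h4⟩ := free_coker y hy hy'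
      ((LinearMap.ker π).subtype.baseChange (Localization.AtPrime p))
      (π.baseChange (Localization.AtPrime p))
      (Module.Flat.lTensor_preserves_injective_linearMap _ (Submodule.subtype_injective _))
      (LinearMap.lTensor_surjective _ hπ)
      (lTensor_exact _ (LinearMap.exact_subtype_ker_map π) hπ)
    refine ⟨h3, ?_⟩
    rw [Module.finrank_baseChange (R := Localization.AtPrime p) (M' := Fin k → R), Module.finrank_fin_fun] at h4
    omega

lemma exists_nzd {R : Type} [CommRing R] [IsNoetherianRing R] [IsLocalRing R] {n : ℕ}
    (I : Ideal R) (h : FD R n (R ⧸ I)) (hI : I ≠ ⊥) :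
    ∀ p ∈ associatedPrimes R R, ¬ I ≤ p := by
  obtain ⟨r, hr⟩ := h.exists_rank
  intro p hp hle
  -- `A ⊗ R/I` nontrivial and free forces `I A = 0`
  have key : ∀ (p' : Ideal R) [p'.IsPrime], p' ∈ associatedPrimes R R →
      Nontrivial (Localization.AtPrime p' ⊗[R] (R ⧸ I)) →
      I.map (algebraMap R (Localization.AtPrime p')) = ⊥ := by
    intro p' _ hp' hnt
    have := (hr p' hp').1
    rw [Ideal.map_eq_bot_iff_le_ker]
    intro i hi
    rw [RingHom.mem_ker]
    apply FaithfulSMul.eq_of_smul_eq_smul (α := Localization.AtPrime p' ⊗[R] (R ⧸ I))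
    intro t
    rw [zero_smul, algebraMap_smul]
    induction t with
    | zero => simp
    | add a b ha hb => rw [smul_add, ha, hb, add_zero]
    | tmul a b =>
      rw [← TensorProduct.tmul_smul]
      obtain ⟨b, rfl⟩ := Ideal.Quotient.mk_surjective b
      have : i • (Ideal.Quotient.mk I b) = 0 := by
        rw [Algebra.smul_def, Ideal.Quotient.algebraMap_eq, ← map_mul,
          Ideal.Quotient.eq_zero_iff_mem]
        exact I.mul_mem_right _ hi
      rw [this, TensorProduct.tmul_zero]
  have hprime : p.IsPrime := hp.1
  have hnt : Nontrivial (Localization.AtPrime p ⊗[R] (R ⧸ I)) := by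
    let C := IsLocalRing.ResidueField (Localization.AtPrime p)
    let f : Localization.AtPrime p →ₐ[R] C := IsScalarTower.toAlgHom R (Localization.AtPrime p) C
    let g : (R ⧸ I) →ₐ[R] C := Ideal.Quotient.liftₐ I (Algebra.ofId R C) (by
      intro a ha
      rw [Algebra.ofId_apply, IsScalarTower.algebraMap_apply R (Localization.AtPrime p) C]
      have : algebraMap R (Localization.AtPrime p) a ∈
          IsLocalRing.maximalIdeal (Localization.AtPrime p) :=
        (IsLocalization.AtPrime.to_map_mem_maximal_iff _ p a).2 (hle ha)
      exact (IsLocalRing.residue_eq_zero_iff _).2 this)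
    exact (Algebra.TensorProduct.productMap f g).toRingHom.domain_nontrivial
  have hrpos : 0 < r := by
    have := (hr p hp).1
    rw [← (hr p hp).2]
    exact Module.finrank_pos_iff_of_free _ _ |>.2 hnt
  obtain ⟨i, hi, hi0⟩ := Submodule.exists_mem_ne_zero_of_ne_bot hI
  obtain ⟨P, hP, hPle⟩ := exists_le_isAssociatedPrime_of_isNoetherianRing R i hi0
  have hPp : P.IsPrime := hP.1
  have hmap := key P hP (Module.nontrivial_of_finrank_pos (R := Localization.AtPrime P)
    (by rw [(hr P hP).2]; exact hrpos))
  have h0 : algebraMap R (Localization.AtPrime P) i = 0 := by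
    have := Ideal.mem_map_of_mem (algebraMap R (Localization.AtPrime P)) hi
    rw [hmap] at this
    exact this
  rw [IsLocalization.map_eq_zero_iff P.primeCompl] at h0
  obtain ⟨m, hm⟩ := h0
  exact m.2 (hPle (by simpa [Submodule.mem_colon_singleton] using hm))

end LCIaux
namespace LCIaux
open TensorProduct

lemma exists_elt {R : Type} [CommRing R] [IsNoetherianRing R] [IsLocalRing R] {k n : ℕ}
    (I : Ideal R) (hI : I ≠ ⊤) (x : Fin (k + 1) → R) (hx : Ideal.span (Set.range x) = I)
    (hind : ∀ a : Fin (k + 1) → R, ∑ i, a i * x i ∈ I ^ 2 → ∀ i, a i ∈ I) (h : FD R n I) :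
    ∃ z ∈ I, z ∉ IsLocalRing.maximalIdeal R * I ∧ IsSMulRegular R z := by
  have hxI : ∀ i, x i ∈ I := fun i => hx ▸ Ideal.subset_span ⟨i, rfl⟩
  have hm : I ≤ IsLocalRing.maximalIdeal R := IsLocalRing.le_maximalIdeal hI
  have h1I : (1 : R) ∉ I := fun h => hI ((Ideal.eq_top_iff_one I).2 h)
  have hnle : ¬ I ≤ IsLocalRing.maximalIdeal R * I := by
    intro hle
    have h0 := hle (hxI 0)
    have h0' : x 0 ∈ IsLocalRing.maximalIdeal R • Submodule.span R (Set.range x) := by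
      have e : Submodule.span R (Set.range x) = I := hx
      rw [e]; exact h0
    obtain ⟨b, hb, hbx⟩ := (Submodule.mem_ideal_smul_span_iff_exists_sum _ _ _).1 h0'
    rw [Finsupp.sum_fintype _ _ (by simp)] at hbx
    have h2 := hind (fun i => (if i = 0 then 1 else 0) - b i) (by
      simp only [sub_mul, Finset.sum_sub_distrib]
      simp only [smul_eq_mul] at hbx
      rw [hbx]
      simp) 0
    simp only [if_true] at h2
    have h3 := Ideal.add_mem _ (hm h2) (hb 0)
    rw [sub_add_cancel] at h3
    exact (Ideal.ne_top_iff_one _).1 (IsLocalRing.maximalIdeal.isMaximal R).ne_top h3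
  have hbot : I ≠ ⊥ := by
    rintro rfl
    exact hnle bot_le
  have hFD : FD R (n + 1) (R ⧸ I) :=
    FD.of_exact I.subtype I.mkQ (Submodule.subtype_injective _) (Submodule.mkQ_surjective _)
      (LinearMap.exact_subtype_mkQ I) h
  have hass := exists_nzd I hFD hbot
  by_contra! hcon
  have hsub : (I : Set R) ⊆ ⋃ J ∈ insert (IsLocalRing.maximalIdeal R * I) (associatedPrimes R R),
      ((id J : Ideal R) : Set R) := by
    intro z hz
    by_cases hz' : z ∈ IsLocalRing.maximalIdeal R * I
    · exact Set.mem_biUnion (Set.mem_insert _ _) hz'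
    · have h2 := hcon z hz hz'
      have h3 : z ∈ ⋃ p ∈ associatedPrimes R R, (p : Set R) := by
        rw [biUnion_associatedPrimes_eq_compl_regular]
        exact h2
      obtain ⟨p, hp, hzp⟩ := Set.mem_iUnion₂.1 h3
      exact Set.mem_biUnion (Set.mem_insert_of_mem _ hp) hzp
  rw [Ideal.subset_union_prime_finite ((associatedPrimes.finite R R).insert _)
    (IsLocalRing.maximalIdeal R * I) (IsLocalRing.maximalIdeal R * I)] at hsub
  · obtain ⟨J, hJ, hIJ⟩ := hsub
    rcases hJ with rfl | hJ
    · exact hnle hIJ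
    · exact hass J hJ hIJ
  · intro J hJ hJ1 _
    rcases hJ with rfl | hJ
    · exact absurd rfl hJ1
    · exact hJ.1

lemma exists_section {A F B C : Type} [CommRing A] [AddCommGroup F] [Module A F] [AddCommGroup B]
    [Module A B] [AddCommGroup C] [Module A C] (s : F →ₗ[A] B) (p : B →ₗ[A] C)
    (ht : Function.Surjective (p ∘ₗ s)) (hk : ∀ v, p (s v) = 0 → s v = 0) :
    ∃ i : C →ₗ[A] B, p ∘ₗ i = LinearMap.id := by
  let e := (p ∘ₗ s).quotKerEquivOfSurjective ht
  refine ⟨(LinearMap.ker (p ∘ₗ s)).liftQ s (fun v hv => hk v hv) ∘ₗ e.symm.toLinearMap, ?_⟩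
  ext c
  obtain ⟨v, rfl⟩ := ht c
  have : e.symm ((p ∘ₗ s) v) = Submodule.Quotient.mk v := by
    rw [LinearEquiv.symm_apply_eq]; rfl
  simp only [LinearMap.comp_apply, LinearEquiv.coe_coe, LinearMap.id_apply] at this ⊢
  rw [this]
  rfl

lemma FD.quot_ideal {R : Type} [CommRing R] {k n : ℕ} (I : Ideal R) (z : R) (hzI : z ∈ I)
    (hz : IsSMulRegular R z) (y : Fin k → R) (hy : ∀ i, y i ∈ I)
    (hspan : I = Ideal.span {z} ⊔ Ideal.span (Set.range y))
    (hind : ∀ (b : R) (c : Fin k → R), b * z + ∑ i, c i * y i = 0 → b ∈ I)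
    (h : FD R n I) :
    FD (R ⧸ Ideal.span {z}) n (I.map (Ideal.Quotient.mk (Ideal.span {z}))) := by
  set R' := R ⧸ Ideal.span {z}
  set I' := I.map (Ideal.Quotient.mk (Ideal.span {z})) with hI'
  have hM : IsSMulRegular I z := by
    intro a b hab
    exact Subtype.ext (hz (congrArg Subtype.val hab))
  have h1 := FD.baseChange_quot z hz hM h
  let l : I →ₗ[R] I' :=
    { toFun := fun a => ⟨Ideal.Quotient.mk _ a.1, Ideal.mem_map_of_mem _ a.2⟩
      map_add' := fun a b => Subtype.ext (by simp)
      map_smul' := fun r a => Subtype.ext (by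
        simp [Algebra.smul_def]) }
  let p : R' ⊗[R] I →ₗ[R'] I' := LinearMap.liftBaseChange R' l
  let s : (Fin k → R') →ₗ[R'] R' ⊗[R] I :=
    Fintype.linearCombination R' (fun i => (1 : R') ⊗ₜ[R] (⟨y i, hy i⟩ : I))
  have hs : ∀ c : Fin k → R, s (fun i => Ideal.Quotient.mk _ (c i)) =
      (1 : R') ⊗ₜ[R] (∑ i, c i • (⟨y i, hy i⟩ : I)) := by
    intro c
    simp only [s, Fintype.linearCombination_apply, TensorProduct.tmul_sum]
    refine Finset.sum_congr rfl fun i _ => ?_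
    rw [TensorProduct.tmul_smul, ← algebraMap_smul R' (c i)]
    rfl
  have hp : ∀ a : I, p ((1 : R') ⊗ₜ[R] a) = l a := by
    intro a
    simp [p]
  have hlift : ∀ c' : Fin k → R', ∃ c : Fin k → R, c' = fun i => Ideal.Quotient.mk _ (c i) := by
    intro c'
    choose c hc using fun i => Ideal.Quotient.mk_surjective (c' i)
    exact ⟨c, funext fun i => (hc i).symm⟩
  obtain ⟨i, hi⟩ := exists_section s p (by
    rintro ⟨w, hw⟩
    rw [hI', Ideal.mem_map_iff_of_surjective _ Ideal.Quotient.mk_surjective] at hw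
    obtain ⟨v, hv, rfl⟩ := hw
    rw [hspan, Submodule.mem_sup] at hv
    obtain ⟨v1, hv1, v2, hv2, rfl⟩ := hv
    obtain ⟨c, rfl⟩ := Ideal.mem_span_range_iff_exists_fun.1 hv2
    refine ⟨fun i => Ideal.Quotient.mk _ (c i), ?_⟩
    rw [LinearMap.comp_apply, hs, hp]
    apply Subtype.ext
    show Ideal.Quotient.mk _ _ = Ideal.Quotient.mk _ _
    rw [map_add, Ideal.Quotient.eq_zero_iff_mem.2 hv1, zero_add]
    simp) (by
    intro c' hc'
    obtain ⟨c, rfl⟩ := hlift c'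
    rw [hs, hp] at hc'
    rw [hs, one_tmul_eq_zero_iff]
    have h2 : Ideal.Quotient.mk (Ideal.span {z}) (∑ i, c i * y i) = 0 := by
      have := congrArg Subtype.val hc'
      simpa [l] using this
    rw [Ideal.Quotient.eq_zero_iff_mem, Ideal.mem_span_singleton'] at h2
    obtain ⟨b, hb⟩ := h2
    have hbI : -b ∈ I := hind (-b) c (by rw [← hb]; ring)
    have hbI : b ∈ I := by simpa using hbI
    have : ∑ i, c i • (⟨y i, hy i⟩ : I) = z • (⟨b, hbI⟩ : I) := by
      apply Subtype.ext
      have e : ((∑ i, c i • (⟨y i, hy i⟩ : I) : I) : R) = ∑ i, c i * y i := by simp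
      rw [e, ← hb, mul_comm]
      rfl
    rw [this]
    exact Submodule.smul_mem_smul (Ideal.mem_span_singleton_self z) trivial)
  exact FD.retract i p hi h1

lemma lift_regular {R : Type} [CommRing R] (I : Ideal R) (hI : I ≠ ⊤) (z : R) (hzI : z ∈ I)
    (hz : IsSMulRegular R z) (rs' : List (R ⧸ Ideal.span {z}))
    (hreg : RingTheory.Sequence.IsRegular (R ⧸ Ideal.span {z}) rs')
    (hrs : Ideal.ofList rs' = I.map (Ideal.Quotient.mk (Ideal.span {z}))) :
    ∃ rs : List R, RingTheory.Sequence.IsRegular R rs ∧ Ideal.ofList rs = I := by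
  obtain ⟨l, rfl⟩ := List.map_surjective_iff.2
    (Ideal.Quotient.mk_surjective (I := Ideal.span {z})) rs'
  have hof : Ideal.ofList (z :: l) = I := by
    rw [← Ideal.map_ofList] at hrs
    have := congrArg (Ideal.comap (Ideal.Quotient.mk (Ideal.span {z}))) hrs
    rw [Ideal.comap_map_of_surjective _ Ideal.Quotient.mk_surjective,
      Ideal.comap_map_of_surjective _ Ideal.Quotient.mk_surjective,
      ← RingHom.ker_eq_comap_bot, Ideal.mk_ker, sup_of_le_left (a := I)
        ((Ideal.span_singleton_le_iff_mem I).2 hzI)] at this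
    rw [Ideal.ofList_cons, sup_comm, this]
  refine ⟨z :: l, ⟨?_, ?_⟩, hof⟩
  · rw [RingTheory.Sequence.isWeaklyRegular_cons_iff]
    refine ⟨hz, ?_⟩
    have h1 := hreg.toIsWeaklyRegular
    have h2 : RingTheory.Sequence.IsWeaklyRegular (R ⧸ Ideal.span {z}) l :=
      (RingTheory.Sequence.isWeaklyRegular_map_algebraMap_iff (R ⧸ Ideal.span {z}) _ l).1 h1
    have e : (R ⧸ Ideal.span {z}) ≃ₗ[R] QuotSMulTop z R :=
      Submodule.quotEquivOfEq _ _ (by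
        rw [← Submodule.ideal_span_singleton_smul]; simp)
    exact (e.isWeaklyRegular_congr l).1 h2
  · rw [hof]
    simpa using hI.symm

lemma vasc {k : ℕ} : ∀ {R : Type} [CommRing R] [IsNoetherianRing R] [IsLocalRing R] {n : ℕ}
    (I : Ideal R) (_ : I ≠ ⊤) (x : Fin k → R) (_ : Ideal.span (Set.range x) = I)
    (_ : ∀ a : Fin k → R, ∑ i, a i * x i ∈ I ^ 2 → ∀ i, a i ∈ I) (_ : FD R n I),
    ∃ rs : List R, RingTheory.Sequence.IsRegular R rs ∧ Ideal.ofList rs = I := by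
  induction k with
  | zero =>
    intro R _ _ _ n I hI x hx _ _
    refine ⟨[], RingTheory.Sequence.IsRegular.nil _ _, ?_⟩
    rw [← hx]; simp [Ideal.ofList]
  | succ k ih =>
    intro R _ _ _ n I hI x hx hind h
    have hxI : ∀ i, x i ∈ I := fun i => hx ▸ Ideal.subset_span ⟨i, rfl⟩
    obtain ⟨z, hzI, hzm, hz⟩ := exists_elt I hI x hx hind h
    obtain ⟨a, ha⟩ := Ideal.mem_span_range_iff_exists_fun.1 (hx ▸ hzI : z ∈ Ideal.span (Set.range x))
    have hj : ∃ j, IsUnit (a j) := by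
      by_contra! hcon
      apply hzm
      rw [← ha]
      exact Ideal.sum_mem _ fun i _ => Ideal.mul_mem_mul
        ((IsLocalRing.mem_maximalIdeal _).2 (hcon i)) (hxI i)
    obtain ⟨j, hj⟩ := hj
    let y : Fin k → R := fun i => x (j.succAbove i)
    have hyI : ∀ i, y i ∈ I := fun i => hxI _
    have hind2 : ∀ (b : R) (c : Fin k → R), b * z + ∑ i, c i * y i ∈ I ^ 2 →
        b ∈ I ∧ ∀ i, c i ∈ I := by
      intro b c hbc
      have h1 := hind (j.insertNth (b * a j) (fun i => b * a (j.succAbove i) + c i)) (by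
        rw [Fin.sum_univ_succAbove _ j]
        simp only [Fin.insertNth_apply_same, Fin.insertNth_apply_succAbove]
        convert hbc using 1
        rw [← ha, Fin.sum_univ_succAbove _ j]
        simp only [add_mul, Finset.sum_add_distrib, mul_add, Finset.mul_sum, y, mul_assoc, add_assoc])
      have hb : b ∈ I := by
        have h2 := h1 j
        rw [Fin.insertNth_apply_same] at h2
        obtain ⟨u, hu⟩ := hj
        have := I.mul_mem_right (↑u⁻¹ : R) h2
        rwa [← hu, mul_assoc, Units.mul_inv, mul_one] at this
      refine ⟨hb, fun i => ?_⟩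
      have h2 := h1 (j.succAbove i)
      rw [Fin.insertNth_apply_succAbove] at h2
      exact (Ideal.add_mem_iff_right _ (I.mul_mem_right _ hb)).1 h2
    have hspan : I = Ideal.span {z} ⊔ Ideal.span (Set.range y) := by
      apply le_antisymm
      · rw [← hx, Ideal.span_le]
        rintro _ ⟨i, rfl⟩
        have hy : ∀ i, y i ∈ Ideal.span {z} ⊔ Ideal.span (Set.range y) := fun i =>
          Ideal.mem_sup_right (Ideal.subset_span ⟨i, rfl⟩)
        rcases Fin.eq_self_or_eq_succAbove j i with rfl | ⟨i, rfl⟩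
        · have h2 : a i * x i ∈ Ideal.span {z} ⊔ Ideal.span (Set.range y) := by
            have : a i * x i = z - ∑ l, a (i.succAbove l) * y l := by
              rw [← ha, Fin.sum_univ_succAbove _ i]; simp [y]
            rw [this]
            exact Ideal.sub_mem _ (Ideal.mem_sup_left (Ideal.mem_span_singleton_self z))
              (Ideal.sum_mem _ fun l _ => Ideal.mul_mem_left _ _ (hy l))
          exact (Ideal.unit_mul_mem_iff_mem _ hj).1 h2
        · exact hy i
      · rw [sup_le_iff, Ideal.span_singleton_le_iff_mem, Ideal.span_le]
        refine ⟨hzI, ?_⟩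
        rintro _ ⟨i, rfl⟩
        exact hyI i
    have hFD := FD.quot_ideal I z hzI hz y hyI hspan
      (fun b c hbc => (hind2 b c (by rw [hbc]; exact zero_mem _)).1) h
    have hz1 : Ideal.span {z} ≠ ⊤ := by
      intro h
      apply hI
      rw [eq_top_iff, ← h]
      exact (Ideal.span_singleton_le_iff_mem I).2 hzI
    have : Nontrivial (R ⧸ Ideal.span {z}) := Ideal.Quotient.nontrivial_iff.2 hz1
    have : IsLocalRing (R ⧸ Ideal.span {z}) :=
      IsLocalRing.of_surjective' (Ideal.Quotient.mk (Ideal.span {z})) Ideal.Quotient.mk_surjective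
    have hcm : (I.map (Ideal.Quotient.mk (Ideal.span {z}))).comap
        (Ideal.Quotient.mk (Ideal.span {z})) = I := by
      rw [Ideal.comap_map_of_surjective _ Ideal.Quotient.mk_surjective,
      ← RingHom.ker_eq_comap_bot, Ideal.mk_ker, sup_of_le_left (a := I)
        ((Ideal.span_singleton_le_iff_mem I).2 hzI)]
    obtain ⟨rs', hreg, hrs⟩ := ih (I.map (Ideal.Quotient.mk (Ideal.span {z}))) (by
        intro h
        rw [h, Ideal.comap_top] at hcm
        exact hI hcm.symm)
      (fun i => Ideal.Quotient.mk _ (y i)) (by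
        conv_rhs => rw [hspan]
        rw [Ideal.map_sup, Ideal.map_quotient_self, bot_sup_eq, Ideal.map_span, ← Set.range_comp]
        rfl) (by
        intro c' hc'
        choose c hc using fun i => Ideal.Quotient.mk_surjective (c' i)
        have h1 : Ideal.Quotient.mk (Ideal.span {z}) (∑ i, c i * y i) ∈
            (I ^ 2).map (Ideal.Quotient.mk (Ideal.span {z})) := by
          rw [Ideal.map_pow]
          simpa [hc] using hc'
        rw [Ideal.mem_map_iff_of_surjective _ Ideal.Quotient.mk_surjective] at h1
        obtain ⟨v, hv, hvc⟩ := h1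
        rw [Ideal.Quotient.eq, Ideal.mem_span_singleton'] at hvc
        obtain ⟨b, hb⟩ := hvc
        have h2 := (hind2 b c (by
          rw [hb, sub_add_cancel]; exact hv)).2
        intro i
        rw [← hc]
        exact Ideal.mem_map_of_mem _ (h2 i)) hFD
    exact lift_regular I hI z hzI hz rs' hreg hrs

end LCIaux
namespace LCIaux

lemma fin_reg {R : Type} [CommRing R] {k : ℕ} (x : Fin k → R)
    (h : ∀ (i : Fin k) (c : R), c * x i ∈ Ideal.span (x '' {j | j < i}) →
      c ∈ Ideal.span (x '' {j | j < i})) :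
    ∀ a : Fin k → R, ∑ i, a i * x i = 0 → ∀ i, a i ∈ Ideal.span (Set.range x) := by
  induction k with
  | zero => intro a _ i; exact i.elim0
  | succ k ih =>
    intro a ha
    have himg : ∀ i : Fin k, x '' {j | j < i.castSucc} =
        (fun l : Fin k => x l.castSucc) '' {j | j < i} := by
      intro i
      ext w
      constructor
      · rintro ⟨j, hj, rfl⟩
        have hj' : (j : ℕ) < i := hj
        exact ⟨⟨j, by omega⟩, hj', rfl⟩
      · rintro ⟨j, hj, rfl⟩
        exact ⟨j.castSucc, hj, rfl⟩
    have hlast : x '' {j | j < Fin.last k} = Set.range (fun l : Fin k => x l.castSucc) := by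
      ext w
      constructor
      · rintro ⟨j, hj, rfl⟩
        have hj' : (j : ℕ) < k := hj
        exact ⟨⟨j, hj'⟩, rfl⟩
      · rintro ⟨j, rfl⟩
        exact ⟨j.castSucc, j.2, rfl⟩
    have hle : Ideal.span (Set.range (fun l : Fin k => x l.castSucc)) ≤
        Ideal.span (Set.range x) := by
      apply Ideal.span_mono
      rintro _ ⟨l, rfl⟩
      exact ⟨_, rfl⟩
    have ih' := ih (fun l => x l.castSucc) (by
      intro i c hc
      rw [← himg] at hc ⊢
      exact h _ c hc)
    rw [Fin.sum_univ_castSucc] at ha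
    have hl : a (Fin.last k) ∈ Ideal.span (Set.range (fun l : Fin k => x l.castSucc)) := by
      rw [← hlast]
      apply h
      rw [hlast, eq_neg_of_add_eq_zero_right ha]
      exact neg_mem (Ideal.sum_mem _ fun i _ => Ideal.mul_mem_left _ _
        (Ideal.subset_span ⟨i, rfl⟩))
    obtain ⟨b, hb⟩ := Ideal.mem_span_range_iff_exists_fun.1 hl
    have h2 := ih' (fun i => a i.castSucc + b i * x (Fin.last k)) (by
      rw [← ha, ← hb, Finset.sum_mul, ← Finset.sum_add_distrib]
      exact Finset.sum_congr rfl fun i _ => by ring)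
    intro i
    refine Fin.lastCases (hle hl) (fun i => ?_) i
    have h3 := hle (h2 i)
    exact (Ideal.add_mem_iff_left _ (Ideal.mul_mem_left _ (b i)
      (Ideal.subset_span (Set.mem_range_self (Fin.last k))))).1 h3

lemma list_indep {R : Type} [CommRing R] (rs : List R)
    (h : RingTheory.Sequence.IsWeaklyRegular R rs) :
    Ideal.span (Set.range rs.get) = Ideal.ofList rs ∧
    ∀ a : Fin rs.length → R, ∑ i, a i * rs.get i ∈ (Ideal.ofList rs) ^ 2 →
      ∀ i, a i ∈ Ideal.ofList rs := by
  have hspan : Ideal.span (Set.range rs.get) = Ideal.ofList rs := by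
    rw [Set.range_list_get]
  refine ⟨hspan, ?_⟩
  intro a ha
  have key := fin_reg rs.get (by
    intro i c hc
    have h1 := RingTheory.Sequence.isWeaklyRegular_iff_Fin _ _ |>.1 h i
    have htake : rs.get '' {j | j < i} = {r | r ∈ rs.take i} := by
      ext w
      simp only [Set.mem_image, Set.mem_ofPred_eq, List.mem_take_iff_getElem]
      constructor
      · rintro ⟨j, hj, rfl⟩
        have hj' : (j : ℕ) < i := hj
        exact ⟨j, by have := j.2; omega, rfl⟩
      · rintro ⟨j, hj, rfl⟩
        exact ⟨⟨j, by omega⟩, by show j < (i : ℕ); omega, rfl⟩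
    rw [htake] at hc ⊢
    have h2 : c • rs.get i ∈ Ideal.ofList (rs.take i) • (⊤ : Submodule R R) := by
      simpa using hc
    have h3 : (Submodule.Quotient.mk c : R ⧸ (Ideal.ofList (rs.take i) • (⊤ : Submodule R R))) = 0 := by
      apply h1.right_eq_zero_of_smul
      have h4 : rs[i] • (Submodule.Quotient.mk c :
          R ⧸ (Ideal.ofList (rs.take i) • (⊤ : Submodule R R))) =
          Submodule.Quotient.mk (c • rs.get i) := by
        have h5 : c • rs.get i = rs[i] • c := mul_comm _ _
        rw [h5]; rfl
      rw [h4, Submodule.Quotient.mk_eq_zero]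
      exact h2
    rw [Submodule.Quotient.mk_eq_zero] at h3
    simpa using h3)
  have h0' : ∑ i, a i * rs.get i ∈ Ideal.ofList rs • Submodule.span R (Set.range rs.get) := by
    have e : Submodule.span R (Set.range rs.get) = Ideal.ofList rs := hspan
    rw [e, smul_eq_mul, ← sq]; exact ha
  obtain ⟨b, hb, hbx⟩ := (Submodule.mem_ideal_smul_span_iff_exists_sum _ _ _).1 h0'
  rw [Finsupp.sum_fintype _ _ (by simp)] at hbx
  simp only [smul_eq_mul] at hbx
  have h2 := key (fun i => a i - b i) (by
    simp only [sub_mul, Finset.sum_sub_distrib]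
    rw [hbx, sub_self])
  rw [hspan] at h2
  intro i
  have := Ideal.add_mem _ (h2 i) (hb i)
  rwa [sub_add_cancel] at this

end LCIaux
namespace LCIaux
lemma beta_sum {A B L : Type} [CommRing A] [CommRing B]
    [AddCommGroup L] [Module B L] (ψ : A →+* B)
    (J : Ideal A)
    (β : J →+ L)
    (hβ : ∀ (a : A) (j : J), β (a • j) = ψ a • β j)
    {ι : Type} [Fintype ι] (a : ι → A) (x : ι → J) :
    β (∑ i, a i • x i) = ∑ i, ψ (a i) • β (x i) := by
  rw [map_sum]
  exact Finset.sum_congr rfl fun i _ => hβ _ _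

lemma beta_span {A B L : Type} [CommRing A] [CommRing B] [Nontrivial B]
    [AddCommGroup L] [Module B L] (ψ : A →+* B)
    (J : Ideal A)
    (β : J →+ L)
    (hβ : ∀ (a : A) (j : J), β (a • j) = ψ a • β j)
    (hsurj : Function.Surjective β)
    {ι : Type} [Fintype ι] (x : ι → J)
    (hx : Ideal.span (Set.range fun i => (x i : A)) = J) :
    Submodule.span B (Set.range fun i => β (x i)) = ⊤ := by
  rw [eq_top_iff]
  rintro l -
  obtain ⟨j, rfl⟩ := hsurj l
  have hj : (j : A) ∈ Ideal.span (Set.range fun i => (x i : A)) := by rw [hx]; exact j.2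
  obtain ⟨a, ha⟩ := Ideal.mem_span_range_iff_exists_fun.1 hj
  have : j = ∑ i, a i • x i := Subtype.ext (by simp [← ha])
  rw [this, beta_sum ψ J β hβ]
  exact Submodule.sum_mem _ fun i _ => Submodule.smul_mem _ _ (Submodule.subset_span ⟨i, rfl⟩)

lemma free_of_indep {A B L : Type} [CommRing A] [CommRing B] [Nontrivial B]
    [AddCommGroup L] [Module B L] (ψ : A →+* B)
    (hψ : Function.Surjective ψ)
    (J : Ideal A)
    (hJ : RingHom.ker ψ = J)
    (β : J →+ L)
    (hβ : ∀ (a : A) (j : J), β (a • j) = ψ a • β j)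
    (hsurj : Function.Surjective β)
    (hker : ∀ j : J, β j = 0 ↔ (j : A) ∈ J ^ 2)
    {k : ℕ} (x : Fin k → A) (hx : Ideal.span (Set.range x) = J)
    (hind : ∀ a : Fin k → A, ∑ i, a i * x i ∈ J ^ 2 → ∀ i, a i ∈ J) : Module.Free B L := by
  have hxJ : ∀ i, x i ∈ J := fun i => hx ▸ Ideal.subset_span ⟨i, rfl⟩
  let y : Fin k → J := fun i => ⟨x i, hxJ i⟩
  have hli : LinearIndependent B (fun i => β (y i)) := by
    rw [Fintype.linearIndependent_iff]
    intro c hc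
    choose a ha using fun i => hψ (c i)
    have h1 : β (∑ i, a i • y i) = 0 := by
      rw [beta_sum ψ J β hβ, ← hc]
      exact Finset.sum_congr rfl fun i _ => by rw [ha]
    rw [hker] at h1
    have h2 := hind a (by simpa [y] using h1)
    intro i
    rw [← ha, ← RingHom.mem_ker, hJ]
    exact h2 i
  exact Module.Free.of_basis (Module.Basis.mk hli (beta_span ψ J β hβ hsurj y hx).ge)

lemma indep_of_free {A B L : Type} [CommRing A] [CommRing B] [Nontrivial B]
    [AddCommGroup L] [Module B L] (ψ : A →+* B)
    (hψ : Function.Surjective ψ)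
    (J : Ideal A)
    (hJ : RingHom.ker ψ = J)
    (β : J →+ L)
    (hβ : ∀ (a : A) (j : J), β (a • j) = ψ a • β j)
    (hsurj : Function.Surjective β)
    (hker : ∀ j : J, β j = 0 ↔ (j : A) ∈ J ^ 2)
    [IsNoetherianRing A] [IsLocalRing A] [Module.Free B L] :
    ∃ x : Fin (Module.finrank B L) → A, Ideal.span (Set.range x) = J ∧
      ∀ a : Fin (Module.finrank B L) → A, ∑ i, a i * x i ∈ J ^ 2 → ∀ i, a i ∈ J := by
  have hfg : J.FG := IsNoetherian.noetherian J
  have hfin : Module.Finite B L := by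
    obtain ⟨s, hs⟩ := hfg
    have hsJ : ∀ i : s, (i : A) ∈ J := fun i => hs ▸ Submodule.subset_span i.2
    have h1 := beta_span ψ J β hβ hsurj (fun i : s => (⟨i, hsJ i⟩ : J)) (by
      simpa using hs)
    exact ⟨Submodule.fg_def.2 ⟨_, Set.finite_range _, h1⟩⟩
  let b := Module.finBasis B L
  choose y hy using fun i => hsurj (b i)
  have hind : ∀ a : Fin (Module.finrank B L) → A, ∑ i, a i * (y i : A) ∈ J ^ 2 →
      ∀ i, a i ∈ J := by
    intro a ha
    have h1 : β (∑ i, a i • y i) = 0 := by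
      rw [hker]; simpa using ha
    rw [beta_sum ψ J β hβ] at h1
    simp only [hy] at h1
    have h2 := Fintype.linearIndependent_iff.1 b.linearIndependent _ h1
    intro i
    rw [← hJ, RingHom.mem_ker]
    exact h2 i
  refine ⟨fun i => y i, ?_, hind⟩
  apply le_antisymm
  · rw [Ideal.span_le]
    rintro _ ⟨i, rfl⟩
    exact (y i).2
  · have hJtop : J ≠ ⊤ := by
      rw [← hJ]; exact RingHom.ker_ne_top ψ
    apply Submodule.le_of_le_smul_of_le_jacobson_bot (I := J) hfg
    · rw [IsLocalRing.jacobson_eq_maximalIdeal ⊥ bot_ne_top]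
      exact IsLocalRing.le_maximalIdeal hJtop
    · intro j hj
      choose a ha using fun i => hψ (b.repr (β ⟨j, hj⟩) i)
      have h1 : β (⟨j, hj⟩ - ∑ i, a i • y i) = 0 := by
        rw [map_sub, beta_sum ψ J β hβ]
        simp only [ha, hy]
        rw [b.sum_repr, sub_self]
      rw [hker] at h1
      have h2 : j - ∑ i, a i * (y i : A) ∈ J ^ 2 := by simpa using h1
      rw [← sub_add_cancel j (∑ i, a i * (y i : A)), add_comm]
      refine Submodule.add_mem_sup ?_ ?_
      · exact Ideal.sum_mem _ fun i _ => Ideal.mul_mem_left _ _ (Ideal.subset_span ⟨i, rfl⟩)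
      · rw [smul_eq_mul, ← sq]; exact h2

lemma rank_of_free {A B L : Type} [CommRing A] [CommRing B] [Nontrivial B]
    [AddCommGroup L] [Module B L] (ψ : A →+* B)
    (hψ : Function.Surjective ψ)
    (J : Ideal A)
    (hJ : RingHom.ker ψ = J)
    (β : J →+ L)
    (hβ : ∀ (a : A) (j : J), β (a • j) = ψ a • β j)
    (hsurj : Function.Surjective β)
    (hker : ∀ j : J, β j = 0 ↔ (j : A) ∈ J ^ 2)
    [IsNoetherianRing A] [IsLocalRing A] [Module.Free B L] :
    Module.finrank B L = minimalGenerators J := by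
  classical
  obtain ⟨x, hx, -⟩ := indep_of_free ψ hψ J hJ β hβ hsurj hker
  have hmem : (Finset.univ.image x).card ∈
      {n | ∃ s : Finset A, s.card = n ∧ Ideal.span (s : Set A) = J} :=
    ⟨Finset.univ.image x, rfl, by simpa using hx⟩
  apply le_antisymm
  · obtain ⟨s, hs, hsJ⟩ := Nat.sInf_mem (s := {n | ∃ s : Finset A, s.card = n ∧
      Ideal.span (s : Set A) = J}) ⟨_, hmem⟩
    have hsJ' : ∀ i : s, (i : A) ∈ J := fun i => hsJ ▸ Submodule.subset_span i.2
    have h1 := beta_span ψ J β hβ hsurj (fun i : s => (⟨i, hsJ' i⟩ : J)) (by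
      simpa using hsJ)
    have h2 := finrank_range_le_card (R := B) (fun i : s => β (⟨i, hsJ' i⟩ : J))
    rw [Set.finrank, h1, finrank_top, Fintype.card_coe, hs] at h2
    exact h2
  · refine (Nat.sInf_le hmem).trans ?_
    exact Finset.card_image_le.trans (by simp)

end LCIaux
namespace LCIaux

lemma ker_local {R S : Type} [CommRing R] [CommRing S] (φ : R →+* S)
    (hφ : Function.Surjective φ) (q : Ideal S) [q.IsPrime] :
    RingHom.ker (Localization.localRingHom (q.comap φ) q φ rfl) =
      (RingHom.ker φ).map (algebraMap R (Localization.AtPrime (q.comap φ))) := by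
  apply le_antisymm
  · intro a ha
    obtain ⟨r, s, rfl⟩ := IsLocalization.exists_mk'_eq (q.comap φ).primeCompl a
    rw [RingHom.mem_ker, Localization.localRingHom_mk', IsLocalization.mk'_eq_zero_iff] at ha
    obtain ⟨u, hu⟩ := ha
    obtain ⟨v, hv⟩ := hφ u
    have h1 : v * r ∈ RingHom.ker φ := by rw [RingHom.mem_ker, map_mul, hv, hu]
    have hvp : v ∈ (q.comap φ).primeCompl := by
      intro h
      have : φ v ∈ q := h
      rw [hv] at this
      exact u.2 this
    have h2 := Ideal.mem_map_of_mem (algebraMap R (Localization.AtPrime (q.comap φ))) h1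
    rw [map_mul] at h2
    have h3 := (Ideal.unit_mul_mem_iff_mem _
      (IsLocalization.map_units (Localization.AtPrime (q.comap φ)) ⟨v, hvp⟩)).1 h2
    rw [← IsLocalization.mk'_spec' (Localization.AtPrime (q.comap φ)) r s] at h3
    exact (Ideal.unit_mul_mem_iff_mem _
      (IsLocalization.map_units (Localization.AtPrime (q.comap φ)) s)).1 h3
  · rw [Ideal.map_le_iff_le_comap]
    intro r hr
    rw [Ideal.mem_comap, RingHom.mem_ker, Localization.localRingHom_to_map,
      (RingHom.mem_ker).1 hr, map_zero]

lemma exists_beta {R S N : Type} [CommRing R] [CommRing S] (φ : R →+* S)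
    (hφ : Function.Surjective φ) (q : Ideal S) [q.IsPrime] [AddCommGroup N] [Module S N]
    (I : Ideal R) (hI : RingHom.ker φ = I) (γ : I →+ N) (hγ : ∀ (r : R) (i : I), γ (r • i) = φ r • γ i)
    (hsurj : Function.Surjective γ)
    (hker : ∀ i : I, γ i = 0 ↔ (i : R) ∈ I ^ 2) :
    ∃ β : (I.map (algebraMap R (Localization.AtPrime (q.comap φ)))) →+
        LocalizedModule q.primeCompl N,
      (∀ a j, β (a • j) = Localization.localRingHom (q.comap φ) q φ rfl a • β j) ∧
      Function.Surjective β ∧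
      ∀ j, β j = 0 ↔ (j : Localization.AtPrime (q.comap φ)) ∈
        (I.map (algebraMap R (Localization.AtPrime (q.comap φ)))) ^ 2 := by
  have hJ := ker_local φ hφ q
  rw [hI] at hJ
  set p := q.comap φ with hp
  set A := Localization.AtPrime p
  set J := I.map (algebraMap R A) with hJdef
  set ψ := Localization.localRingHom p q φ rfl with hψ
  set L := LocalizedModule q.primeCompl N
  let _ : Module R L := Module.compHom L φ
  have smul_def : ∀ (r : R) (l : L), r • l = φ r • l := fun _ _ => rfl
  have hmem : ∀ s : p.primeCompl, φ s ∈ q.primeCompl := fun s => s.2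
  -- cancellation
  have hbij : ∀ s : q.primeCompl, Function.Bijective (fun l : L => (s : S) • l) := fun s =>
    (Module.End.isUnit_iff _).1
      (IsLocalizedModule.map_units (S := q.primeCompl) (LocalizedModule.mkLinearMap q.primeCompl N) s)
  let f : I →ₗ[R] J := Algebra.idealMap A I
  have hf : IsLocalizedModule p.primeCompl f := Algebra.idealMap_isLocalizedModule _ _ _
  have hfval : ∀ i, (f i : A) = algebraMap R A i := fun i => rfl
  let g : I →ₗ[R] L :=
    { toFun := fun i => LocalizedModule.mkLinearMap q.primeCompl N (γ i)
      map_add' := fun a b => by simp only [map_add]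
      map_smul' := fun r a => by
        rw [hγ, map_smul]; rfl }
  have hunits : ∀ s : p.primeCompl, IsUnit (algebraMap R (Module.End R L) s) := by
    intro s
    rw [Module.End.isUnit_iff]
    exact hbij ⟨φ s, hmem s⟩
  let β : J →ₗ[R] L := IsLocalizedModule.lift p.primeCompl f g hunits
  have hβf : ∀ i, β (f i) = LocalizedModule.mkLinearMap q.primeCompl N (γ i) := fun i =>
    IsLocalizedModule.lift_apply p.primeCompl f g hunits i
  have hβsmul : ∀ (r : R) (j : J), β (r • j) = φ r • β j := fun r j => β.map_smul r j
  have hsemi : ∀ (a : A) (j : J), β (a • j) = ψ a • β j := by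
    intro a j
    obtain ⟨r, s, rfl⟩ := IsLocalization.exists_mk'_eq p.primeCompl a
    apply (hbij ⟨φ s, hmem s⟩).1
    show φ s • β _ = φ s • (ψ _ • β j)
    have h1 : (s : R) • (IsLocalization.mk' A r s • j) = r • j := by
      rw [← algebraMap_smul A (s : R), ← algebraMap_smul A r, smul_smul, IsLocalization.mk'_spec']
    have h2 : φ s • (ψ (IsLocalization.mk' A r s) • β j) = φ r • β j := by
      rw [← algebraMap_smul (Localization.AtPrime q) (φ s), ← algebraMap_smul (Localization.AtPrime q) (φ r), smul_smul,
        ← Localization.localRingHom_to_map p q φ rfl, ← map_mul, IsLocalization.mk'_spec',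
        Localization.localRingHom_to_map]
    rw [← hβsmul, h1, h2, hβsmul]
  refine ⟨β.toAddMonoidHom, hsemi, ?_, ?_⟩
  · intro l
    obtain ⟨⟨n, s⟩, hns⟩ := IsLocalizedModule.surj q.primeCompl (LocalizedModule.mkLinearMap q.primeCompl N) l
    obtain ⟨i, hi⟩ := hsurj n
    obtain ⟨t, ht⟩ := hφ s
    have htp : t ∈ p.primeCompl := by
      intro h
      have : φ t ∈ q := h
      rw [ht] at this
      exact s.2 this
    refine ⟨IsLocalizedModule.mk' f i ⟨t, htp⟩, ?_⟩
    apply (hbij s).1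
    show (s : S) • β _ = (s : S) • l
    rw [← ht, ← hβsmul]
    have h1 : t • IsLocalizedModule.mk' f i ⟨t, htp⟩ = f i :=
      IsLocalizedModule.mk'_cancel' f i ⟨t, htp⟩
    rw [h1, hβf, hi, ht]
    exact hns.symm
  · intro j
    constructor
    · intro hj
      have hj : β j = 0 := hj
      obtain ⟨⟨i, t⟩, hit⟩ := IsLocalizedModule.surj p.primeCompl f j
      have hit : (t : R) • j = f i := hit
      have h1 : LocalizedModule.mkLinearMap q.primeCompl N (γ i) = 0 := by
        rw [← hβf, ← hit, hβsmul, hj, smul_zero]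
      rw [IsLocalizedModule.eq_zero_iff q.primeCompl] at h1
      obtain ⟨u, hu⟩ := h1
      obtain ⟨v, hv⟩ := hφ u
      have hvp : v ∈ p.primeCompl := by
        intro h
        have : φ v ∈ q := h
        rw [hv] at this
        exact u.2 this
      have h2 : γ (v • i) = 0 := by rw [hγ, hv]; exact hu
      rw [hker] at h2
      have h3 := Ideal.mem_map_of_mem (algebraMap R A) h2
      rw [Ideal.map_pow] at h3
      have h4 : algebraMap R A ((v • i : I) : R) = algebraMap R A v * (algebraMap R A t * (j : A)) := by
        have h5 := congrArg Subtype.val hit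
        rw [hfval] at h5
        show algebraMap R A (v * i) = _
        rw [map_mul, ← h5]
        show _ * (t : R) • (j : A) = _
        rw [Algebra.smul_def]
      rw [h4] at h3
      have h6 := (Ideal.unit_mul_mem_iff_mem _ (IsLocalization.map_units A ⟨v, hvp⟩)).1 h3
      exact (Ideal.unit_mul_mem_iff_mem _ (IsLocalization.map_units A t)).1 h6
    · intro hj
      show β j = 0
      have key : ∀ a (ha : a ∈ J ^ 2), ∃ h : a ∈ J, β ⟨a, h⟩ = 0 := by
        intro a ha
        rw [sq] at ha
        refine Submodule.mul_induction_on ha ?_ ?_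
        · intro m hm n hn
          refine ⟨J.mul_mem_left _ hn, ?_⟩
          have h1 := hsemi m ⟨n, hn⟩
          rw [← hJ] at hm
          rw [(RingHom.mem_ker).1 hm, zero_smul] at h1
          exact h1
        · rintro x y ⟨hx, hx'⟩ ⟨hy, hy'⟩
          refine ⟨J.add_mem hx hy, ?_⟩
          have := β.map_add ⟨x, hx⟩ ⟨y, hy⟩
          rw [hx', hy', add_zero] at this
          exact this
      exact (key _ hj).2

end LCIaux
namespace LCIaux
open TensorProduct

lemma FD.local_ideal {R : Type} [CommRing R] {n : ℕ} (I : Ideal R) (p : Ideal R) [p.IsPrime]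
    (h : FD R n I) : FD (Localization.AtPrime p) n
      (I.map (algebraMap R (Localization.AtPrime p))) := by
  have h1 := h.baseChange_flat (Localization.AtPrime p)
  have hf : IsLocalizedModule p.primeCompl (Algebra.idealMap (Localization.AtPrime p) I) :=
    Algebra.idealMap_isLocalizedModule _ _ _
  exact h1.equiv (IsLocalizedModule.isBaseChange p.primeCompl (Localization.AtPrime p)
    (Algebra.idealMap (Localization.AtPrime p) I)).equiv

lemma FD.ker_ideal {R S : Type} [CommRing R] [CommRing S] (φ : R →+* S)
    (hφ : Function.Surjective φ) (hfd : letI := φ.toAlgebra; HasFiniteFlatDimension R S) :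
    ∃ n, FD R n (RingHom.ker φ) := by
  let _ := φ.toAlgebra
  obtain ⟨n, hn⟩ := FD.of_hasFinite hfd
  have h1 := hn.succ.syzygy (Algebra.linearMap R S) hφ
  exact ⟨n, h1.equiv (LinearEquiv.ofEq _ _ (by ext; rfl))⟩

lemma main_local {R S N : Type} [CommRing R] [CommRing S] [IsNoetherianRing R] (φ : R →+* S)
    (hφ : Function.Surjective φ) [AddCommGroup N] [Module S N]
    (hfd : letI := φ.toAlgebra; HasFiniteFlatDimension R S)
    (γ : RingHom.ker φ →+ N) (hγ : ∀ (r : R) (i : RingHom.ker φ), γ (r • i) = φ r • γ i)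
    (hsurj : Function.Surjective γ)
    (hker : ∀ i : RingHom.ker φ, γ i = 0 ↔ (i : R) ∈ (RingHom.ker φ) ^ 2)
    (q : Ideal S) [q.IsPrime] :
    (Localization.localRingHom (q.comap φ) q φ rfl).IsCompleteIntersection ↔
        Module.Free (Localization.AtPrime q) (LocalizedModule q.primeCompl N) ∧
        Module.finrank (Localization.AtPrime q) (LocalizedModule q.primeCompl N) =
          minimalGenerators
            (Ideal.map (algebraMap R (Localization.AtPrime (q.comap φ))) (RingHom.ker φ)) := by
  obtain ⟨β, h1, h2, h3⟩ := exists_beta φ hφ q _ rfl γ hγ hsurj hker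
  have hψ := RingHom.surjective_localRingHom_of_surjective φ hφ q
  have hJ := ker_local φ hφ q
  constructor
  · rintro ⟨rs, hreg, hrs⟩
    obtain ⟨h4, h5⟩ := list_indep rs hreg.toIsWeaklyRegular
    rw [hrs, hJ] at h4 h5
    have hfree := free_of_indep _ hψ _ hJ β h1 h2 h3 rs.get h4 h5
    exact ⟨hfree, rank_of_free _ hψ _ hJ β h1 h2 h3⟩
  · rintro ⟨hfree, -⟩
    obtain ⟨x, hx, hind⟩ := indep_of_free _ hψ _ hJ β h1 h2 h3
    obtain ⟨n, hn⟩ := FD.ker_ideal φ hφ hfd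
    have : IsNoetherianRing (Localization.AtPrime (q.comap φ)) :=
      IsLocalization.isNoetherianRing (q.comap φ).primeCompl _ inferInstance
    unfold RingHom.IsCompleteIntersection
    rw [hJ]
    exact vasc _ (by rw [← hJ]; exact RingHom.ker_ne_top _) x hx hind
      (hn.local_ideal _ (q.comap φ))

lemma cot_smul {R S : Type} [CommRing R] [CommRing S] (φ : R →+* S)
    (hφ : Function.Surjective φ) (r : R) (c : (RingHom.ker φ).Cotangent) :
    letI : Module S (RingHom.ker φ).Cotangent :=
      Module.compHom _
        ((RingHom.quotientKerEquivOfSurjective (f := φ) hφ).symm : S ≃+* _).toRingHom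
    φ r • c = r • c := by
  show (RingHom.quotientKerEquivOfSurjective (f := φ) hφ).symm (φ r) • c = r • c
  have : (RingHom.quotientKerEquivOfSurjective (f := φ) hφ).symm (φ r) =
      Ideal.Quotient.mk _ r := by
    rw [RingEquiv.symm_apply_eq]; rfl
  rw [this]
  exact algebraMap_smul (R ⧸ RingHom.ker φ) r c

end LCIaux

theorem lci_iff_conormal_locally_free
    (R S : Type) [CommRing R] [CommRing S]
    [IsNoetherianRing R] [IsNoetherianRing S]
    (φ : R →+* S) (hφ : Function.Surjective φ)
    (hfd : letI := φ.toAlgebra; HasFiniteFlatDimension R S) :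
    letI : Module S (RingHom.ker φ).Cotangent :=
      Module.compHom _
        ((RingHom.quotientKerEquivOfSurjective (f := φ) hφ).symm : S ≃+* _).toRingHom
    ((∀ (q : Ideal S) (_ : q.IsPrime),
        (Localization.localRingHom (q.comap φ) q φ rfl).IsCompleteIntersection) ↔
      (∀ (q : Ideal S) (_ : q.IsPrime),
        Module.Free (Localization.AtPrime q)
          (LocalizedModule q.primeCompl (RingHom.ker φ).Cotangent) ∧
        Module.finrank (Localization.AtPrime q)
            (LocalizedModule q.primeCompl (RingHom.ker φ).Cotangent) =
          minimalGenerators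
            (Ideal.map (algebraMap R (Localization.AtPrime (q.comap φ)))
              (RingHom.ker φ)))) ∧
    ((∀ (q : Ideal S) (_ : q.IsPrime),
        (Localization.localRingHom (q.comap φ) q φ rfl).IsCompleteIntersection) →
      Module.Projective S (RingHom.ker φ).Cotangent) := by
  letI inst : Module S (RingHom.ker φ).Cotangent :=
    Module.compHom _
      ((RingHom.quotientKerEquivOfSurjective (f := φ) hφ).symm : S ≃+* _).toRingHom
  have hγ : ∀ (r : R) (i : RingHom.ker φ),
      (RingHom.ker φ).toCotangent.toAddMonoidHom (r • i) =
        φ r • (RingHom.ker φ).toCotangent.toAddMonoidHom i := by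
    intro r i
    refine Eq.trans ?_ (LCIaux.cot_smul φ hφ r _).symm
    exact (RingHom.ker φ).toCotangent.map_smul r i
  have hsurj : Function.Surjective (RingHom.ker φ).toCotangent.toAddMonoidHom :=
    (RingHom.ker φ).toCotangent_surjective
  have key := fun (q : Ideal S) (hq : q.IsPrime) =>
    LCIaux.main_local φ hφ hfd (RingHom.ker φ).toCotangent.toAddMonoidHom hγ hsurj
      (fun i => (RingHom.ker φ).toCotangent_eq_zero i) q
  refine ⟨forall₂_congr key, fun h => ?_⟩
  have hfin : Module.Finite S (RingHom.ker φ).Cotangent := by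
    have : IsNoetherian R (RingHom.ker φ).Cotangent :=
      isNoetherian_of_surjective (f := (RingHom.ker φ).toCotangent)
        (LinearMap.range_eq_top.2 (RingHom.ker φ).toCotangent_surjective)
    obtain ⟨s, hs⟩ := (IsNoetherian.noetherian (⊤ : Submodule R (RingHom.ker φ).Cotangent))
    refine ⟨⟨s, ?_⟩⟩
    rw [eq_top_iff]
    rintro c -
    have hc : c ∈ Submodule.span R (s : Set (RingHom.ker φ).Cotangent) := by rw [hs]; trivial
    induction hc using Submodule.span_induction with
    | mem x hx => exact Submodule.subset_span hx
    | zero => exact zero_mem _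
    | add x y _ _ hx hy => exact add_mem hx hy
    | smul r x _ hx =>
      rw [← LCIaux.cot_smul φ hφ r x]
      exact Submodule.smul_mem _ _ hx
  have hfp : Module.FinitePresentation S (RingHom.ker φ).Cotangent :=
    Module.finitePresentation_of_finite _ _
  refine Module.projective_of_localization_maximal fun m hm => ?_
  have := ((key m hm.isPrime).1 (h m hm.isPrime)).1
  exact Module.Projective.of_free
end

section
/- Let A be a differential graded algebra concentrated in non-negative degrees and let M be a dg A-module with H_i(M) = 0 for all |i| sufficiently large (bounded homology). Then M lies in the localizing subcategory of the derived category D(A) generated by H_0(A), where H_0(A) is viewed as a dg A-module via the augmentation A → H_0(A). -/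
/-!
STATEMENT 11: Let `A` be a dg algebra concentrated in non-negative degrees and
`M` a dg `A`-module with bounded homology.  Then `M` lies in the localizing
subcategory of `D(A)` generated by `H₀(A)` (viewed as a dg `A`-module via the
augmentation).

A dg algebra is encoded as a ring with an internal `ℤ`-grading and a degree
`-1` differential; dg modules likewise.  Localizing subcategories of `D(A)` are
encoded by predicates on dg modules closed under quasi-isomorphism, suspension,
extensions along short exact sequences, homotopy retracts and arbitrary
coproducts.  A model of `H₀(A)` is any dg module concentrated in degree `0`
with zero differential receiving a dg map from `A` which is surjective with
kernel (in degree `0`) the boundaries.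
-/

open DirectSum

/-- A dg algebra structure on a ring `A`. -/
structure IsDGAlgebra (A : Type) [Ring A] (𝒜 : ℤ → AddSubgroup A)
    (dA : A →+ A) : Prop where
  internal : DirectSum.IsInternal 𝒜
  one_mem : (1 : A) ∈ 𝒜 0
  mul_mem : ∀ {i j : ℤ} {a b : A}, a ∈ 𝒜 i → b ∈ 𝒜 j → a * b ∈ 𝒜 (i + j)
  d_mem : ∀ {i : ℤ} {a : A}, a ∈ 𝒜 i → dA a ∈ 𝒜 (i - 1)
  d_sq : ∀ a, dA (dA a) = 0
  leibniz : ∀ {i : ℤ} (a b : A), a ∈ 𝒜 i →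
    dA (a * b) = dA a * b + (((-1 : ℤˣ) ^ i : ℤˣ) : ℤ) • (a * dA b)

/-- A dg module over the dg algebra `(A, 𝒜, dA)`. -/
structure DGMod (A : Type) [Ring A] (𝒜 : ℤ → AddSubgroup A) (dA : A →+ A) where
  M : Type
  [addCommGroup : AddCommGroup M]
  [module : Module A M]
  ℳ : ℤ → AddSubgroup M
  d : M →+ M
  internal : DirectSum.IsInternal ℳ
  smul_mem : ∀ {i j : ℤ} {a : A} {m : M}, a ∈ 𝒜 i → m ∈ ℳ j → a • m ∈ ℳ (i + j)
  d_mem : ∀ {i : ℤ} {m : M}, m ∈ ℳ i → d m ∈ ℳ (i - 1)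
  d_sq : ∀ m, d (d m) = 0
  leibniz : ∀ {i : ℤ} (a : A) (m : M), a ∈ 𝒜 i →
    d (a • m) = dA a • m + (((-1 : ℤˣ) ^ i : ℤˣ) : ℤ) • (a • d m)

attribute [instance] DGMod.addCommGroup DGMod.module

variable {A : Type} [Ring A] {𝒜 : ℤ → AddSubgroup A} {dA : A →+ A}

/-- A morphism of dg modules. -/
structure DGHom (M N : DGMod A 𝒜 dA) where
  toFun : M.M →ₗ[A] N.M
  mem : ∀ {i : ℤ} {m : M.M}, m ∈ M.ℳ i → toFun m ∈ N.ℳ i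
  comm : ∀ m, toFun (M.d m) = N.d (toFun m)

/-- Vanishing of the `i`-th homology of a dg module. -/
def HVanish (M : DGMod A 𝒜 dA) (i : ℤ) : Prop :=
  M.ℳ i ⊓ M.d.ker ≤ AddSubgroup.map M.d (M.ℳ (i + 1))

/-- Quasi-isomorphisms of dg modules, expressed elementwise. -/
def IsQuasiIso {M N : DGMod A 𝒜 dA} (f : DGHom M N) : Prop :=
  (∀ (i : ℤ) (z : N.M), z ∈ N.ℳ i → N.d z = 0 →
    ∃ z' w, z' ∈ M.ℳ i ∧ M.d z' = 0 ∧ w ∈ N.ℳ (i + 1) ∧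
      f.toFun z' = z + N.d w) ∧
  (∀ (i : ℤ) (z : M.M), z ∈ M.ℳ i → M.d z = 0 →
    (∃ w, w ∈ N.ℳ (i + 1) ∧ f.toFun z = N.d w) →
    ∃ v, v ∈ M.ℳ (i + 1) ∧ z = M.d v)

/-- `N` is a suspension (shift) of `M`. -/
def IsSuspension (M N : DGMod A 𝒜 dA) : Prop :=
  ∃ e : M.M ≃+ N.M,
    (∀ i, AddSubgroup.map e.toAddMonoidHom (M.ℳ i) = N.ℳ (i + 1)) ∧
    (∀ m, e (M.d m) = - N.d (e m)) ∧
    (∀ {i : ℤ} (a : A) (m : M.M), a ∈ 𝒜 i →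
      e (a • m) = (((-1 : ℤˣ) ^ i : ℤˣ) : ℤ) • (a • e m))

/-- A short exact sequence of dg modules. -/
def IsShortExactSeq {M₁ M₂ M₃ : DGMod A 𝒜 dA}
    (f : DGHom M₁ M₂) (g : DGHom M₂ M₃) : Prop :=
  Function.Injective f.toFun ∧ Function.Surjective g.toFun ∧
    ∀ x, g.toFun x = 0 ↔ ∃ y, f.toFun y = x

/-- `C` is a coproduct (direct sum) of the family `F`. -/
def IsCoproductOf {ι : Type} (F : ι → DGMod A 𝒜 dA) (C : DGMod A 𝒜 dA) : Prop :=
  ∃ φ : ∀ i, DGHom (F i) C,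
    (∀ i, Function.Injective (φ i).toFun) ∧
    (⨆ i, LinearMap.range (φ i).toFun) = ⊤ ∧
    iSupIndep fun i => LinearMap.range (φ i).toFun

/-- `N` is a homotopy retract of `X`. -/
def IsHtpyRetract (N X : DGMod A 𝒜 dA) : Prop :=
  ∃ (ii : DGHom N X) (r : DGHom X N) (h : N.M →+ N.M),
    (∀ {j : ℤ} {m : N.M}, m ∈ N.ℳ j → h m ∈ N.ℳ (j + 1)) ∧
    ∀ m, r.toFun (ii.toFun m) - m = N.d (h m) + h (N.d m)

/-- Membership predicate of a thick subcategory of `D(A)`. -/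
structure IsThickClass (P : DGMod A 𝒜 dA → Prop) : Prop where
  qis : ∀ {M N} (f : DGHom M N), IsQuasiIso f → (P M ↔ P N)
  susp : ∀ {M N}, IsSuspension M N → (P M ↔ P N)
  ext₁ : ∀ {M₁ M₂ M₃} (f : DGHom M₁ M₂) (g : DGHom M₂ M₃),
    IsShortExactSeq f g → P M₂ → P M₃ → P M₁
  ext₂ : ∀ {M₁ M₂ M₃} (f : DGHom M₁ M₂) (g : DGHom M₂ M₃),
    IsShortExactSeq f g → P M₁ → P M₃ → P M₂
  ext₃ : ∀ {M₁ M₂ M₃} (f : DGHom M₁ M₂) (g : DGHom M₂ M₃),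
    IsShortExactSeq f g → P M₁ → P M₂ → P M₃
  retract : ∀ {N X}, IsHtpyRetract N X → P X → P N

/-- Membership predicate of a localizing subcategory of `D(A)`. -/
structure IsLocalizingClass (P : DGMod A 𝒜 dA → Prop) extends
    IsThickClass P : Prop where
  coprod : ∀ {ι : Type} (F : ι → DGMod A 𝒜 dA) (C : DGMod A 𝒜 dA),
    IsCoproductOf F C → (∀ i, P (F i)) → P C

/-- `Z` builds `M` in `D(A)`. -/
def Builds (Z M : DGMod A 𝒜 dA) : Prop :=
  ∀ P : DGMod A 𝒜 dA → Prop, IsLocalizingClass P → P Z → P M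

/-- `Z` finitely builds `M` in `D(A)`. -/
def FinBuilds (Z M : DGMod A 𝒜 dA) : Prop :=
  ∀ P : DGMod A 𝒜 dA → Prop, IsThickClass P → P Z → P M

/-- `A` as a dg module over itself. -/
def aMod (hA : IsDGAlgebra A 𝒜 dA) : DGMod A 𝒜 dA where
  M := A
  ℳ := 𝒜
  d := dA
  internal := hA.internal
  smul_mem := fun ha hm => by simpa [smul_eq_mul] using hA.mul_mem ha hm
  d_mem := hA.d_mem
  d_sq := hA.d_sq
  leibniz := fun a m ha => by simpa [smul_eq_mul] using hA.leibniz a m ha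

/-- `Z` is a model of `H₀(A)` viewed as a dg `A`-module via the augmentation:
`Z` is concentrated in degree `0` with zero differential, and receives a dg map
from `A` which is surjective with kernel the boundaries in degree `0`. -/
def IsHZero (hA : IsDGAlgebra A 𝒜 dA) (Z : DGMod A 𝒜 dA) : Prop :=
  (∀ i : ℤ, i ≠ 0 → Z.ℳ i = ⊥) ∧ Z.d = 0 ∧
  ∃ π : DGHom (aMod hA) Z, Function.Surjective π.toFun ∧
    ∀ x ∈ 𝒜 (0 : ℤ), (π.toFun x = 0 ↔ ∃ y ∈ 𝒜 (1 : ℤ), dA y = x)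


section Aux

/-! ### Internal gradings -/

theorem aux_internal_of_proj {M : Type} [AddCommGroup M] (G : ℤ → AddSubgroup M)
    (p : ℤ → M →+ M) (h1 : ∀ i m, m ∈ G i → p i m = m)
    (h2 : ∀ i j m, m ∈ G i → j ≠ i → p j m = 0)
    (h3 : ∀ m, m ∈ ⨆ i, G i) : DirectSum.IsInternal G := by
  have key : ∀ (x : ⨁ i, G i) (i : ℤ),
      p i (DirectSum.coeAddMonoidHom G x) = (x i : M) := by
    intro x i
    induction x using DirectSum.induction_on with
    | zero => simp
    | of j y =>
      rw [DirectSum.coeAddMonoidHom_of]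
      by_cases h : i = j
      · subst h
        rw [h1 _ _ y.2, DirectSum.of_eq_same]
      · rw [h2 j i _ y.2 h, DirectSum.of_eq_of_ne _ _ _ h]
        rfl
    | add x y hx hy => rw [map_add, map_add, hx, hy]; rfl
  constructor
  · rw [injective_iff_map_eq_zero]
    intro x hx
    refine DFinsupp.ext fun i => Subtype.ext ?_
    rw [← key x i, hx]
    simp
  · intro m
    have h := h3 m
    induction h using AddSubgroup.iSup_induction' with
    | hp i x hx => exact ⟨DirectSum.of (fun i => G i) i ⟨x, hx⟩, DirectSum.coeAddMonoidHom_of _ _ _⟩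
    | h1 => exact ⟨0, map_zero _⟩
    | hadd x y _ _ hx hy =>
      obtain ⟨a, rfl⟩ := hx
      obtain ⟨b, rfl⟩ := hy
      exact ⟨a + b, map_add _ _ _⟩

/-- The projection to the degree `i` component. -/
noncomputable def DGMod.proj (M : DGMod A 𝒜 dA) (i : ℤ) : M.M →+ M.M :=
  (M.ℳ i).subtype.comp ((DFinsupp.evalAddMonoidHom i).comp
    (AddEquiv.ofBijective (DirectSum.coeAddMonoidHom M.ℳ) M.internal).symm.toAddMonoidHom)

theorem DGMod.proj_mem (M : DGMod A 𝒜 dA) (i : ℤ) (m : M.M) : M.proj i m ∈ M.ℳ i :=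
  SetLike.coe_mem _

theorem DGMod.proj_coe (M : DGMod A 𝒜 dA) (i : ℤ) (x : ⨁ i, M.ℳ i) :
    M.proj i (DirectSum.coeAddMonoidHom M.ℳ x) = (x i : M.M) := by
  have : (AddEquiv.ofBijective (DirectSum.coeAddMonoidHom M.ℳ) M.internal).symm
      (DirectSum.coeAddMonoidHom M.ℳ x) = x :=
    (AddEquiv.ofBijective (DirectSum.coeAddMonoidHom M.ℳ) M.internal).symm_apply_apply x
  simp only [DGMod.proj, AddMonoidHom.comp_apply]
  erw [this]
  rfl

theorem DGMod.proj_same (M : DGMod A 𝒜 dA) {i : ℤ} {m : M.M} (h : m ∈ M.ℳ i) :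
    M.proj i m = m := by
  have := M.proj_coe i (DirectSum.of (fun i => M.ℳ i) i ⟨m, h⟩)
  rwa [DirectSum.coeAddMonoidHom_of, DirectSum.of_eq_same] at this

theorem DGMod.proj_ne (M : DGMod A 𝒜 dA) {i j : ℤ} {m : M.M} (h : m ∈ M.ℳ i) (hj : j ≠ i) :
    M.proj j m = 0 := by
  have := M.proj_coe j (DirectSum.of (fun i => M.ℳ i) i ⟨m, h⟩)
  rwa [DirectSum.coeAddMonoidHom_of, DirectSum.of_eq_of_ne _ _ _ hj] at this

theorem DGMod.ind (M : DGMod A 𝒜 dA) {p : M.M → Prop} (h0 : p 0)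
    (h : ∀ i m, m ∈ M.ℳ i → p m) (ha : ∀ x y, p x → p y → p (x + y)) (m : M.M) : p m := by
  obtain ⟨x, rfl⟩ := M.internal.2 m
  induction x using DirectSum.induction_on with
  | zero => simpa using h0
  | of j y => rw [DirectSum.coeAddMonoidHom_of]; exact h j _ y.2
  | add x y hx hy => rw [map_add]; exact ha _ _ hx hy

theorem DGMod.sum_proj (M : DGMod A 𝒜 dA) (m : M.M) :
    ∃ s : Finset ℤ, ∀ t, s ⊆ t → ∑ i ∈ t, M.proj i m = m := by
  classical
  induction m using M.ind with
  | h0 => exact ⟨∅, by simp⟩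
  | h i m hm =>
    refine ⟨{i}, fun t ht => ?_⟩
    rw [Finset.sum_eq_single i, M.proj_same hm]
    · intro j _ hj
      exact M.proj_ne hm hj
    · intro h
      exact absurd (ht (Finset.mem_singleton_self i)) h
  | ha x y hx hy =>
    obtain ⟨s, hs⟩ := hx
    obtain ⟨t, ht⟩ := hy
    refine ⟨s ∪ t, fun u hu => ?_⟩
    simp only [map_add, Finset.sum_add_distrib]
    rw [hs u (Finset.union_subset_left hu), ht u (Finset.union_subset_right hu)]

theorem DGMod.proj_proj (M : DGMod A 𝒜 dA) (i j : ℤ) (m : M.M) :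
    M.proj i (M.proj j m) = if i = j then M.proj j m else 0 := by
  split_ifs with h
  · subst h; exact M.proj_same (M.proj_mem _ _)
  · exact M.proj_ne (M.proj_mem _ _) h

theorem DGMod.proj_smul (M : DGMod A 𝒜 dA) {j : ℤ} {a : A} (ha : a ∈ 𝒜 j) (i : ℤ) (m : M.M) :
    M.proj i (a • m) = a • M.proj (i - j) m := by
  induction m using M.ind with
  | h0 => simp
  | h l m hm =>
    by_cases h : i - j = l
    · rw [h, M.proj_same hm, M.proj_same]
      have := M.smul_mem ha hm
      rwa [show j + l = i by omega] at this
    · rw [M.proj_ne hm h, smul_zero, M.proj_ne (M.smul_mem ha hm) (by omega)]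
  | ha x y hx hy => simp only [smul_add, map_add, hx, hy]

theorem DGMod.proj_d (M : DGMod A 𝒜 dA) (i : ℤ) (m : M.M) :
    M.proj i (M.d m) = M.d (M.proj (i + 1) m) := by
  induction m using M.ind with
  | h0 => simp
  | h l m hm =>
    by_cases h : i + 1 = l
    · rw [h, M.proj_same hm, M.proj_same]
      have := M.d_mem hm
      rwa [show l - 1 = i by omega] at this
    · rw [M.proj_ne hm h, map_zero, M.proj_ne (M.d_mem hm) (by omega)]
  | ha x y hx hy => simp only [map_add, hx, hy]

theorem DGMod.eq_zero_of_mem (M : DGMod A 𝒜 dA) {i j : ℤ} {m : M.M} (h : m ∈ M.ℳ i)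
    (hj : m ∈ M.ℳ j) (hij : i ≠ j) : m = 0 := by
  rw [← M.proj_same h, M.proj_ne hj hij]

/-! ### Sub dg modules -/

/-- The dg submodule on a homogeneous `d`-stable submodule. -/
noncomputable def DGMod.sub (M : DGMod A 𝒜 dA) (N : Submodule A M.M)
    (hp : ∀ i m, m ∈ N → M.proj i m ∈ N) (hd : ∀ m, m ∈ N → M.d m ∈ N) : DGMod A 𝒜 dA where
  M := N
  ℳ := fun i => (M.ℳ i).comap (N.subtype : N →+ M.M)
  d := AddMonoidHom.mk' (fun m => ⟨M.d m, hd _ m.2⟩) fun a b => Subtype.ext (by simp)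
  internal := by
    refine aux_internal_of_proj _
      (fun i => AddMonoidHom.mk' (fun m => ⟨M.proj i m, hp i _ m.2⟩)
        fun a b => Subtype.ext (by simp)) ?_ ?_ ?_
    · intro i m hm
      exact Subtype.ext (M.proj_same hm)
    · intro i j m hm hj
      exact Subtype.ext (M.proj_ne hm hj)
    · intro m
      obtain ⟨s, hs⟩ := M.sum_proj m
      have : m = ∑ i ∈ s, (⟨M.proj i m, hp i _ m.2⟩ : N) := by
        apply Subtype.ext
        rw [AddSubmonoidClass.coe_finsetSum]
        exact (hs s (Finset.Subset.refl s)).symm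
      rw [this]
      refine AddSubgroup.sum_mem _ fun i _ => AddSubgroup.mem_iSup_of_mem i ?_
      exact M.proj_mem i m
  smul_mem := fun ha hm => M.smul_mem ha hm
  d_mem := fun hm => M.d_mem hm
  d_sq := fun m => Subtype.ext (M.d_sq m)
  leibniz := fun a m ha => Subtype.ext (M.leibniz a m ha)

/-- Inclusion of a dg submodule into the ambient dg module. -/
noncomputable def DGMod.subIncl (M : DGMod A 𝒜 dA) (N : Submodule A M.M)
    (hp : ∀ i m, m ∈ N → M.proj i m ∈ N) (hd : ∀ m, m ∈ N → M.d m ∈ N) :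
    DGHom (M.sub N hp hd) M where
  toFun := N.subtype
  mem := fun h => h
  comm := fun _ => rfl

/-- Inclusion between dg submodules. -/
noncomputable def DGMod.subMap (M : DGMod A 𝒜 dA) (N N' : Submodule A M.M)
    (hp : ∀ i m, m ∈ N → M.proj i m ∈ N) (hd : ∀ m, m ∈ N → M.d m ∈ N)
    (hp' : ∀ i m, m ∈ N' → M.proj i m ∈ N') (hd' : ∀ m, m ∈ N' → M.d m ∈ N') (h : N ≤ N') :
    DGHom (M.sub N hp hd) (M.sub N' hp' hd') where
  toFun := Submodule.inclusion h
  mem := fun h => h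
  comm := fun _ => rfl

/-! ### Modules over `H₀(A)` and modules concentrated in one degree -/

/-- `A`-modules on which the `A`-action factors through `H₀(A)`. -/
structure IsHMod (𝒜 : ℤ → AddSubgroup A) (dA : A →+ A) (V : Type) [AddCommGroup V]
    [Module A V] : Prop where
  zero : ∀ i : ℤ, i ≠ 0 → ∀ a ∈ 𝒜 i, ∀ v : V, a • v = 0
  dzero : ∀ (i : ℤ), ∀ a ∈ 𝒜 i, ∀ v : V, dA a • v = 0

theorem IsHMod.leib {V : Type} [AddCommGroup V] [Module A V] (hV : IsHMod 𝒜 dA V)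
    (d : V →ₗ[A] V) {i : ℤ} (a : A) (m : V) (ha : a ∈ 𝒜 i) :
    d (a • m) = dA a • m + (((-1 : ℤˣ) ^ i : ℤˣ) : ℤ) • (a • d m) := by
  rw [hV.dzero i a ha]
  by_cases h : i = 0
  · subst h; simp
  · rw [hV.zero i h a ha, hV.zero i h a ha]; simp

/-- The dg module which is `V` in degree `k`. -/
abbrev conc (V : Type) [AddCommGroup V] [Module A V] (hV : IsHMod 𝒜 dA V) (k : ℤ) :
    DGMod A 𝒜 dA where
  M := V
  ℳ := fun i => if i = k then ⊤ else ⊥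
  d := 0
  internal := by
    refine aux_internal_of_proj _ (fun i => if i = k then AddMonoidHom.id V else 0) ?_ ?_ ?_
    · intro i m hm
      split_ifs at hm ⊢ with h
      · rfl
      · simpa using hm.symm
    · intro i j m hm hj
      split_ifs at hm ⊢ with h h'
      · omega
      · simpa using hm
      · rfl
      · rfl
    · intro m
      exact AddSubgroup.mem_iSup_of_mem k (by simp)
  smul_mem := by
    intro i j a m ha hm
    by_cases h : i = 0
    · subst h
      rw [zero_add]
      split_ifs at hm ⊢ with h
      · trivial
      · rw [(AddSubgroup.mem_bot).1 hm, smul_zero]; exact AddSubgroup.zero_mem _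
    · rw [hV.zero i h a ha]; exact AddSubgroup.zero_mem _
  d_mem := fun _ => AddSubgroup.zero_mem _
  d_sq := fun _ => rfl
  leibniz := fun a m ha => hV.leib (0 : V →ₗ[A] V) a m ha

theorem conc_susp (V : Type) [AddCommGroup V] [Module A V] (hV : IsHMod 𝒜 dA V) (k : ℤ) :
    IsSuspension (conc V hV k) (conc V hV (k + 1)) := by
  refine ⟨AddEquiv.refl V, ?_, ?_, ?_⟩
  · intro i
    ext x
    change (x ∈ AddSubgroup.map (AddMonoidHom.id V) (if i = k then ⊤ else ⊥ : AddSubgroup V)) ↔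
      x ∈ (if i + 1 = k + 1 then ⊤ else ⊥ : AddSubgroup V)
    rw [AddSubgroup.map_id]
    simp
  · intro m
    change (0 : V) = - 0
    simp
  · intro i a m ha
    revert m
    change ∀ m : V, a • m = (((-1 : ℤˣ) ^ i : ℤˣ) : ℤ) • (a • m)
    intro m
    by_cases h : i = 0
    · subst h; simp
    · have := hV.zero i h a ha m
      rw [this, smul_zero]

theorem conc_mem {V : Type} [AddCommGroup V] [Module A V] {hV : IsHMod 𝒜 dA V} {k i : ℤ}
    {m : V} : (m ∈ (conc V hV k).ℳ i) ↔ (i = k ∨ m = 0) := by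
  change m ∈ (if i = k then ⊤ else ⊥ : AddSubgroup V) ↔ _
  split_ifs with h <;> simp [h]

theorem conc_shift {P : DGMod A 𝒜 dA → Prop} (hP : IsLocalizingClass P)
    (V : Type) [AddCommGroup V] [Module A V] (hV : IsHMod 𝒜 dA V) (h : P (conc V hV 0)) (k : ℤ) :
    P (conc V hV k) := by
  induction k using Int.induction_on with
  | zero => exact h
  | succ i ih => exact (hP.susp (conc_susp V hV _)).1 ih
  | pred i ih =>
    refine (hP.susp (conc_susp V hV _)).2 ?_
    rwa [sub_add_cancel]

/-! ### Coproducts -/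

theorem coprod_of_proj {ι : Type} (F : ι → DGMod A 𝒜 dA) (C : DGMod A 𝒜 dA)
    (φ : ∀ i, DGHom (F i) C) {E : Type} [AddCommGroup E] [Module A E]
    (ρ : ι → C.M →ₗ[A] E)
    (hinj : ∀ i, ∀ x, ρ i ((φ i).toFun x) = 0 → x = 0)
    (hne : ∀ i j, j ≠ i → ∀ x, ρ i ((φ j).toFun x) = 0)
    (hspan : ∀ c : C.M, c ∈ ⨆ i, LinearMap.range (φ i).toFun) : IsCoproductOf F C := by
  refine ⟨φ, ?_, ?_, ?_⟩
  · intro i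
    rw [injective_iff_map_eq_zero]
    intro x hx
    exact hinj i x (by rw [hx, map_zero])
  · exact eq_top_iff.2 fun c _ => hspan c
  · intro i
    rw [Submodule.disjoint_def]
    rintro _ ⟨x, rfl⟩ hx
    have : (⨆ j, ⨆ (_ : j ≠ i), LinearMap.range (φ j).toFun) ≤ LinearMap.ker (ρ i) := by
      refine iSup_le fun j => iSup_le fun hj => ?_
      rintro _ ⟨y, rfl⟩
      exact hne i j hj y
    rw [hinj i x (this hx), map_zero]

theorem IsHMod.punit : IsHMod 𝒜 dA PUnit := ⟨fun _ _ _ _ _ => rfl, fun _ _ _ _ => rfl⟩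

theorem P_acyclic {P : DGMod A 𝒜 dA → Prop} (hP : IsLocalizingClass P) (M : DGMod A 𝒜 dA)
    (hM : ∀ i m, m ∈ M.ℳ i → M.d m = 0 → ∃ v, v ∈ M.ℳ (i + 1) ∧ m = M.d v) : P M := by
  have h0 : P (conc PUnit IsHMod.punit 0) := by
    refine hP.coprod (ι := Empty) (fun i => i.elim) _ ⟨fun i => i.elim, fun i => i.elim, ?_, ?_⟩
      (fun i => i.elim)
    · refine eq_top_iff.2 fun c _ => ?_
      have : c = 0 := rfl
      rw [this]; exact Submodule.zero_mem _
    · intro i; exact i.elim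
  let f : DGHom M (conc PUnit IsHMod.punit 0) :=
    { toFun := 0, mem := fun _ => AddSubgroup.zero_mem _, comm := fun _ => rfl }
  refine (hP.qis f ⟨?_, ?_⟩).2 h0
  · intro i z _ _
    exact ⟨0, 0, AddSubgroup.zero_mem _, map_zero _, AddSubgroup.zero_mem _, rfl⟩
  · intro i z hz hdz _
    exact hM i z hz hdz

end Aux

section Telescope

/-- Finitely supported sequences in a dg module. -/
noncomputable def DGMod.seq (T : DGMod A 𝒜 dA) : DGMod A 𝒜 dA where
  M := ℕ →₀ T.M
  ℳ := fun i =>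
    { carrier := {f | ∀ n, f n ∈ T.ℳ i}
      zero_mem' := fun n => AddSubgroup.zero_mem _
      add_mem' := fun hf hg n => AddSubgroup.add_mem _ (hf n) (hg n)
      neg_mem' := fun hf n => AddSubgroup.neg_mem _ (hf n) }
  d := Finsupp.mapRange.addMonoidHom T.d
  internal := by
    refine aux_internal_of_proj _ (fun i => Finsupp.mapRange.addMonoidHom (T.proj i)) ?_ ?_ ?_
    · intro i f hf
      ext n
      simpa using T.proj_same (hf n)
    · intro i j f hf hj
      ext n
      simpa using T.proj_ne (hf n) hj
    · intro f
      induction f using Finsupp.induction_linear with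
      | zero => exact AddSubgroup.zero_mem _
      | add f g hf hg => exact AddSubgroup.add_mem _ hf hg
      | single n m =>
        induction m using T.ind with
        | h0 => simp
        | h i m hm =>
          refine AddSubgroup.mem_iSup_of_mem i fun k => ?_
          rw [Finsupp.single_apply]
          split_ifs
          · exact hm
          · exact AddSubgroup.zero_mem _
        | ha x y hx hy =>
          rw [Finsupp.single_add]
          exact AddSubgroup.add_mem _ hx hy
  smul_mem := fun ha hm n => T.smul_mem ha (hm n)
  d_mem := fun hm n => by simpa using T.d_mem (hm n)
  d_sq := fun f => by ext n; simp [T.d_sq]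
  leibniz := fun a f ha => by
    ext n
    simpa using T.leibniz a (f n) ha

theorem DGMod.seq_proj (T : DGMod A 𝒜 dA) (i : ℤ) (f : ℕ →₀ T.M) (n : ℕ) :
    (show ℕ →₀ T.M from T.seq.proj i f) n = T.proj i (f n) := by
  revert f
  refine T.seq.ind (p := fun f => (show ℕ →₀ T.M from T.seq.proj i f) n
    = T.proj i ((show ℕ →₀ T.M from f) n)) ?_ ?_ ?_
  · have : T.seq.proj i 0 = 0 := map_zero _
    simp only [this]
    exact (map_zero (T.proj i)).symm
  · intro j f hf
    by_cases h : i = j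
    · subst h
      rw [T.seq.proj_same hf, T.proj_same (hf n)]
    · rw [T.seq.proj_ne hf h, T.proj_ne (hf n) h]
      rfl
  · intro f g hf hg
    have : T.seq.proj i (f + g) = T.seq.proj i f + T.seq.proj i g := map_add _ _ _
    simp only [this]
    refine Eq.trans ?_ (map_add (T.proj i) _ _).symm
    rw [← hf, ← hg]
    rfl

theorem P_telescope {P : DGMod A 𝒜 dA → Prop} (hP : IsLocalizingClass P) (T : DGMod A 𝒜 dA)
    (S : ℕ → Submodule A T.M) (hp : ∀ n, ∀ i m, m ∈ S n → T.proj i m ∈ S n)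
    (hd : ∀ n, ∀ m, m ∈ S n → T.d m ∈ S n) (hS : ∀ n, S n ≤ S (n + 1))
    (htop : ∀ m, ∃ n, m ∈ S n) (hPS : ∀ n, P (T.sub (S n) (hp n) (hd n))) : P T := by
  have hmono : Monotone S := monotone_nat_of_le_succ hS
  let N : Submodule A (ℕ →₀ T.M) :=
    { carrier := {f | ∀ n, f n ∈ S n}
      zero_mem' := fun n => Submodule.zero_mem _
      add_mem' := fun hf hg n => Submodule.add_mem _ (hf n) (hg n)
      smul_mem' := fun a f hf n => Submodule.smul_mem _ a (hf n) }
  have hNp : ∀ i (f : ℕ →₀ T.M), f ∈ N → (show ℕ →₀ T.M from T.seq.proj i f) ∈ N := by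
    intro i f hf n
    rw [T.seq_proj]
    exact hp n i _ (hf n)
  have hNd : ∀ (f : ℕ →₀ T.M), f ∈ N → (show ℕ →₀ T.M from T.seq.d f) ∈ N := by
    intro f hf n
    exact hd n _ (hf n)
  let C : DGMod A 𝒜 dA := T.seq.sub N hNp hNd
  let u : C.M →ₗ[A] (ℕ →₀ T.M) := N.subtype
  have hu : ∀ f (n : ℕ), u f n ∈ S n := fun f n => f.2 n
  have hC : P C := by
    let φ : ∀ n, DGHom (T.sub (S n) (hp n) (hd n)) C := fun n =>
      { toFun := LinearMap.codRestrict N ((Finsupp.lsingle n).comp (S n).subtype) (by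
          intro x k
          change Finsupp.single n ((show S n from x) : T.M) k ∈ S k
          rw [Finsupp.single_apply]
          split_ifs with h
          · subst h; exact (show S n from x).2
          · exact Submodule.zero_mem _)
        mem := by
          intro i m hm k
          change Finsupp.single n (m.1 : T.M) k ∈ T.ℳ i
          rw [Finsupp.single_apply]
          split_ifs with h
          · exact hm
          · exact AddSubgroup.zero_mem _
        comm := by
          intro m
          apply Subtype.ext
          change Finsupp.single n (T.d m.1) = Finsupp.mapRange T.d (map_zero _) (Finsupp.single n m.1)
          rw [Finsupp.mapRange_single] }
    refine hP.coprod (fun n => T.sub (S n) (hp n) (hd n)) C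
      (coprod_of_proj _ _ φ (E := T.M) (fun n => (Finsupp.lapply n).comp N.subtype) ?_ ?_ ?_) hPS
    · intro n x hx
      apply Subtype.ext
      have : Finsupp.single n x.1 n = 0 := hx
      rw [Finsupp.single_eq_same] at this
      exact this
    · intro i j hij x
      change Finsupp.single j x.1 i = 0
      rw [Finsupp.single_apply, if_neg hij]
    · intro c
      have : c = ∑ n ∈ (u c).support, (φ n).toFun ⟨(u c) n, hu c n⟩ := by
        have huinj : Function.Injective u := Subtype.val_injective
        apply huinj
        rw [map_sum]
        exact (Finsupp.sum_single (u c)).symm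
      rw [this]
      exact Submodule.sum_mem _ fun n _ => Submodule.mem_iSup_of_mem n ⟨_, rfl⟩
  -- the map `1 - shift`
  let sh : (ℕ →₀ T.M) →ₗ[A] (ℕ →₀ T.M) := Finsupp.lmapDomain T.M A Nat.succ
  have sh0 : ∀ f, sh f 0 = 0 := by
    intro f
    exact Finsupp.mapDomain_of_notMem_range _ _ (by simp)
  have shs : ∀ f n, sh f (n + 1) = f n := by
    intro f n
    exact Finsupp.mapDomain_apply Nat.succ_injective _ _
  let F : DGHom C C :=
    { toFun := LinearMap.restrict (LinearMap.id - sh) (p := N) (q := N) (by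
        intro f hf n
        change f n - sh f n ∈ S n
        refine Submodule.sub_mem _ (hf n) ?_
        cases n with
        | zero => rw [sh0]; exact Submodule.zero_mem _
        | succ n => rw [shs]; exact hS n (hf n))
      mem := by
        intro i f hf n
        change (u f) n - sh (u f) n ∈ T.ℳ i
        refine AddSubgroup.sub_mem _ (hf n) ?_
        cases n with
        | zero => rw [sh0]; exact AddSubgroup.zero_mem _
        | succ n => rw [shs]; exact hf n
      comm := by
        intro f
        apply Subtype.ext
        refine Finsupp.ext fun n => ?_
        change T.d ((u f) n) - sh (Finsupp.mapRange T.d (map_zero _) (u f)) n = T.d ((u f) n - sh (u f) n)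
        rw [map_sub]
        cases n with
        | zero => rw [sh0, sh0]; simp
        | succ n => rw [shs, shs]; rfl }
  let G : DGHom C T :=
    { toFun := (Finsupp.lsum ℕ (fun _ : ℕ => (LinearMap.id : T.M →ₗ[A] T.M))).comp N.subtype
      mem := by
        intro i f hf
        change (u f).sum (fun _ x => x) ∈ T.ℳ i
        exact AddSubgroup.sum_mem _ fun n _ => hf n
      comm := by
        intro f
        change (Finsupp.mapRange T.d (map_zero _) (u f)).sum (fun _ x => x) =
          T.d ((u f).sum (fun _ x => x))
        rw [Finsupp.sum_mapRange_index (by simp), Finsupp.sum, Finsupp.sum, map_sum] }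
  have Gval : ∀ f : C.M, ∀ k, (∀ n, k ≤ n → (u f) n = 0) →
      G.toFun f = ∑ n ∈ Finset.range k, (u f) n := by
    intro f k hk
    change (u f).sum (fun _ x => x) = _
    refine Finsupp.sum_of_support_subset _ ?_ _ (by simp)
    intro n hn
    rw [Finset.mem_range]
    by_contra h
    exact (Finsupp.mem_support_iff.1 hn) (hk n (not_lt.1 h))
  have bd : ∀ f : (ℕ →₀ T.M), ∃ k, ∀ n, k ≤ n → f n = 0 := by
    intro f
    refine ⟨f.support.sup id + 1, fun n hn => ?_⟩
    by_contra h
    have := Finset.le_sup (f := id) (Finsupp.mem_support_iff.2 h)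
    simp only [id] at this
    omega
  have Fval0 : ∀ f : C.M, u (F.toFun f) 0 = (u f) 0 := by
    intro f
    change (u f) 0 - sh (u f) 0 = _
    rw [sh0, sub_zero]
  have Fvals : ∀ f : C.M, ∀ n, u (F.toFun f) (n + 1) = (u f) (n + 1) - (u f) n := by
    intro f n
    change (u f) (n + 1) - sh (u f) (n + 1) = _
    rw [shs]
  have psum : ∀ f : C.M, ∀ k, ∑ n ∈ Finset.range (k + 1), u (F.toFun f) n = (u f) k := by
    intro f k
    induction k with
    | zero => rw [Finset.sum_range_one, Fval0]
    | succ k ih => rw [Finset.sum_range_succ, ih, Fvals]; abel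
  refine hP.ext₃ F G ⟨?_, ?_, ?_⟩ hC hC
  · rw [injective_iff_map_eq_zero]
    intro f hf
    apply Subtype.ext
    refine Finsupp.ext fun n => ?_
    change u f n = 0
    rw [← psum f n, hf]
    exact Finset.sum_const_zero
  · intro m
    obtain ⟨n, hn⟩ := htop m
    refine ⟨⟨Finsupp.single n m, ?_⟩, ?_⟩
    · intro k
      change Finsupp.single n m k ∈ S k
      rw [Finsupp.single_apply]
      split_ifs with h
      · subst h; exact hn
      · exact Submodule.zero_mem _
    · change (Finsupp.single n m).sum (fun _ x => x) = m
      simp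
  · intro f
    constructor
    · intro hf
      obtain ⟨k, hk⟩ := bd (u f)
      let q : ℕ → T.M := fun n => ∑ i ∈ Finset.range (n + 1), (u f) i
      have hq : ∀ n, q n ≠ 0 → n ∈ Finset.range k := by
        intro n hn
        rw [Finset.mem_range]
        by_contra h
        apply hn
        change ∑ i ∈ Finset.range (n + 1), (u f) i = 0
        rw [← Gval f (n + 1) (fun m hm => hk m (by omega)), hf]
      refine ⟨⟨Finsupp.onFinset (Finset.range k) q hq, ?_⟩, ?_⟩
      · intro n
        change q n ∈ S n
        refine Submodule.sum_mem _ fun i hi => ?_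
        exact hmono (Nat.lt_succ_iff.1 (Finset.mem_range.1 hi)) (hu f i)
      · apply Subtype.ext
        refine Finsupp.ext fun n => ?_
        change u (F.toFun _) n = u f n
        cases n with
        | zero =>
          refine (Fval0 _).trans ?_
          exact Finset.sum_range_one _
        | succ n =>
          refine (Fvals _ n).trans ?_
          change q (n + 1) - q n = _
          simp only [q]
          rw [Finset.sum_range_succ]
          abel
    · rintro ⟨g, rfl⟩
      obtain ⟨k, hk⟩ := bd (u g)
      rw [Gval (F.toFun g) (k + 1), psum, hk k le_rfl]
      intro n hn
      obtain ⟨m, rfl⟩ : ∃ m, n = m + 1 := ⟨n - 1, by omega⟩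
      rw [Fvals, hk _ (by omega), hk _ (by omega), sub_zero]

end Telescope

section Resolution

theorem IsHMod.finsupp {V ι : Type} [AddCommGroup V] [Module A V] (h : IsHMod 𝒜 dA V) :
    IsHMod 𝒜 dA (ι →₀ V) where
  zero := fun i hi a ha v => by ext n; simpa using h.zero i hi a ha (v n)
  dzero := fun i a ha v => by ext n; simpa using h.dzero i a ha (v n)

theorem IsHMod.submodule {V : Type} [AddCommGroup V] [Module A V] (h : IsHMod 𝒜 dA V)
    (N : Submodule A V) : IsHMod 𝒜 dA N where
  zero := fun i hi a ha v => Subtype.ext (h.zero i hi a ha v)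
  dzero := fun i a ha v => Subtype.ext (h.dzero i a ha v)

theorem IsHMod.directSum {V : ℕ → Type} [∀ n, AddCommGroup (V n)] [∀ n, Module A (V n)]
    (h : ∀ n, IsHMod 𝒜 dA (V n)) : IsHMod 𝒜 dA (Π₀ n, V n) where
  zero := fun i hi a ha v => by ext n; simpa using (h n).zero i hi a ha (v n)
  dzero := fun i a ha v => by ext n; simpa using (h n).dzero i a ha (v n)

theorem isHMod_of_conc (M : DGMod A 𝒜 dA) (k : ℤ) (hk : ∀ i, i ≠ k → M.ℳ i = ⊥) :
    IsHMod 𝒜 dA M.M := by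
  have hall : ∀ m : M.M, m ∈ M.ℳ k := by
    intro m
    induction m using M.ind with
    | h0 => exact AddSubgroup.zero_mem _
    | h i m hm =>
      by_cases h : i = k
      · rwa [← h]
      · rw [hk i h] at hm
        rw [(AddSubgroup.mem_bot).1 hm]; exact AddSubgroup.zero_mem _
    | ha x y hx hy => exact AddSubgroup.add_mem _ hx hy
  have hd : ∀ m : M.M, M.d m = 0 := by
    intro m
    have := M.d_mem (hall m)
    rw [hk _ (by omega)] at this
    exact (AddSubgroup.mem_bot).1 this
  refine ⟨?_, ?_⟩
  · intro i hi a ha v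
    have := M.smul_mem ha (hall v)
    rw [hk _ (by omega)] at this
    exact (AddSubgroup.mem_bot).1 this
  · intro i a ha v
    have := M.leibniz a v ha
    rw [hd, hd, smul_zero, smul_zero, add_zero] at this
    exact this.symm

theorem P_free {P : DGMod A 𝒜 dA → Prop} (hP : IsLocalizingClass P)
    {V : Type} [AddCommGroup V] [Module A V] (hV : IsHMod 𝒜 dA V) (k : ℤ)
    (h : P (conc V hV k)) (ι : Type) (hF : IsHMod 𝒜 dA (ι →₀ V)) : P (conc (ι →₀ V) hF k) := by
  let φ : ι → DGHom (conc V hV k) (conc (ι →₀ V) hF k) := fun i =>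
    { toFun := (Finsupp.lsingle i : V →ₗ[A] (ι →₀ V))
      mem := by
        intro j m hm
        rcases conc_mem.1 hm with h | h
        · exact conc_mem.2 (Or.inl h)
        · refine conc_mem.2 (Or.inr ?_)
          rw [h]
          exact map_zero (Finsupp.lsingle i : V →ₗ[A] (ι →₀ V))
      comm := fun m => map_zero (Finsupp.lsingle i : V →ₗ[A] (ι →₀ V)) }
  refine hP.coprod (fun _ => conc V hV k) _
    (coprod_of_proj _ _ φ (E := V) (fun i => (Finsupp.lapply i : (ι →₀ V) →ₗ[A] V)) ?_ ?_ ?_)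
    (fun _ => h)
  · intro i x hx
    have : Finsupp.single i (show V from x) i = 0 := hx
    rw [Finsupp.single_eq_same] at this
    exact this
  · intro i j hij x
    change Finsupp.single j (show V from x) i = 0
    classical
    rw [Finsupp.single_apply, if_neg hij]
  · intro c
    revert c
    change ∀ c : ι →₀ V, c ∈ (⨆ i, LinearMap.range (Finsupp.lsingle i : V →ₗ[A] (ι →₀ V)))
    intro c
    rw [Finsupp.iSup_lsingle_range]
    trivial

/-- bundled `H₀(A)`-modules -/
structure HModB (𝒜 : ℤ → AddSubgroup A) (dA : A →+ A) where
  V : Type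
  [grp : AddCommGroup V]
  [mod : Module A V]
  prop : IsHMod 𝒜 dA V

attribute [instance] HModB.grp HModB.mod

/-- the next syzygy -/
noncomputable def HModB.next (H : Type) [AddCommGroup H] [Module A H] (hH : IsHMod 𝒜 dA H)
    (ev : ∀ X : HModB 𝒜 dA, (X.V →₀ H) →ₗ[A] X.V) (X : HModB 𝒜 dA) : HModB 𝒜 dA where
  V := LinearMap.ker (ev X)
  prop := hH.finsupp.submodule _

/-- the sequence of syzygies -/
noncomputable def HModB.syz (H : Type) [AddCommGroup H] [Module A H] (hH : IsHMod 𝒜 dA H)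
    (ev : ∀ X : HModB 𝒜 dA, (X.V →₀ H) →ₗ[A] X.V) (X : HModB 𝒜 dA) : ℕ → HModB 𝒜 dA
  | 0 => X
  | n + 1 => HModB.next H hH ev (HModB.syz H hH ev X n)

/-- A nonnegatively graded complex of `H₀(A)`-modules as a dg module. -/
noncomputable def cplx (F : ℕ → Type) [∀ n, AddCommGroup (F n)] [∀ n, Module A (F n)]
    (hF : ∀ n, IsHMod 𝒜 dA (F n)) (δ : ∀ n, F (n + 1) →ₗ[A] F n)
    (hδ : ∀ n x, δ n (δ (n + 1) x) = 0) : DGMod A 𝒜 dA :=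
  let D : (Π₀ n, F n) →ₗ[A] (Π₀ n, F n) :=
    { toFun := fun x => DFinsupp.mapRange (fun n => δ n) (fun n => map_zero _)
        (DFinsupp.comapDomain Nat.succ Nat.succ_injective x)
      map_add' := fun x y => by ext n; simp
      map_smul' := fun a x => by ext n; simp }
  have hD : ∀ x n, D x n = δ n (x (n + 1)) := fun x n => by simp [D]
  { M := Π₀ n, F n
    ℳ := fun i =>
      { carrier := {x | ∀ n : ℕ, (n : ℤ) ≠ i → x n = 0}
        zero_mem' := fun n _ => rfl
        add_mem' := fun {x y} hx hy n hn => by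
          rw [DFinsupp.add_apply, hx n hn, hy n hn, add_zero]
        neg_mem' := fun {x} hx n hn => by rw [DFinsupp.neg_apply, hx n hn, neg_zero] }
    d := D.toAddMonoidHom
    internal := by
      classical
      refine aux_internal_of_proj _
        (fun i => DFinsupp.filterAddMonoidHom F (fun n : ℕ => (n : ℤ) = i)) ?_ ?_ ?_
      · intro i x hx
        ext n
        change DFinsupp.filter _ x n = x n
        rw [DFinsupp.filter_apply]
        split_ifs with h
        · rfl
        · exact (hx n h).symm
      · intro i j x hx hj
        ext n
        change DFinsupp.filter _ x n = 0
        rw [DFinsupp.filter_apply]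
        split_ifs with h
        · exact hx n (by omega)
        · rfl
      · intro x
        induction x using DFinsupp.induction with
        | h0 => exact AddSubgroup.zero_mem _
        | ha n b f _ _ hf =>
          refine AddSubgroup.add_mem _ (AddSubgroup.mem_iSup_of_mem (n : ℤ) ?_) hf
          intro m hm
          exact DFinsupp.single_eq_of_ne (by omega)
    smul_mem := by
      intro i j a x ha hx n hn
      by_cases h : i = 0
      · subst h
        rw [DFinsupp.smul_apply, hx n (by omega), smul_zero]
      · exact (hF n).zero i h a ha (x n)
    d_mem := by
      intro i x hx n hn
      change D x n = 0
      rw [hD, hx (n + 1) (by push_cast; omega), map_zero]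
    d_sq := by
      intro x
      refine DFinsupp.ext fun n => ?_
      change D (D x) n = 0
      rw [hD, hD, hδ]
    leibniz := fun a m ha => (IsHMod.directSum hF).leib D a m ha }

section
variable (F : ℕ → Type) [∀ n, AddCommGroup (F n)] [∀ n, Module A (F n)]
    (hF : ∀ n, IsHMod 𝒜 dA (F n)) (δ : ∀ n, F (n + 1) →ₗ[A] F n)
    (hδ : ∀ n x, δ n (δ (n + 1) x) = 0)

/-- components -/
def cplxEv (n : ℕ) : (cplx F hF δ hδ).M →ₗ[A] F n := DFinsupp.lapply (R := A) n

theorem cplx_d (x : (cplx F hF δ hδ).M) (n : ℕ) :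
    cplxEv F hF δ hδ n ((cplx F hF δ hδ).d x) = δ n (cplxEv F hF δ hδ (n + 1) x) := rfl

theorem cplx_ext (x y : (cplx F hF δ hδ).M)
    (h : ∀ n, cplxEv F hF δ hδ n x = cplxEv F hF δ hδ n y) : x = y :=
  DFinsupp.ext h

theorem cplx_mem (x : (cplx F hF δ hδ).M) (i : ℤ) :
    x ∈ (cplx F hF δ hδ).ℳ i ↔ ∀ n : ℕ, (n : ℤ) ≠ i → cplxEv F hF δ hδ n x = 0 := Iff.rfl

theorem cplx_single (n : ℕ) (b : F n) : ∃ x : (cplx F hF δ hδ).M,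
    cplxEv F hF δ hδ n x = b ∧ ∀ m, m ≠ n → cplxEv F hF δ hδ m x = 0 :=
  ⟨DFinsupp.single n b, DFinsupp.single_eq_same, fun _ hm => DFinsupp.single_eq_of_ne hm⟩

theorem cplx_bdd (x : (cplx F hF δ hδ).M) :
    ∃ n, ∀ m, n ≤ m → cplxEv F hF δ hδ m x = 0 := by
  classical
  revert x
  change ∀ x : Π₀ n, F n, ∃ n, ∀ m, n ≤ m → x m = 0
  intro x
  refine ⟨x.support.sup id + 1, fun m hm => ?_⟩
  by_contra h
  have := Finset.le_sup (f := id) (DFinsupp.mem_support_iff.2 h)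
  simp only [id] at this
  omega

theorem cplx_proj (x : (cplx F hF δ hδ).M) (i : ℤ) (n : ℕ)
    (h : cplxEv F hF δ hδ n x = 0) : cplxEv F hF δ hδ n ((cplx F hF δ hδ).proj i x) = 0 := by
  by_cases hn : (n : ℤ) = i
  · subst hn
    have key : ∀ x, cplxEv F hF δ hδ n ((cplx F hF δ hδ).proj n x) = cplxEv F hF δ hδ n x := by
      intro x
      induction x using (cplx F hF δ hδ).ind with
      | h0 => simp
      | h j m hm =>
        by_cases hj : (n : ℤ) = j
        · subst hj; rw [(cplx F hF δ hδ).proj_same hm]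
        · rw [(cplx F hF δ hδ).proj_ne hm hj, map_zero, (cplx_mem F hF δ hδ _ _).1 hm n hj]
      | ha x y hx hy => rw [map_add, map_add, map_add, hx, hy]
    rw [key, h]
  · exact (cplx_mem F hF δ hδ _ _).1 ((cplx F hF δ hδ).proj_mem i x) n hn

theorem P_cplx {P : DGMod A 𝒜 dA → Prop} (hP : IsLocalizingClass P)
    (hPF : ∀ n : ℕ, P (conc (F n) (hF n) n)) : P (cplx F hF δ hδ) := by
  let T := cplx F hF δ hδ
  let e := cplxEv F hF δ hδ
  let S : ℕ → Submodule A T.M := fun n => ⨅ m : {m // n ≤ m}, LinearMap.ker (e m)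
  have hS : ∀ n x, x ∈ S n ↔ ∀ m, n ≤ m → e m x = 0 := by
    intro n x
    simp [S, Submodule.mem_iInf]
  have hp : ∀ n, ∀ i m, m ∈ S n → T.proj i m ∈ S n := by
    intro n i m hm
    rw [hS] at hm ⊢
    exact fun k hk => cplx_proj F hF δ hδ m i k (hm k hk)
  have hd : ∀ n, ∀ m, m ∈ S n → T.d m ∈ S n := by
    intro n m hm
    rw [hS] at hm ⊢
    intro k hk
    refine (cplx_d F hF δ hδ m k).trans ?_
    have := hm (k + 1) (by omega)
    exact (congrArg (δ k) this).trans (map_zero _)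
  have hle : ∀ n, S n ≤ S (n + 1) := by
    intro n x hx
    rw [hS] at hx ⊢
    exact fun m hm => hx m (by omega)
  refine P_telescope hP T S hp hd hle ?_ ?_
  · intro m
    obtain ⟨n, hn⟩ := cplx_bdd F hF δ hδ m
    exact ⟨n, (hS n m).2 hn⟩
  · intro n
    induction n with
    | zero =>
      refine P_acyclic hP _ ?_
      intro i m _ _
      refine ⟨0, AddSubgroup.zero_mem _, ?_⟩
      rw [map_zero]
      apply Subtype.ext
      exact cplx_ext F hF δ hδ _ _ fun k => ((hS 0 _).1 m.2 k (Nat.zero_le k)).trans (map_zero _).symm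
    | succ n ih =>
      let g : DGHom (T.sub (S (n + 1)) (hp (n + 1)) (hd (n + 1))) (conc (F n) (hF n) n) :=
        { toFun := (e n).comp (S (n + 1)).subtype
          mem := by
            intro i m hm
            refine conc_mem.2 ?_
            by_cases h : i = n
            · exact Or.inl h
            · exact Or.inr ((cplx_mem F hF δ hδ _ _).1 hm n (fun h' => h h'.symm))
          comm := by
            intro m
            change e n (T.d m.1) = 0
            refine (cplx_d F hF δ hδ m.1 n).trans ?_
            have := (hS _ _).1 m.2 (n + 1) le_rfl
            exact (congrArg (δ n) this).trans (map_zero _) }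
      refine hP.ext₂ (T.subMap (S n) (S (n + 1)) (hp n) (hd n) (hp _) (hd _) (hle n)) g
        ⟨Submodule.inclusion_injective (hle n), ?_, ?_⟩ ih (hPF n)
      · intro b
        obtain ⟨x, hx, hx'⟩ := cplx_single F hF δ hδ n b
        exact ⟨⟨x, (hS _ _).2 fun m hm => hx' m (by omega)⟩, hx⟩
      · intro x
        constructor
        · intro hx
          refine ⟨⟨x.1, (hS _ _).2 fun m hm => ?_⟩, rfl⟩
          rcases Nat.eq_or_lt_of_le hm with h | h
          · subst h; exact hx
          · exact (hS _ _).1 x.2 m h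
        · rintro ⟨y, rfl⟩
          exact (hS _ _).1 y.2 n le_rfl

end

theorem P_conc {P : DGMod A 𝒜 dA → Prop} (hP : IsLocalizingClass P)
    (H : Type) [AddCommGroup H] [Module A H] (hH : IsHMod 𝒜 dA H) (hPH : P (conc H hH 0))
    (ev : ∀ X : HModB 𝒜 dA, (X.V →₀ H) →ₗ[A] X.V) (hev : ∀ X, Function.Surjective (ev X))
    (V : Type) [AddCommGroup V] [Module A V] (hV : IsHMod 𝒜 dA V) (k : ℤ) :
    P (conc V hV k) := by
  refine conc_shift hP V hV ?_ k
  let X : ℕ → HModB 𝒜 dA := HModB.syz H hH ev ⟨V, hV⟩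
  let F : ℕ → Type := fun n => (X n).V →₀ H
  let ε : ∀ n, F n →ₗ[A] (X n).V := fun n => ev (X n)
  let κ : ∀ n, (X (n + 1)).V →ₗ[A] F n := fun n => (LinearMap.ker (ε n)).subtype
  have hε : ∀ n, Function.Surjective (ε n) := fun n => hev _
  have hκ : ∀ n, Function.Injective (κ n) := fun n => Subtype.val_injective
  have hεκ : ∀ n x, ε n (κ n x) = 0 := fun n x => x.2
  have hκε : ∀ n y, ε n y = 0 → ∃ x, κ n x = y := fun n y hy => ⟨⟨y, hy⟩, rfl⟩
  have hF : ∀ n, IsHMod 𝒜 dA (F n) := fun n => hH.finsupp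
  let δ : ∀ n, F (n + 1) →ₗ[A] F n := fun n => (κ n).comp (ε (n + 1))
  have hδ : ∀ n x, δ n (δ (n + 1) x) = 0 := by
    intro n x
    change κ n (ε (n + 1) (κ (n + 1) _)) = 0
    rw [hεκ, map_zero]
  have hPT : P (cplx F hF δ hδ) :=
    P_cplx F hF δ hδ hP fun n => P_free hP hH n (conc_shift hP H hH hPH n) _ (hF n)
  let f : DGHom (cplx F hF δ hδ) (conc V hV 0) :=
    { toFun := (ε 0).comp (cplxEv F hF δ hδ 0)
      mem := by
        intro i m hm
        refine conc_mem.2 ?_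
        by_cases h : i = 0
        · exact Or.inl h
        · refine Or.inr ?_
          have := (cplx_mem F hF δ hδ m i).1 hm 0 (by simpa using fun h' => h h'.symm)
          exact (congrArg (ε 0) this).trans (map_zero _)
      comm := by
        intro m
        exact hεκ 0 _ }
  refine (hP.qis f ⟨?_, ?_⟩).1 hPT
  · intro i z hz _
    rcases conc_mem.1 hz with h | h
    · subst h
      obtain ⟨y, hy⟩ := hε 0 z
      obtain ⟨x, hx, hx'⟩ := cplx_single F hF δ hδ 0 y
      refine ⟨x, 0, ?_, ?_, AddSubgroup.zero_mem _, ?_⟩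
      · exact (cplx_mem F hF δ hδ x 0).2 fun n hn => hx' n (by simpa using hn)
      · refine cplx_ext F hF δ hδ _ _ fun n => ?_
        rw [cplx_d, hx' (n + 1) (by omega), map_zero, map_zero]
      · rw [map_zero, add_zero]
        exact (congrArg (ε 0) hx).trans hy
    · refine ⟨0, 0, AddSubgroup.zero_mem _, map_zero _, AddSubgroup.zero_mem _, ?_⟩
      rw [map_zero, map_zero, add_zero]
      exact h.symm
  · intro i z hz hdz hfz
    obtain ⟨w, _, hw⟩ := hfz
    have hz' := (cplx_mem F hF δ hδ z i).1 hz
    by_cases hi : i < 0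
    · refine ⟨0, AddSubgroup.zero_mem _, ?_⟩
      rw [map_zero]
      refine cplx_ext F hF δ hδ _ _ fun n => ?_
      rw [hz' n (by omega), map_zero]
    · obtain ⟨n, rfl⟩ := Int.eq_ofNat_of_zero_le (not_lt.1 hi)
      have hεz : ε n (cplxEv F hF δ hδ n z) = 0 := by
        cases n with
        | zero => exact hw
        | succ n =>
          apply hκ n
          rw [map_zero]
          refine (cplx_d F hF δ hδ z n).symm.trans ?_
          rw [hdz, map_zero]
      obtain ⟨x, hx⟩ := hκε n _ hεz
      obtain ⟨y, hy⟩ := hε (n + 1) x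
      obtain ⟨v, hv, hv'⟩ := cplx_single F hF δ hδ (n + 1) y
      refine ⟨v, ?_, ?_⟩
      · exact (cplx_mem F hF δ hδ v _).2 fun m hm => hv' m (by omega)
      · refine cplx_ext F hF δ hδ _ _ fun m => ?_
        rw [cplx_d]
        by_cases hm : m = n
        · subst hm
          rw [hv]
          change _ = κ m (ε (m + 1) y)
          rw [hy, hx]
        · rw [hv' (m + 1) (by omega), map_zero, hz' m (by omega)]

end Resolution

section Truncation

variable (hA : IsDGAlgebra A 𝒜 dA) (hnonneg : ∀ i : ℤ, i < 0 → 𝒜 i = ⊥)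

theorem A_ind (hA : IsDGAlgebra A 𝒜 dA) (p : A → Prop) (h0 : p 0) (h1 : ∀ i : ℤ, ∀ a ∈ 𝒜 i, p a)
    (h2 : ∀ a b, p a → p b → p (a + b)) : ∀ a, p a :=
  (aMod hA).ind (p := fun a : A => p a) h0 (fun i a ha => h1 i a ha) (fun a b => h2 a b)

theorem exists_q (hA : IsDGAlgebra A 𝒜 dA) : ∃ q : A →+ A, (∀ y, q y ∈ 𝒜 0) ∧ (∀ y ∈ 𝒜 0, q y = y) ∧
    (∀ i : ℤ, i ≠ 0 → ∀ y ∈ 𝒜 i, q y = 0) :=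
  ⟨(aMod hA).proj 0, fun y => (aMod hA).proj_mem 0 y, fun y hy => (aMod hA).proj_same hy,
    fun i hi y hy => (aMod hA).proj_ne hy (fun h => hi h.symm)⟩

theorem trunc_smul (hA : IsDGAlgebra A 𝒜 dA)
    (hnonneg : ∀ i : ℤ, i < 0 → 𝒜 i = ⊥) (M : DGMod A 𝒜 dA) (k : ℤ) (B : AddSubgroup M.M)
    (hB : ∀ a ∈ 𝒜 0, ∀ b ∈ B, a • b ∈ B) (a : A) (m : M.M)
    (hm : (∀ i < k, M.proj i m = 0) ∧ M.proj k m ∈ B) :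
    (∀ i < k, M.proj i (a • m) = 0) ∧ M.proj k (a • m) ∈ B := by
  revert a
  refine A_ind hA (fun a : A => (∀ i < k, M.proj i (a • m) = 0) ∧
    M.proj k (a • m) ∈ B) ?_ ?_ ?_
  · have : (0 : A) • m = 0 := zero_smul _ _
    refine ⟨fun i _ => ?_, ?_⟩
    · exact (congrArg _ this).trans (map_zero _)
    · have h : M.proj k ((0 : A) • m) = 0 := (congrArg _ this).trans (map_zero _)
      exact h.symm ▸ AddSubgroup.zero_mem B
  · intro j a ha
    by_cases hj : j < 0
    · rw [hnonneg j hj] at ha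
      rw [(AddSubgroup.mem_bot).1 ha, zero_smul]
      exact ⟨fun i _ => map_zero _, by rw [map_zero]; exact AddSubgroup.zero_mem _⟩
    · refine ⟨fun i hi => ?_, ?_⟩
      · rw [M.proj_smul ha, hm.1 _ (by omega), smul_zero]
      · rw [M.proj_smul ha]
        by_cases h0 : j = 0
        · subst h0
          rw [sub_zero]
          exact hB a ha _ hm.2
        · rw [hm.1 _ (by omega), smul_zero]
          exact AddSubgroup.zero_mem _
  · intro a b h1 h2
    have : (a + b) • m = a • m + b • m := add_smul _ _ _
    refine ⟨fun i hi => ?_, ?_⟩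
    · refine (congrArg _ this).trans ?_
      rw [map_add, h1.1 i hi, h2.1 i hi, add_zero]
    · have h : M.proj k ((a + b) • m) = _ := congrArg _ this
      rw [map_add] at h
      exact h.symm ▸ AddSubgroup.add_mem B h1.2 h2.2

/-- The truncation of `M` with everything above degree `k` and `B` in degree `k`. -/
def trunc (M : DGMod A 𝒜 dA) (k : ℤ) (B : AddSubgroup M.M)
    (hB : ∀ a ∈ 𝒜 0, ∀ b ∈ B, a • b ∈ B) : Submodule A M.M where
  carrier := {m | (∀ i < k, M.proj i m = 0) ∧ M.proj k m ∈ B}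
  zero_mem' := ⟨fun _ _ => map_zero _, by rw [map_zero]; exact AddSubgroup.zero_mem _⟩
  add_mem' := fun {x y} hx hy => ⟨fun i hi => by rw [map_add, hx.1 i hi, hy.1 i hi, add_zero],
    by rw [map_add]; exact AddSubgroup.add_mem _ hx.2 hy.2⟩
  smul_mem' := fun a m hm => trunc_smul hA hnonneg M k B hB a m hm

theorem mem_trunc (M : DGMod A 𝒜 dA) (k : ℤ) (B : AddSubgroup M.M)
    (hB : ∀ a ∈ 𝒜 0, ∀ b ∈ B, a • b ∈ B) (m : M.M) : m ∈ trunc hA hnonneg M k B hB ↔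
      (∀ i < k, M.proj i m = 0) ∧ M.proj k m ∈ B := Iff.rfl

theorem trunc_proj (M : DGMod A 𝒜 dA) (k : ℤ) (B : AddSubgroup M.M)
    (hB : ∀ a ∈ 𝒜 0, ∀ b ∈ B, a • b ∈ B) (i : ℤ) (m : M.M)
    (hm : m ∈ trunc hA hnonneg M k B hB) : M.proj i m ∈ trunc hA hnonneg M k B hB := by
  refine ⟨fun j hj => ?_, ?_⟩
  · rw [M.proj_proj]
    split_ifs with h
    · subst h; exact hm.1 _ hj
    · rfl
  · rw [M.proj_proj]
    split_ifs with h
    · subst h; exact hm.2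
    · exact AddSubgroup.zero_mem _

theorem trunc_d (M : DGMod A 𝒜 dA) (k : ℤ) (B : AddSubgroup M.M)
    (hB : ∀ a ∈ 𝒜 0, ∀ b ∈ B, a • b ∈ B) (h1 : ∀ m, M.d m ∈ B) (h2 : ∀ m ∈ B, M.d m = 0)
    (m : M.M) (hm : m ∈ trunc hA hnonneg M k B hB) : M.d m ∈ trunc hA hnonneg M k B hB := by
  refine ⟨fun j hj => ?_, ?_⟩
  · rw [M.proj_d]
    by_cases h : j + 1 = k
    · rw [h]; exact h2 _ hm.2
    · rw [hm.1 _ (by omega), map_zero]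
  · rw [M.proj_d]
    exact h1 _

theorem trunc_mem_of_gt (M : DGMod A 𝒜 dA) (k : ℤ) (B : AddSubgroup M.M)
    (hB : ∀ a ∈ 𝒜 0, ∀ b ∈ B, a • b ∈ B) {i : ℤ} (hi : k < i) {m : M.M} (hm : m ∈ M.ℳ i) :
    m ∈ trunc hA hnonneg M k B hB := by
  refine ⟨fun j hj => M.proj_ne hm (by omega), ?_⟩
  rw [M.proj_ne hm (by omega)]
  exact AddSubgroup.zero_mem _

theorem trunc_mem_of_eq (M : DGMod A 𝒜 dA) (k : ℤ) (B : AddSubgroup M.M)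
    (hB : ∀ a ∈ 𝒜 0, ∀ b ∈ B, a • b ∈ B) {m : M.M} (hm : m ∈ M.ℳ k) (hmB : m ∈ B) :
    m ∈ trunc hA hnonneg M k B hB := by
  refine ⟨fun j hj => M.proj_ne hm (by omega), ?_⟩
  rwa [M.proj_same hm]

theorem d_smul_zero (hA : IsDGAlgebra A 𝒜 dA)
    (hnonneg : ∀ i : ℤ, i < 0 → 𝒜 i = ⊥) (M : DGMod A 𝒜 dA) (a : A) (ha : a ∈ 𝒜 0) (m : M.M) :
    M.d (a • m) = a • M.d m := by
  have h0 : dA a = 0 := by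
    have := hA.d_mem ha
    rw [hnonneg _ (by omega)] at this
    exact (AddSubgroup.mem_bot).1 this
  rw [M.leibniz a m ha, h0]
  simp

theorem kerB (hA : IsDGAlgebra A 𝒜 dA)
    (hnonneg : ∀ i : ℤ, i < 0 → 𝒜 i = ⊥) (M : DGMod A 𝒜 dA) : ∀ a ∈ 𝒜 0, ∀ b ∈ M.d.ker, a • b ∈ M.d.ker := by
  intro a ha b hb
  rw [AddMonoidHom.mem_ker] at hb ⊢
  rw [d_smul_zero hA hnonneg M a ha, hb, smul_zero]

theorem rangeB (hA : IsDGAlgebra A 𝒜 dA)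
    (hnonneg : ∀ i : ℤ, i < 0 → 𝒜 i = ⊥) (M : DGMod A 𝒜 dA) : ∀ a ∈ 𝒜 0, ∀ b ∈ M.d.range, a • b ∈ M.d.range := by
  rintro a ha _ ⟨b, rfl⟩
  exact ⟨a • b, d_smul_zero hA hnonneg M a ha b⟩

/-- good truncation -/
noncomputable def tau (M : DGMod A 𝒜 dA) (k : ℤ) : DGMod A 𝒜 dA :=
  M.sub (trunc hA hnonneg M k M.d.ker (kerB hA hnonneg M))
    (trunc_proj hA hnonneg M k _ _)
    (trunc_d hA hnonneg M k _ _ (fun m => M.d_sq m) (fun _ hm => hm))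

/-- good truncation modulo homology in the bottom degree -/
noncomputable def tauB (M : DGMod A 𝒜 dA) (k : ℤ) : DGMod A 𝒜 dA :=
  M.sub (trunc hA hnonneg M k M.d.range (rangeB hA hnonneg M))
    (trunc_proj hA hnonneg M k _ _)
    (trunc_d hA hnonneg M k _ _ (fun m => ⟨m, rfl⟩)
      (fun _ hm => by obtain ⟨y, rfl⟩ := hm; exact M.d_sq y))

theorem trunc_le_tauB (M : DGMod A 𝒜 dA) (k : ℤ) :
    trunc hA hnonneg M (k + 1) M.d.ker (kerB hA hnonneg M) ≤
      trunc hA hnonneg M k M.d.range (rangeB hA hnonneg M) := by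
  intro m hm
  refine ⟨fun i hi => hm.1 i (by omega), ?_⟩
  rw [hm.1 k (by omega)]
  exact AddSubgroup.zero_mem _

theorem trunc_range_le_ker (M : DGMod A 𝒜 dA) (k : ℤ) :
    trunc hA hnonneg M k M.d.range (rangeB hA hnonneg M) ≤
      trunc hA hnonneg M k M.d.ker (kerB hA hnonneg M) := by
  intro m hm
  refine ⟨hm.1, ?_⟩
  obtain ⟨y, hy⟩ := hm.2
  rw [← hy]
  exact M.d_sq y

/-- every boundary of degree `i` is the boundary of an element of degree `i+1` -/
theorem exists_homog (M : DGMod A 𝒜 dA) {i : ℤ} {m : M.M} (hm : m ∈ M.ℳ i)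
    (h : m ∈ M.d.range) : ∃ y ∈ M.ℳ (i + 1), M.d y = m := by
  obtain ⟨y, hy⟩ := h
  refine ⟨M.proj (i + 1) y, M.proj_mem _ _, ?_⟩
  rw [← M.proj_d, hy, M.proj_same hm]

theorem P_tauB {P : DGMod A 𝒜 dA → Prop} (hP : IsLocalizingClass P) (M : DGMod A 𝒜 dA) (k : ℤ)
    (h : P (tau hA hnonneg M (k + 1))) : P (tauB hA hnonneg M k) := by
  let f : DGHom (tau hA hnonneg M (k + 1)) (tauB hA hnonneg M k) :=
    M.subMap _ _ _ _ _ _ (trunc_le_tauB hA hnonneg M k)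
  refine (hP.qis f ⟨?_, ?_⟩).1 h
  · rintro i ⟨z, hzt⟩ hz hdz
    change z ∈ M.ℳ i at hz
    have hdz : M.d z = 0 := congrArg Subtype.val hdz
    rcases lt_trichotomy i k with hi | hi | hi
    · have hz0 : z = 0 := by rw [← M.proj_same hz, hzt.1 i hi]
      subst hz0
      refine ⟨0, 0, AddSubgroup.zero_mem _, map_zero _, AddSubgroup.zero_mem _, ?_⟩
      apply Subtype.ext
      change (0 : M.M) = 0 + M.d 0
      rw [map_zero, add_zero]
    · subst hi
      have hzr : z ∈ M.d.range := by
        have := hzt.2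
        rwa [M.proj_same hz] at this
      obtain ⟨y, hy, hyz⟩ := exists_homog M hz hzr
      refine ⟨0, ⟨-y, Submodule.neg_mem _ (trunc_mem_of_gt hA hnonneg M i _ _ (by omega) hy)⟩,
        AddSubgroup.zero_mem _, map_zero _, AddSubgroup.neg_mem _ hy, ?_⟩
      apply Subtype.ext
      change (0 : M.M) = z + M.d (-y)
      rw [map_neg, hyz, add_neg_cancel]
    · have hz' : z ∈ trunc hA hnonneg M (k + 1) M.d.ker (kerB hA hnonneg M) := by
        rcases eq_or_lt_of_le (Int.add_one_le_iff.2 hi) with h | h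
        · subst h; exact trunc_mem_of_eq hA hnonneg M _ _ _ hz hdz
        · exact trunc_mem_of_gt hA hnonneg M _ _ _ h hz
      refine ⟨⟨z, hz'⟩, 0, hz, Subtype.ext hdz, AddSubgroup.zero_mem _, ?_⟩
      apply Subtype.ext
      change z = z + M.d 0
      rw [map_zero, add_zero]
  · rintro i ⟨z, hzt⟩ hz hdz ⟨⟨w, hwt⟩, hw, hzw⟩
    change z ∈ M.ℳ i at hz
    change w ∈ M.ℳ (i + 1) at hw
    have hzw : z = M.d w := congrArg Subtype.val hzw
    by_cases hi : k < i
    · exact ⟨⟨w, trunc_mem_of_gt hA hnonneg M _ _ _ (by omega) hw⟩, hw, Subtype.ext hzw⟩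
    · have hz0 : z = 0 := by rw [← M.proj_same hz, hzt.1 i (by omega)]
      subst hz0
      refine ⟨0, AddSubgroup.zero_mem _, ?_⟩
      rw [map_zero]
      rfl

theorem P_tau_step {P : DGMod A 𝒜 dA → Prop} (hP : IsLocalizingClass P)
    (hconc : ∀ (V : Type) [AddCommGroup V] [Module A V] (hV : IsHMod 𝒜 dA V) (k : ℤ),
      P (conc V hV k))
    (M : DGMod A 𝒜 dA) (k : ℤ)
    (h : P (tau hA hnonneg M (k + 1))) : P (tau hA hnonneg M k) := by
  have hB := P_tauB hA hnonneg hP M k h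
  let τ := trunc hA hnonneg M k M.d.ker (kerB hA hnonneg M)
  let β := trunc hA hnonneg M k M.d.range (rangeB hA hnonneg M)
  let K : Submodule A τ := β.comap τ.subtype
  have hK : ∀ x : τ, x ∈ K ↔ M.proj k x.1 ∈ M.d.range := fun x =>
    ⟨fun h => h.2, fun h => ⟨x.2.1, h⟩⟩
  have hV : IsHMod 𝒜 dA (τ ⧸ K) := by
    refine ⟨?_, ?_⟩
    · intro i hi a ha v
      obtain ⟨x, rfl⟩ := K.mkQ_surjective v
      rw [← map_smul, Submodule.mkQ_apply, Submodule.Quotient.mk_eq_zero, hK]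
      change M.proj k (a • x.1) ∈ _
      by_cases hi' : i < 0
      · rw [hnonneg i hi'] at ha
        rw [(AddSubgroup.mem_bot).1 ha, zero_smul, map_zero]
        exact AddSubgroup.zero_mem _
      · rw [M.proj_smul ha, x.2.1 _ (by omega), smul_zero]
        exact AddSubgroup.zero_mem _
    · intro i a ha v
      obtain ⟨x, rfl⟩ := K.mkQ_surjective v
      rw [← map_smul, Submodule.mkQ_apply, Submodule.Quotient.mk_eq_zero, hK]
      change M.proj k (dA a • x.1) ∈ _
      rw [M.proj_smul (hA.d_mem ha)]
      by_cases hi : i < 1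
      · have := hA.d_mem ha
        rw [hnonneg _ (by omega)] at this
        rw [(AddSubgroup.mem_bot).1 this, zero_smul]
        exact AddSubgroup.zero_mem _
      by_cases hi : i = 1
      · subst hi
        rw [sub_self, sub_zero]
        have h1 := M.leibniz a (M.proj k x.1) ha
        have h2 : M.d (M.proj k x.1) = 0 := x.2.2
        rw [h2, smul_zero, smul_zero, add_zero] at h1
        exact ⟨_, h1⟩
      · rw [x.2.1 _ (by omega), smul_zero]
        exact AddSubgroup.zero_mem _
  let f : DGHom (tauB hA hnonneg M k) (tau hA hnonneg M k) :=
    M.subMap _ _ _ _ _ _ (trunc_range_le_ker hA hnonneg M k)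
  let g : DGHom (tau hA hnonneg M k) (conc (τ ⧸ K) hV k) :=
    { toFun := K.mkQ
      mem := by
        intro i m hm
        refine conc_mem.2 ?_
        by_cases hi : i = k
        · exact Or.inl hi
        · refine Or.inr ((Submodule.Quotient.mk_eq_zero K).2 ((hK _).2 ?_))
          have : M.proj k (m.1 : M.M) = 0 := M.proj_ne hm (fun h => hi h.symm)
          exact this.symm ▸ AddSubgroup.zero_mem _
      comm := by
        intro m
        refine (Submodule.Quotient.mk_eq_zero K).2 ((hK _).2 ?_)
        have : M.proj k (M.d (m.1 : M.M)) = _ := M.proj_d k m.1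
        exact ⟨_, this.symm⟩ }
  refine hP.ext₂ f g ⟨Submodule.inclusion_injective (trunc_range_le_ker hA hnonneg M k), K.mkQ_surjective, ?_⟩ hB (hconc _ hV k)
  intro x
  refine (Submodule.Quotient.mk_eq_zero K).trans ?_
  constructor
  · intro hx
    exact ⟨⟨x.1, hx⟩, rfl⟩
  · rintro ⟨y, rfl⟩
    exact y.2

theorem P_bounded (hA : IsDGAlgebra A 𝒜 dA)
    (hnonneg : ∀ i : ℤ, i < 0 → 𝒜 i = ⊥) {P : DGMod A 𝒜 dA → Prop} (hP : IsLocalizingClass P)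
    (hconc : ∀ (V : Type) [AddCommGroup V] [Module A V] (hV : IsHMod 𝒜 dA V) (k : ℤ),
      P (conc V hV k))
    (M : DGMod A 𝒜 dA) (n : ℕ) (hM : ∀ i : ℤ, (n : ℤ) ≤ |i| → HVanish M i) : P M := by
  have hM' : ∀ i : ℤ, (n : ℤ) ≤ |i| → ∀ z ∈ M.ℳ i, M.d z = 0 → ∃ y ∈ M.ℳ (i + 1), M.d y = z := by
    intro i hi z hz hdz
    obtain ⟨y, hy, h⟩ := hM i hi ⟨hz, hdz⟩
    exact ⟨y, hy, h⟩
  have htop : P (tau hA hnonneg M n) := by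
    refine P_acyclic hP _ ?_
    rintro i ⟨z, hzt⟩ hz hdz
    change z ∈ M.ℳ i at hz
    have hdz : M.d z = 0 := congrArg Subtype.val hdz
    by_cases hi : i < n
    · have hz0 : z = 0 := by rw [← M.proj_same hz, hzt.1 i (by omega)]
      subst hz0
      refine ⟨0, AddSubgroup.zero_mem _, ?_⟩
      rw [map_zero]
      rfl
    · obtain ⟨y, hy, h⟩ := hM' i (le_trans (not_lt.1 hi) (le_abs_self i)) z hz hdz
      exact ⟨⟨y, trunc_mem_of_gt hA hnonneg M _ _ _ (by omega) hy⟩, hy, Subtype.ext h.symm⟩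
  have hall : ∀ j : ℕ, P (tau hA hnonneg M ((n : ℤ) - j)) := by
    intro j
    induction j with
    | zero => simpa using htop
    | succ j ih =>
      refine P_tau_step hA hnonneg hP hconc M _ ?_
      have : (n : ℤ) - ((j + 1 : ℕ) : ℤ) + 1 = n - j := by push_cast; ring
      rwa [this]
  have hbot := hall (2 * n)
  have hk : (n : ℤ) - ((2 * n : ℕ) : ℤ) = -n := by push_cast; ring
  rw [hk] at hbot
  let f : DGHom (tau hA hnonneg M (-n)) M := M.subIncl _ _ _
  refine (hP.qis f ⟨?_, ?_⟩).1 hbot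
  · intro i z hz hdz
    by_cases hi : i < -n
    · obtain ⟨y, hy, h⟩ := hM' i (le_trans (by omega) (neg_le_abs i)) z hz hdz
      refine ⟨0, -y, AddSubgroup.zero_mem _, map_zero _, AddSubgroup.neg_mem _ hy, ?_⟩
      rw [map_zero, map_neg, h, add_neg_cancel]
    · have hz' : z ∈ trunc hA hnonneg M (-n) M.d.ker (kerB hA hnonneg M) := by
        rcases eq_or_lt_of_le (not_lt.1 hi) with h | h
        · subst h; exact trunc_mem_of_eq hA hnonneg M _ _ _ hz hdz
        · exact trunc_mem_of_gt hA hnonneg M _ _ _ h hz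
      refine ⟨⟨z, hz'⟩, 0, hz, Subtype.ext hdz, AddSubgroup.zero_mem _, ?_⟩
      rw [map_zero, add_zero]
      rfl
  · rintro i ⟨z, hzt⟩ hz hdz ⟨w, hw, hzw⟩
    change z ∈ M.ℳ i at hz
    have hzw : z = M.d w := hzw
    by_cases hi : -(n : ℤ) ≤ i
    · exact ⟨⟨w, trunc_mem_of_gt hA hnonneg M _ _ _ (by omega) hw⟩, hw, Subtype.ext hzw⟩
    · have hz0 : z = 0 := by rw [← M.proj_same hz, hzt.1 i (by omega)]
      subst hz0
      refine ⟨0, AddSubgroup.zero_mem _, ?_⟩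
      rw [map_zero]
      rfl

theorem HZero_ev (Z : DGMod A 𝒜 dA) (hZ : IsHZero hA Z) (X : HModB 𝒜 dA) :
    ∃ e : (X.V →₀ Z.M) →ₗ[A] X.V, Function.Surjective e := by
  obtain ⟨hconc, hd, π, hπ, hker⟩ := hZ
  let p : A →ₗ[A] Z.M := π.toFun
  have hp : Function.Surjective p := hπ
  obtain ⟨q, hq0, hq1, hq2⟩ := exists_q hA
  have hkill : ∀ (v : X.V), LinearMap.ker p ≤ LinearMap.ker (LinearMap.toSpanSingleton A X.V v) := by
    intro v x hx
    rw [LinearMap.mem_ker] at hx ⊢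
    rw [LinearMap.toSpanSingleton_apply]
    have hgen : ∀ y : A, y • v = q y • v := by
      refine A_ind hA _ ?_ ?_ ?_
      · rw [map_zero]
      · intro i y hy
        by_cases hi : i = 0
        · subst hi
          rw [hq1 y hy]
        · rw [hq2 i hi y hy, zero_smul]
          exact X.prop.zero i hi y hy v
      · intro y z hy hz
        rw [map_add, add_smul, add_smul, hy, hz]
    have hp0 : ∀ y : A, p y = p (q y) := by
      refine A_ind hA _ ?_ ?_ ?_
      · rw [map_zero q]
      · intro i y hy
        by_cases hi : i = 0
        · subst hi
          rw [hq1 y hy]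
        · rw [hq2 i hi y hy, map_zero]
          have := π.mem hy
          rw [hconc i hi] at this
          exact (AddSubgroup.mem_bot).1 this
      · intro y z hy hz
        rw [map_add q, map_add p, map_add p, hy, hz]
    rw [hgen x]
    rw [hp0] at hx
    obtain ⟨y, hy, hyx⟩ := (hker _ (hq0 x)).1 hx
    rw [← hyx]
    exact X.prop.dzero 1 y hy v
  let ψ : X.V → (Z.M →ₗ[A] X.V) := fun v =>
    ((LinearMap.ker p).liftQ (LinearMap.toSpanSingleton A X.V v) (hkill v)).comp
      (p.quotKerEquivOfSurjective hp).symm.toLinearMap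
  have hψ : ∀ v a, ψ v (p a) = a • v := by
    intro v a
    have : (p.quotKerEquivOfSurjective hp).symm (p a) = (LinearMap.ker p).mkQ a := by
      rw [LinearEquiv.symm_apply_eq]
      rfl
    change (LinearMap.ker p).liftQ _ (hkill v) ((p.quotKerEquivOfSurjective hp).symm (p a)) = _
    rw [this]
    rfl
  refine ⟨Finsupp.lsum ℕ ψ, fun v => ⟨Finsupp.single v (p 1), ?_⟩⟩
  rw [Finsupp.lsum_single, hψ, one_smul]

end Truncation

theorem h0_builds_bounded_homology
    (hA : IsDGAlgebra A 𝒜 dA)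
    (hnonneg : ∀ i : ℤ, i < 0 → 𝒜 i = ⊥)
    (M : DGMod A 𝒜 dA)
    (hM : ∃ n : ℕ, ∀ i : ℤ, (n : ℤ) ≤ |i| → HVanish M i)
    (Z : DGMod A 𝒜 dA) (hZ : IsHZero hA Z) :
    Builds Z M := by
  obtain ⟨n, hn⟩ := hM
  intro P hP hPZ
  have hH : IsHMod 𝒜 dA Z.M := isHMod_of_conc Z 0 hZ.1
  have hPH : P (conc Z.M hH 0) := by
    let f : DGHom (conc Z.M hH 0) Z :=
      { toFun := LinearMap.id
        mem := by
          intro i m hm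
          rcases conc_mem.1 hm with h | h
          · subst h
            have hall : ∀ m : Z.M, m ∈ Z.ℳ 0 := by
              intro m
              induction m using Z.ind with
              | h0 => exact AddSubgroup.zero_mem _
              | h i m hm =>
                by_cases h : i = 0
                · rwa [← h]
                · rw [hZ.1 i h] at hm
                  rw [(AddSubgroup.mem_bot).1 hm]; exact AddSubgroup.zero_mem _
              | ha x y hx hy => exact AddSubgroup.add_mem _ hx hy
            exact hall m
          · rw [h]; exact AddSubgroup.zero_mem _
        comm := by
          intro m
          rw [hZ.2.1]
          rfl }
    refine (hP.qis f ⟨?_, ?_⟩).2 hPZ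
    · intro i z hz _
      refine ⟨z, 0, ?_, rfl, AddSubgroup.zero_mem _, ?_⟩
      · refine conc_mem.2 ?_
        by_cases h : i = 0
        · exact Or.inl h
        · rw [hZ.1 i h] at hz
          exact Or.inr ((AddSubgroup.mem_bot).1 hz)
      · rw [map_zero, add_zero]
        rfl
    · rintro i z _ _ ⟨w, _, hw⟩
      rw [hZ.2.1] at hw
      exact ⟨0, AddSubgroup.zero_mem _, hw⟩
  choose ev hev using HZero_ev hA Z hZ
  exact P_bounded hA hnonneg hP
    (fun V _ _ hV k => P_conc hP Z.M hH hPH ev hev V hV k) M n hn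
end
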